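/- arXiv:1602.05379 — 8 statements merged into one kernel-verified Lean document; each statement's English description precedes it below -/
import Mathlib

section
/- Let (A, m) be a noetherian local ring with residue field k = A/m and Krull dimension n = dim A. Then the following are equivalent: (i) dim_k(m/m²) = n; (ii) Tor_i^A(k, k) = 0 for all sufficiently large i. -/
/-!
STATEMENT 0: Let (A, m) be a noetherian local ring with residue field k = A/m and
Krull dimension n = dim A. Then the following are equivalent:
(i) dim_k(m/m²) = n; (ii) Tor_i^A(k, k) = 0 for all sufficiently large i.
-/

open CategoryTheory Limits IsLocalRing

universe u

namespace RegTor

lemma exists_avoid {A : Type u} [CommRing A] [IsNoetherianRing A] [IsLocalRing A]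
    (hm : maximalIdeal A ≠ ⊥) (s : Set (Ideal A)) (hs : s.Finite)
    (hp : ∀ p ∈ s, p.IsPrime) (hne : ∀ p ∈ s, ¬ maximalIdeal A ≤ p) :
    ∃ x ∈ maximalIdeal A, x ∉ maximalIdeal A ^ 2 ∧ ∀ p ∈ s, x ∉ p := by
  have h2 : ¬ maximalIdeal A ≤ maximalIdeal A ^ 2 := by
    intro h
    apply hm
    apply Submodule.eq_bot_of_le_smul_of_le_jacobson_bot (maximalIdeal A) _
      (IsNoetherian.noetherian _)
    · rwa [smul_eq_mul, ← pow_two]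
    · rw [IsLocalRing.jacobson_eq_maximalIdeal _ bot_ne_top]
  by_contra! hcon
  have := (Ideal.subset_union_prime_finite (hs.insert (maximalIdeal A ^ 2)) (f := id)
    (maximalIdeal A ^ 2) (maximalIdeal A ^ 2) (by
      intro i hi h _
      rcases hi with rfl | hi
      · exact absurd rfl h
      · exact hp i hi) (I := maximalIdeal A)).1 (by
      intro x hx
      simp only [Set.mem_iUnion, id]
      by_cases hx2 : x ∈ maximalIdeal A ^ 2
      · exact ⟨_, Set.mem_insert _ _, hx2⟩
      · obtain ⟨p, h1, h2⟩ := hcon x hx hx2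
        exact ⟨p, Set.mem_insert_of_mem _ h1, h2⟩)
  obtain ⟨i, hi, hle⟩ := this
  rcases hi with rfl | hi
  · exact h2 hle
  · exact hne i hi hle

lemma isLocalRing_quot {A : Type u} [CommRing A] [IsLocalRing A] {x : A}
    (hx : x ∈ maximalIdeal A) : IsLocalRing (A ⧸ Ideal.span {x}) := by
  have : Nontrivial (A ⧸ Ideal.span {x}) := by
    apply Ideal.Quotient.nontrivial_iff.mpr
    intro h
    have : Ideal.span {x} ≤ maximalIdeal A := by
      rwa [Ideal.span_singleton_le_iff_mem]
    rw [h] at this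
    exact (maximalIdeal.isMaximal A).ne_top (top_le_iff.mp this)
  exact IsLocalRing.of_surjective' (Ideal.Quotient.mk _) Ideal.Quotient.mk_surjective

lemma edim_le {A : Type u} [CommRing A] [IsNoetherianRing A] [IsLocalRing A] {x : A}
    (hx : x ∈ maximalIdeal A) [IsLocalRing (A ⧸ Ideal.span {x})] :
    (maximalIdeal A).spanFinrank ≤ (maximalIdeal (A ⧸ Ideal.span {x})).spanFinrank + 1 := by
  classical
  obtain ⟨s, hs, hspan⟩ := Submodule.FG.exists_span_finset_card_eq_spanFinrank
    (IsNoetherian.noetherian (maximalIdeal (A ⧸ Ideal.span {x})))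
  choose g hg using Ideal.Quotient.mk_surjective (I := Ideal.span {x})
  have hmap := IsLocalRing.map_maximalIdeal_of_surjective (Ideal.Quotient.mk (Ideal.span {x}))
    Ideal.Quotient.mk_surjective
  have key : maximalIdeal A = Ideal.span ((insert x (s.image g) : Finset A) : Set A) := by
    have h1 : (Ideal.span ((insert x (s.image g) : Finset A) : Set A)).map
        (Ideal.Quotient.mk (Ideal.span {x})) = (maximalIdeal A).map
        (Ideal.Quotient.mk (Ideal.span {x})) := by
      rw [hmap, Ideal.map_span, ← hspan]
      have : (Ideal.Quotient.mk (Ideal.span {x})) x = 0 := by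
        rw [Ideal.Quotient.eq_zero_iff_mem]; exact Ideal.mem_span_singleton_self x
      simp only [Finset.coe_insert, Finset.coe_image, Set.image_insert_eq, Set.image_image, hg,
        Set.image_id', this]
      exact Submodule.span_insert_zero
    have h2 := congrArg (Ideal.comap (Ideal.Quotient.mk (Ideal.span {x}))) h1
    rw [Ideal.comap_map_of_surjective _ Ideal.Quotient.mk_surjective,
      Ideal.comap_map_of_surjective _ Ideal.Quotient.mk_surjective, ← RingHom.ker_eq_comap_bot,
      Ideal.mk_ker, sup_eq_left.mpr, sup_eq_left.mpr] at h2
    · exact h2.symm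
    · rwa [Ideal.span_singleton_le_iff_mem]
    · exact Ideal.span_mono (by simp)
  rw [key]
  refine (Submodule.spanFinrank_span_le_ncard_of_finite (Finset.finite_toSet _)).trans ?_
  rw [Set.ncard_coe_finset]
  refine (Finset.card_insert_le _ _).trans ?_
  have := Finset.card_image_le (s := s) (f := g)
  omega

lemma edim_quot_lt {A : Type u} [CommRing A] [IsNoetherianRing A] [IsLocalRing A] {x : A}
    (hx : x ∈ maximalIdeal A) (hx2 : x ∉ maximalIdeal A ^ 2) [IsLocalRing (A ⧸ Ideal.span {x})] :
    (maximalIdeal (A ⧸ Ideal.span {x})).spanFinrank + 1 ≤ (maximalIdeal A).spanFinrank := by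
  classical
  obtain ⟨s, hs, hspan⟩ := Submodule.FG.exists_span_finset_card_eq_spanFinrank
    (IsNoetherian.noetherian (maximalIdeal A))
  have hmap := IsLocalRing.map_maximalIdeal_of_surjective (Ideal.Quotient.mk (Ideal.span {x}))
    Ideal.Quotient.mk_surjective
  have hx' := hx
  rw [← hspan] at hx'
  obtain ⟨a, -, ha⟩ := Submodule.mem_span_finset.mp hx'
  have : ∃ i ∈ s, IsUnit (a i) := by
    by_contra! h
    apply hx2
    rw [← ha, pow_two]
    refine Ideal.sum_mem _ fun i hi ↦ Ideal.mul_mem_mul ((mem_maximalIdeal _).mpr (h i hi)) ?_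
    rw [← hspan]
    exact Submodule.subset_span hi
  obtain ⟨i, hi, hu⟩ := this
  let mk := Ideal.Quotient.mk (Ideal.span {x})
  have hxz : mk x = 0 := by
    rw [Ideal.Quotient.eq_zero_iff_mem]; exact Ideal.mem_span_singleton_self x
  have key : maximalIdeal (A ⧸ Ideal.span {x}) =
      Ideal.span (((s.erase i).image mk : Finset _) : Set _) := by
    rw [← hmap, ← hspan]
    change Ideal.map mk (Ideal.span _) = _
    rw [Ideal.map_span]
    apply le_antisymm
    · rw [Ideal.span_le]
      rintro _ ⟨j, hj, rfl⟩
      by_cases hji : j = i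
      · subst hji
        have h0 : mk (a j) * mk j + ∑ l ∈ s.erase j, mk (a l) * mk l = 0 := by
          have h3 := congrArg mk ha
          rw [hxz, ← Finset.add_sum_erase _ _ hi] at h3
          simpa using h3
        obtain ⟨v, hv⟩ := (hu.map mk).exists_left_inv
        have : mk j = - v * ∑ l ∈ s.erase j, mk (a l) * mk l := by
          linear_combination (v) * h0 - (mk j) * hv
        rw [this]
        refine Ideal.mul_mem_left _ _ (Ideal.sum_mem _ fun l hl ↦ Ideal.mul_mem_left _ _ ?_)
        exact Ideal.subset_span (by simpa using ⟨l, by simpa [and_comm] using hl, rfl⟩)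
      · exact Ideal.subset_span (by simpa using ⟨j, ⟨hj, hji⟩, rfl⟩)
    · apply Ideal.span_mono
      intro y hy
      simp only [Finset.coe_image, Set.mem_image] at hy ⊢
      obtain ⟨j, hj, rfl⟩ := hy
      exact ⟨j, Finset.mem_of_mem_erase hj, rfl⟩
  have h1 : (maximalIdeal (A ⧸ Ideal.span {x})).spanFinrank ≤ (s.erase i).card := by
    rw [key]
    refine (Submodule.spanFinrank_span_le_ncard_of_finite (Finset.finite_toSet _)).trans ?_
    rw [Set.ncard_coe_finset]
    exact Finset.card_image_le
  rw [Finset.card_erase_of_mem hi] at h1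
  have := Finset.card_pos.mpr ⟨i, hi⟩
  omega


lemma isDomain_of_prime {A : Type u} [CommRing A] [IsNoetherianRing A] [IsLocalRing A] {x : A}
    (hx : x ∈ maximalIdeal A) (hp : (Ideal.span {x}).IsPrime)
    (hmin : ∀ p ∈ minimalPrimes A, x ∉ p) : IsDomain A := by
  obtain ⟨P, hP, hle⟩ := Ideal.exists_minimalPrimes_le (I := (⊥ : Ideal A)) (J := Ideal.span {x})
    bot_le
  have hPp : P.IsPrime := hP.1.1
  have hxP := hmin P hP
  have : P = ⊥ := by
    apply Submodule.eq_bot_of_le_smul_of_le_jacobson_bot (maximalIdeal A) _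
      (IsNoetherian.noetherian _)
    · intro p hpP
      obtain ⟨a, rfl⟩ := Ideal.mem_span_singleton'.mp (hle hpP)
      rcases hPp.mem_or_mem hpP with h | h
      · rw [mul_comm]
        exact Ideal.mul_mem_mul hx h
      · exact absurd h hxP
    · rw [IsLocalRing.jacobson_eq_maximalIdeal _ bot_ne_top]
  subst this
  exact IsDomain.of_bot_isPrime A

lemma regular_seq (n : ℕ) : ∀ (A : Type u) [CommRing A] [IsNoetherianRing A] [IsLocalRing A],
    ringKrullDim A = n → (maximalIdeal A).spanFinrank ≤ n →
    IsDomain A ∧ ∃ rs : List A, RingTheory.Sequence.IsRegular A rs ∧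
      Ideal.ofList rs = maximalIdeal A := by
  induction n with
  | zero =>
    intro A _ _ _ hd hs
    have hbot : maximalIdeal A = ⊥ := by
      rw [← Submodule.spanFinrank_eq_zero_iff_eq_bot (IsNoetherian.noetherian _)]
      omega
    have hf : IsField A := IsLocalRing.isField_iff_maximalIdeal_eq.mpr hbot
    refine ⟨hf.isDomain, [], RingTheory.Sequence.IsRegular.nil A A, by simp [hbot]⟩
  | succ n ih =>
    intro A _ _ _ hd hs
    have hht : ((maximalIdeal A).height : WithBot ℕ∞) = ((n + 1 : ℕ) : WithBot ℕ∞) := by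
      rw [← hd, IsLocalRing.maximalIdeal_height_eq_ringKrullDim]
    have hnotmin : ∀ p ∈ minimalPrimes A, ¬ maximalIdeal A ≤ p := by
      intro p hp hle
      have hpp : p.IsPrime := hp.1.1
      have : maximalIdeal A = p := le_antisymm hle (IsLocalRing.le_maximalIdeal hpp.ne_top)
      rw [← this] at hp
      have h0 : (maximalIdeal A).height = 0 := Ideal.height_eq_zero_iff.mpr hp
      rw [h0] at hht
      norm_cast at hht
    have hbot : maximalIdeal A ≠ ⊥ := by
      intro h
      obtain ⟨P, hP, hle⟩ := Ideal.exists_minimalPrimes_le (I := (⊥ : Ideal A))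
        (J := maximalIdeal A) bot_le
      exact hnotmin P hP (h ▸ bot_le)
    obtain ⟨x, hx, hx2, hxm⟩ := exists_avoid hbot (minimalPrimes A)
      (minimalPrimes.finite_of_isNoetherianRing A) (fun p hp ↦ hp.1.1) hnotmin
    have := isLocalRing_quot hx
    have h1 := edim_quot_lt hx hx2
    have h2 : ringKrullDim A ≤ ringKrullDim (A ⧸ Ideal.span {x}) + 1 := by
      rw [← IsLocalRing.maximalIdeal_height_eq_ringKrullDim]
      exact Ideal.height_le_ringKrullDim_quotient_add_one hx
    have h3 := ringKrullDim_le_spanFinrank_maximalIdeal (A ⧸ Ideal.span {x})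
    have h4 : ringKrullDim (A ⧸ Ideal.span {x}) = n := by
      apply le_antisymm
      · exact h3.trans (by exact_mod_cast (by omega))
      · rw [hd] at h2
        push_cast at h2
        exact ENat.WithBot.add_le_add_one_right_iff.mp h2
    obtain ⟨hdom, rs, hreg, hrs⟩ := ih (A ⧸ Ideal.span {x}) h4 (by omega)
    have hA : IsDomain A := isDomain_of_prime hx
      ((Ideal.Quotient.isDomain_iff_prime _).mp hdom) hxm
    refine ⟨hA, ?_⟩
    choose g hg using Ideal.Quotient.mk_surjective (I := Ideal.span {x})
    have hmaprs : (rs.map g).map (Ideal.Quotient.mk (Ideal.span {x})) = rs := by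
      simp [Function.comp_def, hg]
    refine ⟨x :: rs.map g, ?_, ?_⟩
    · apply RingTheory.Sequence.IsRegular.cons'
      · have hx0 : x ≠ 0 := by rintro rfl; exact hx2 (Ideal.zero_mem _)
        exact IsSMulRegular.of_ne_zero hx0
      · rw [hmaprs]
        have e : QuotSMulTop x A ≃ₗ[A ⧸ Ideal.span {x}] (A ⧸ Ideal.span {x}) := by
          refine LinearEquiv.extendScalarsOfSurjective (R := A) Ideal.Quotient.mk_surjective
            (Submodule.quotEquivOfEq _ _ ?_)
          rw [← Submodule.ideal_span_singleton_smul]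
          simp
        exact (e.isRegular_congr rs).mpr hreg
    · have h1 : (Ideal.ofList (x :: rs.map g)).map
        (Ideal.Quotient.mk (Ideal.span {x})) = (maximalIdeal A).map
        (Ideal.Quotient.mk (Ideal.span {x})) := by
        rw [IsLocalRing.map_maximalIdeal_of_surjective _ Ideal.Quotient.mk_surjective, ← hrs,
          Ideal.map_ofList, List.map_cons, hmaprs, Ideal.ofList_cons]
        simp
      have h2 := congrArg (Ideal.comap (Ideal.Quotient.mk (Ideal.span {x}))) h1
      rw [Ideal.comap_map_of_surjective _ Ideal.Quotient.mk_surjective,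
        Ideal.comap_map_of_surjective _ Ideal.Quotient.mk_surjective, ← RingHom.ker_eq_comap_bot,
        Ideal.mk_ker, sup_eq_left.mpr, sup_eq_left.mpr] at h2
      · exact h2
      · rwa [Ideal.span_singleton_le_iff_mem]
      · rw [Ideal.ofList_cons]; exact le_sup_left

lemma pd_of_regular (A : Type u) [CommRing A] [IsNoetherianRing A] [IsLocalRing A] (n : ℕ)
    (h1 : ringKrullDim A = n) (h2 : (maximalIdeal A).spanFinrank ≤ n) :
    ∃ d, HasProjectiveDimensionLE (ModuleCat.of A (ResidueField A)) d := by
  obtain ⟨-, rs, hreg, hrs⟩ := regular_seq n A h1 h2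
  have := ModuleCat.projectiveDimension_quotient_eq_length.{u} rs hreg
  refine ⟨rs.length, ?_⟩
  rw [← projectiveDimension_le_iff, ← this]
  apply le_of_eq
  apply projectiveDimension_eq_of_iso
  apply LinearEquiv.toModuleIso
  exact (Submodule.quotEquivOfEq _ _ hrs.symm).trans (Shrink.linearEquiv A _).symm


theorem free_of_pd_zero {A : Type u} [CommRing A] [IsNoetherianRing A] [IsLocalRing A]
    {M : Type u} [AddCommGroup M] [Module A M] [Module.Finite A M]
    (h : HasProjectiveDimensionLT (ModuleCat.of A M) 1) : Module.Free A M := by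
  rw [← projective_iff_hasProjectiveDimensionLT_one] at h
  have : Module.Projective A M := ModuleCat.projective_of_module_projective (ModuleCat.of A M)
  exact Module.free_of_flat_of_isLocalRing

theorem pd_of_free {A : Type u} [CommRing A] {M : Type u} [AddCommGroup M] [Module A M]
    [Module.Free A M] (d : ℕ) : HasProjectiveDimensionLT (ModuleCat.of A M) (d + 1) := by
  have : Projective (ModuleCat.of A M) := inferInstance
  have h := projective_iff_hasProjectiveDimensionLT_one.1 this
  exact hasProjectiveDimensionLT_of_ge _ 1 (d+1) (by omega)

theorem exists_cover (A : Type u) [CommRing A] [IsNoetherianRing A]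
    (M : Type u) [AddCommGroup M] [Module A M] [Module.Finite A M] :
    ∃ (P : Type u) (_ : AddCommGroup P) (_ : Module A P) (_ : Module.Finite A P)
      (_ : Module.Free A P) (f : P →ₗ[A] M), Function.Surjective f := by
  obtain ⟨P, _, _, _, _, f, surjf⟩ := Module.exists_finite_presentation A M
  exact ⟨P, _, _, ‹_›, ‹_›, f, surjf⟩

theorem pd_ker {A : Type u} [CommRing A] {P M : Type u} [AddCommGroup M] [Module A M]
    [AddCommGroup P] [Module A P] [Module.Free A P] (f : P →ₗ[A] M) (hf : Function.Surjective f)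
    (d : ℕ) : HasProjectiveDimensionLT (ModuleCat.of A M) (d + 2) ↔
      HasProjectiveDimensionLT (ModuleCat.of A (LinearMap.ker f)) (d + 1) :=
  (LinearMap.shortExact_shortComplexKer hf).hasProjectiveDimensionLT_X₃_iff d
    (inferInstanceAs (Projective (ModuleCat.of A P)))

theorem free_of_depth_zero {A : Type u} [CommRing A] [IsNoetherianRing A] [IsLocalRing A]
    (j : ResidueField A →ₗ[A] A) (hj : Function.Injective j) (d : ℕ) :
    ∀ (M : Type u) [AddCommGroup M] [Module A M] [Module.Finite A M],
      HasProjectiveDimensionLT (ModuleCat.of A M) (d + 1) → Module.Free A M := by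
  induction d with
  | zero => intro M _ _ _ h; exact free_of_pd_zero h
  | succ d ih =>
    intro M _ _ _ h
    obtain ⟨P, _, _, _, _, f, hf⟩ := exists_cover A M
    have hK : Module.Free A (LinearMap.ker f) := ih _ ((pd_ker f hf d).1 h)
    refine Module.free_of_lTensor_residueField_injective (LinearMap.ker f).subtype f hf
      (LinearMap.exact_subtype_ker_map f) ?_
    have e : (j.rTensor P) ∘ₗ ((LinearMap.ker f).subtype.lTensor (ResidueField A)) =
        ((LinearMap.ker f).subtype.lTensor A) ∘ₗ (j.rTensor (LinearMap.ker f)) := by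
      rw [LinearMap.rTensor_comp_lTensor, LinearMap.lTensor_comp_rTensor]
    have i1 : Function.Injective (((LinearMap.ker f).subtype.lTensor A) ∘ₗ
        (j.rTensor (LinearMap.ker f))) := by
      rw [LinearMap.coe_comp]
      exact (Module.Flat.lTensor_preserves_injective_linearMap _ Subtype.val_injective).comp
        (Module.Flat.rTensor_preserves_injective_linearMap _ hj)
    rw [← e, LinearMap.coe_comp] at i1
    exact i1.of_comp

theorem maximalIdeal_eq_bot_of_depth_zero {A : Type u} [CommRing A] [IsNoetherianRing A]
    [IsLocalRing A] (h : maximalIdeal A ∈ associatedPrimes A A) (d : ℕ)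
    (hd : HasProjectiveDimensionLT (ModuleCat.of A (ResidueField A)) (d + 1)) :
    maximalIdeal A = ⊥ := by
  obtain ⟨_, f, hf⟩ := (isAssociatedPrime_iff_exists_injective_linearMap _ _).1 h
  have : Module.Free A (ResidueField A) := free_of_depth_zero f hf d _ hd
  rw [eq_bot_iff]
  intro x hx
  have h1 : ∀ z : ResidueField A, x • z = (0 : A) • z := by
    intro z
    rw [Algebra.smul_def, zero_smul]
    have : algebraMap A (ResidueField A) x = 0 := (residue_eq_zero_iff x).2 hx
    rw [this, zero_mul]
  exact eq_of_smul_eq_smul h1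

section transfer
variable {A : Type u} [CommRing A] [IsNoetherianRing A] [IsLocalRing A] (x : A)

/-- reduction mod x as a linear map over the quotient ring -/
noncomputable def redMap {M N : Type u} [AddCommGroup M] [Module A M] [AddCommGroup N] [Module A N]
    (f : M →ₗ[A] N) : QuotSMulTop x M →ₗ[A ⧸ Ideal.span {x}] QuotSMulTop x N :=
  LinearMap.extendScalarsOfSurjective (R := A) Ideal.Quotient.mk_surjective (QuotSMulTop.map x f)

theorem pd_transfer (hxA : IsSMulRegular A x) (d : ℕ) :
    ∀ (M : Type u) [AddCommGroup M] [Module A M] [Module.Finite A M],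
      IsSMulRegular M x →
      HasProjectiveDimensionLT (ModuleCat.of A M) (d + 1) →
      HasProjectiveDimensionLT (ModuleCat.of (A ⧸ Ideal.span {x}) (QuotSMulTop x M)) (d + 1) := by
  induction d with
  | zero =>
    intro M _ _ _ _ h
    have := free_of_pd_zero h
    exact pd_of_free 0
  | succ d ih =>
    intro M _ _ _ hM h
    obtain ⟨P, _, _, _, _, f, hf⟩ := exists_cover A M
    have hP : IsSMulRegular P x := by
      intro a b hab
      let B := Module.Free.chooseBasis A P
      apply B.repr.injective
      ext i
      apply hxA
      have := congrArg (fun z => B.repr z i) hab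
      simpa using this
    have hKreg : IsSMulRegular (LinearMap.ker f) x :=
      hP.of_injective (LinearMap.ker f).subtype Subtype.val_injective
    have hK := ih (LinearMap.ker f) hKreg ((pd_ker f hf d).1 h)
    have hex := LinearMap.exact_subtype_ker_map f
    have e2 := QuotSMulTop.map_exact x hex hf
    have e3 := QuotSMulTop.map_surjective x hf
    have e1 : Function.Injective (QuotSMulTop.map x (LinearMap.ker f).subtype) := by
      have z : Function.Exact (0 : PUnit.{u+1} →ₗ[A] LinearMap.ker f) (LinearMap.ker f).subtype :=
        (LinearMap.exact_zero_iff_injective _ _).2 Subtype.val_injective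
      have := QuotSMulTop.map_first_exact_on_four_term_exact_of_isSMulRegular_last z hex hM
      rw [map_zero] at this
      exact (LinearMap.exact_zero_iff_injective _ _).1 this
    let S : ShortComplex (ModuleCat.{u} (A ⧸ Ideal.span {x})) :=
      ModuleCat.shortComplexOfCompEqZero (redMap x (LinearMap.ker f).subtype) (redMap x f) (by
        apply DFunLike.ext
        exact e2.apply_apply_eq_zero)
    have hS : S.ShortExact :=
      { exact := (ShortComplex.ShortExact.moduleCat_exact_iff_function_exact _).mpr e2
        mono_f := (ModuleCat.mono_iff_injective _).mpr e1
        epi_g := (ModuleCat.epi_iff_surjective _).mpr e3 }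
    exact hS.hasProjectiveDimensionLT_X₃ (d+1) hK (pd_of_free (M := QuotSMulTop x P) (d+1))


theorem pd_quot (hxm : x ∈ maximalIdeal A) (hx2 : x ∉ maximalIdeal A ^ 2) (d : ℕ)
    [IsLocalRing (A ⧸ Ideal.span {x})]
    (h : HasProjectiveDimensionLT (ModuleCat.of (A ⧸ Ideal.span {x})
      (QuotSMulTop x (maximalIdeal A))) d) :
    HasProjectiveDimensionLT (ModuleCat.of (A ⧸ Ideal.span {x})
      (ResidueField (A ⧸ Ideal.span {x}))) d := by
  let B := A ⧸ Ideal.span {x}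
  have hloc : IsLocalHom (Ideal.Quotient.mk (Ideal.span {x})) :=
    .of_surjective _ Ideal.Quotient.mk_surjective
  let π : ResidueField A →ₗ[A] ResidueField B :=
    { toFun := ResidueField.map (Ideal.Quotient.mk (Ideal.span {x}))
      map_add' := map_add _
      map_smul' := by
        intro a z
        rw [Algebra.smul_def, map_mul, Algebra.smul_def]
        rfl }
  have hπ : π 1 = 1 := map_one (ResidueField.map (Ideal.Quotient.mk (Ideal.span {x})))
  have hx0 : (maximalIdeal A).toCotangent ⟨x, hxm⟩ ≠ 0 := by
    rw [Ne, Ideal.toCotangent_eq_zero]; exact hx2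
  obtain ⟨φ, hφ⟩ := Module.Projective.exists_dual_eq_one (ResidueField A)
    (V := CotangentSpace A) hx0
  let g0 : maximalIdeal A →ₗ[A] ResidueField B :=
    π ∘ₗ (φ.restrictScalars A) ∘ₗ (maximalIdeal A).toCotangent
  have hg0 : g0 ⟨x, hxm⟩ = 1 := by
    change π (φ _) = 1
    rw [hφ, hπ]
  let g1 : QuotSMulTop x (maximalIdeal A) →ₗ[A] ResidueField B :=
    Submodule.liftQ _ g0 (by
      rintro _ ⟨y, -, rfl⟩
      rw [LinearMap.mem_ker]
      change g0 (x • y) = 0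
      rw [map_smul, Algebra.smul_def]
      have : algebraMap A (ResidueField B) x = 0 := by
        rw [IsScalarTower.algebraMap_apply A B (ResidueField B)]
        have : algebraMap A B x = 0 :=
          Ideal.Quotient.eq_zero_iff_mem.2 (Ideal.mem_span_singleton_self x)
        rw [this, map_zero]
      rw [this, zero_mul])
  let g : QuotSMulTop x (maximalIdeal A) →ₗ[B] ResidueField B :=
    LinearMap.extendScalarsOfSurjective (R := A) Ideal.Quotient.mk_surjective g1
  let f : ResidueField B →ₗ[B] QuotSMulTop x (maximalIdeal A) :=
    Submodule.liftQ (maximalIdeal B) (LinearMap.toSpanSingleton B _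
      (Submodule.Quotient.mk ⟨x, hxm⟩)) (by
      intro b hb
      rw [← IsLocalRing.map_maximalIdeal_of_surjective (Ideal.Quotient.mk (Ideal.span {x}))
        Ideal.Quotient.mk_surjective] at hb
      obtain ⟨a, ha, rfl⟩ := (Ideal.mem_map_iff_of_surjective _ Ideal.Quotient.mk_surjective).1 hb
      rw [LinearMap.mem_ker, LinearMap.toSpanSingleton_apply]
      change a • (Submodule.Quotient.mk ⟨x, hxm⟩ : QuotSMulTop x (maximalIdeal A)) = 0
      rw [← Submodule.Quotient.mk_smul, Submodule.Quotient.mk_eq_zero]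
      refine ⟨⟨a, ha⟩, trivial, ?_⟩
      ext
      exact mul_comm _ _)
  have hf1 : f 1 = Submodule.Quotient.mk ⟨x, hxm⟩ := by
    change (1 : B) • (Submodule.Quotient.mk ⟨x, hxm⟩ : QuotSMulTop x (maximalIdeal A)) = _
    rw [one_smul]
  have hg1 : g (f 1) = 1 := by
    rw [hf1]; exact hg0
  have hgf : g ∘ₗ f = LinearMap.id := by
    ext z
    obtain ⟨b, rfl⟩ := residue_surjective z
    have : residue B b = b • (1 : ResidueField B) := by
      rw [Algebra.smul_def, mul_one]; rfl
    rw [this, map_smul, LinearMap.comp_apply, hg1]; rfl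
  let r : Retract (ModuleCat.of B (ResidueField B)) 
      (ModuleCat.of B (QuotSMulTop x (maximalIdeal A))) :=
    { i := ModuleCat.ofHom f
      r := ModuleCat.ofHom g
      retract := by rw [← ModuleCat.ofHom_comp, hgf]; rfl }
  exact r.hasProjectiveDimensionLT d

end transfer

theorem exists_dim_nat (A : Type u) [CommRing A] [IsNoetherianRing A] [IsLocalRing A] :
    ∃ k : ℕ, ringKrullDim A = k := by
  have h1 : ringKrullDim A ≤ ((maximalIdeal A).spanFinrank : ℕ) :=
    ringKrullDim_le_spanFinrank_maximalIdeal A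
  have h0 : 0 ≤ ringKrullDim A := ringKrullDim_nonneg_of_nontrivial
  generalize ringKrullDim A = z at *
  induction z with
  | bot => simp at h0
  | coe z =>
    induction z with
    | top => exact absurd h1 (by
        intro h
        have := WithBot.coe_le_coe.1 h
        exact absurd this (by simp))
    | coe z => exact ⟨z, rfl⟩

theorem edim_le_of_pd (n : ℕ) : ∀ (A : Type u) [CommRing A] [IsNoetherianRing A] [IsLocalRing A]
    (_ : ringKrullDim A = n) (d : ℕ)
    (_ : HasProjectiveDimensionLT (ModuleCat.of A (ResidueField A)) (d + 1)),
    (maximalIdeal A).spanFinrank ≤ n := by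
  induction n using Nat.strong_induction_on with
  | _ n ih =>
  intro A _ _ _ hn d hd
  by_cases hm : maximalIdeal A = ⊥
  · rw [hm]; simp
  have hass : maximalIdeal A ∉ associatedPrimes A A :=
    fun h => hm (maximalIdeal_eq_bot_of_depth_zero h d hd)
  obtain ⟨x, hxm, hx2, hx⟩ := exists_avoid hm (associatedPrimes A A) (associatedPrimes.finite A A)
    (fun p hp => hp.isPrime) (by
      intro p hp hle
      have := (maximalIdeal.isMaximal A).eq_of_le hp.isPrime.ne_top hle
      exact hass (this ▸ hp))
  have hx0 : x ∈ nonZeroDivisors A := by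
    by_contra hc
    have : x ∈ ((nonZeroDivisors A : Set A))ᶜ := hc
    rw [← biUnion_associatedPrimes_eq_compl_nonZeroDivisors] at this
    simp only [Set.mem_iUnion] at this
    obtain ⟨p, hp, hxp⟩ := this
    exact hx p hp hxp
  have hreg : IsSMulRegular A x := by
    intro a b hab
    exact (mul_cancel_left_mem_nonZeroDivisors hx0).1 hab
  have hloc := isLocalRing_quot hxm
  obtain ⟨k, hk⟩ := exists_dim_nat (A ⧸ Ideal.span {x})
  have h1 := ringKrullDim_quotient_succ_le_of_nonZeroDivisor hx0
  rw [hk, hn] at h1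
  have h1' : k + 1 ≤ n := by exact_mod_cast h1
  have hres : Function.Surjective (Algebra.linearMap A (ResidueField A)) := residue_surjective
  have hd2 : HasProjectiveDimensionLT (ModuleCat.of A (ResidueField A)) (d + 2) :=
    hasProjectiveDimensionLT_of_ge _ (d+1) (d+2) (by omega)
  have hK := (pd_ker _ hres d).1 hd2
  have hker : LinearMap.ker (Algebra.linearMap A (ResidueField A)) = maximalIdeal A := by
    ext a
    exact residue_eq_zero_iff a
  rw [hker] at hK
  have hmreg : IsSMulRegular (maximalIdeal A) x :=
    hreg.of_injective (maximalIdeal A).subtype Subtype.val_injective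
  have hT := pd_transfer x hreg d (maximalIdeal A) hmreg hK
  have hB := pd_quot x hxm hx2 _ hT
  have h3 := ih k (by omega) (A ⧸ Ideal.span {x}) hk d hB
  have h4 := edim_le hxm
  omega

section shift
variable {C : Type*} [Category* C] [Abelian C]

/-- the augmentation of a projective resolution -/
noncomputable def aug {Z : C} (Q : ProjectiveResolution Z) : Q.complex.X 0 ⟶ Z := Q.π.f 0

theorem d_aug {Z : C} (Q : ProjectiveResolution Z) : Q.complex.d 1 0 ≫ aug Q = 0 :=
  Q.complex_d_comp_π_f_zero

instance aug_epi {Z : C} (Q : ProjectiveResolution Z) : Epi (aug Q) :=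
  inferInstanceAs (Epi (Q.π.f 0))

theorem aug_exact {Z : C} (Q : ProjectiveResolution Z) :
    (ShortComplex.mk _ _ (d_aug Q)).Exact := Q.exact₀

theorem d_aug_comp {Z Y : C} (Q : ProjectiveResolution Z) (f : Z ⟶ Y) :
    Q.complex.d 1 0 ≫ aug Q ≫ f = 0 := by
  rw [← Category.assoc, d_aug, zero_comp]

theorem aug_comp_zero {S : ShortComplex C} (Q : ProjectiveResolution S.X₁) :
    (aug Q ≫ S.f) ≫ S.g = 0 := by
  rw [Category.assoc, S.zero, comp_zero]

theorem exact_mid {S : ShortComplex C} (hS : S.ShortExact) (Q : ProjectiveResolution S.X₁) :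
    (ShortComplex.mk (Q.complex.d 1 0) (aug Q ≫ S.f)
      (d_aug_comp Q S.f)).Exact := by
  let φ : ShortComplex.mk _ _ (d_aug Q) ⟶ ShortComplex.mk (Q.complex.d 1 0)
      (aug Q ≫ S.f) (d_aug_comp Q S.f) :=
    { τ₁ := 𝟙 _, τ₂ := 𝟙 _, τ₃ := S.f, comm₁₂ := by simp, comm₂₃ := by simp }
  have : Epi φ.τ₁ := by dsimp [φ]; infer_instance
  have : IsIso φ.τ₂ := by dsimp [φ]; infer_instance
  have : Mono φ.τ₃ := hS.mono_f
  exact (ShortComplex.exact_iff_of_epi_of_isIso_of_mono φ).1 (aug_exact Q)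

theorem exact_low {S : ShortComplex C} (hS : S.ShortExact) (Q : ProjectiveResolution S.X₁) :
    (ShortComplex.mk (aug Q ≫ S.f) S.g
      (aug_comp_zero Q)).Exact := by
  let φ : ShortComplex.mk (aug Q ≫ S.f) S.g
      (aug_comp_zero Q) ⟶ S :=
    { τ₁ := aug Q, τ₂ := 𝟙 _, τ₃ := 𝟙 _, comm₁₂ := by simp, comm₂₃ := by simp }
  have : Epi φ.τ₁ := by dsimp [φ]; infer_instance
  have : IsIso φ.τ₂ := by dsimp [φ]; infer_instance
  have : Mono φ.τ₃ := by dsimp [φ]; infer_instance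
  exact (ShortComplex.exact_iff_of_epi_of_isIso_of_mono φ).2 hS.exact

/-- the complex of the extended resolution -/
noncomputable def extComplex {S : ShortComplex C} (Q : ProjectiveResolution S.X₁) :
    ChainComplex C ℕ :=
  ChainComplex.augment Q.complex (aug Q ≫ S.f)
    (d_aug_comp Q S.f)

theorem extComplex_exactAt {S : ShortComplex C} (hS : S.ShortExact)
    (Q : ProjectiveResolution S.X₁) (n : ℕ) : (extComplex Q).ExactAt (n + 1) := by
  rw [HomologicalComplex.exactAt_iff' _ (n + 1 + 1) (n + 1) n (by simp) (by simp)]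
  match n with
  | 0 => exact exact_mid hS Q
  | n + 1 => exact Q.exact_succ n

/-- resolution of the third term from a resolution of the first -/
noncomputable def extRes {S : ShortComplex C} (hS : S.ShortExact) [hp : Projective S.X₂]
    (Q : ProjectiveResolution S.X₁) : ProjectiveResolution S.X₃ where
  complex := extComplex Q
  projective n := by
    match n with
    | 0 => exact hp
    | n + 1 => exact Q.projective n
  π := (ChainComplex.toSingle₀Equiv _ _).symm ⟨S.g, aug_comp_zero Q⟩
  quasiIso := ⟨fun n => by
    cases n
    · rw [ChainComplex.quasiIsoAt₀_iff, ShortComplex.quasiIso_iff_of_zeros']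
      · refine (ShortComplex.exact_and_epi_g_iff_of_iso ?_).2
          ⟨exact_low hS Q, hS.epi_g⟩
        exact ShortComplex.isoMk (Iso.refl _) (Iso.refl _) (Iso.refl _)
          ((Category.id_comp _).trans (Category.comp_id _).symm)
          ((Category.id_comp _).trans (Eq.trans (ChainComplex.toSingle₀Equiv_symm_apply_f_zero
            (C := extComplex Q) (X := S.X₃) S.g (aug_comp_zero Q)).symm (Category.comp_id _).symm))
      all_goals rfl
    · rw [quasiIsoAt_iff_exactAt']
      · apply extComplex_exactAt hS
      · apply ChainComplex.exactAt_succ_single_obj⟩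

variable [HasProjectiveResolutions C] {D : Type*} [Category* D] [Abelian D]

theorem isZero_leftDerived_iff (F : C ⥤ D) [F.Additive] {Z : C} (P : ProjectiveResolution Z)
    (n : ℕ) : IsZero ((F.leftDerived (n + 1)).obj Z) ↔
      ((ShortComplex.mk _ _ (P.complex.d_comp_d (n + 2) (n + 1) n)).map F).Exact := by
  rw [(P.isoLeftDerivedObj F (n+1)).isZero_iff]
  erw [← HomologicalComplex.exactAt_iff_isZero_homology]
  rw [HomologicalComplex.exactAt_iff' _ (n + 1 + 1) (n + 1) n (by simp) (by simp)]
  rfl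

theorem shift_iff (F : C ⥤ D) [F.Additive] {S : ShortComplex C} (hS : S.ShortExact)
    [Projective S.X₂] (n : ℕ) :
    IsZero ((F.leftDerived (n + 2)).obj S.X₃) ↔ IsZero ((F.leftDerived (n + 1)).obj S.X₁) := by
  let Q : ProjectiveResolution S.X₁ := (HasProjectiveResolutions.out S.X₁).out.some
  rw [isZero_leftDerived_iff F Q n, isZero_leftDerived_iff F (extRes hS Q) (n+1)]
  rfl

theorem mono_of_tor_one (F : C ⥤ D) [F.Additive] [F.PreservesEpimorphisms]
    {S : ShortComplex C} (hS : S.ShortExact)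
    [Projective S.X₂] (h : IsZero ((F.leftDerived 1).obj S.X₃)) : Mono (F.map S.f) := by
  let Q : ProjectiveResolution S.X₁ := (HasProjectiveResolutions.out S.X₁).out.some
  rw [isZero_leftDerived_iff F (extRes hS Q) 0] at h
  have h' : (ShortComplex.mk (F.map (Q.complex.d 1 0)) (F.map (aug Q) ≫ F.map S.f)
      (by rw [← Category.assoc, ← F.map_comp, (d_aug Q), F.map_zero,
        zero_comp])).Exact := by
    have e : F.map (aug Q) ≫ F.map S.f = F.map (aug Q ≫ S.f) := (F.map_comp _ _).symm
    simp only [e]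
    exact h
  rw [Preadditive.mono_iff_cancel_zero]
  intro T t ht
  -- pull back along the epimorphism
  obtain ⟨T', e, he, s, hs⟩ := surjective_up_to_refinements_of_epi (F.map (aug Q)) t
  obtain ⟨T'', e', he', s', hs'⟩ := h'.exact_up_to_refinements s (by
    dsimp
    rw [← Category.assoc, ← hs, Category.assoc, ht, comp_zero])
  dsimp at hs'
  rw [← cancel_epi (e' ≫ e), comp_zero, Category.assoc, hs, ← Category.assoc, hs', Category.assoc,
    ← F.map_comp, (d_aug Q), F.map_zero, comp_zero]

end shift

theorem tor_of_pd {A : Type u} [CommRing A] [IsNoetherianRing A] [IsLocalRing A]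
    (X : ModuleCat.{u} A) (d : ℕ) :
    ∀ (M : Type u) [AddCommGroup M] [Module A M] [Module.Finite A M],
      HasProjectiveDimensionLT (ModuleCat.of A M) (d + 1) → ∀ i, d + 1 ≤ i →
      IsZero (((Tor (ModuleCat.{u} A) i).obj X).obj (ModuleCat.of A M)) := by
  induction d with
  | zero =>
    intro M _ _ _ h i hi
    have := projective_iff_hasProjectiveDimensionLT_one.2 h
    obtain ⟨j, rfl⟩ := Nat.exists_eq_add_of_le' hi
    exact isZero_Tor_succ_of_projective _ X (ModuleCat.of A M) j
  | succ d ih =>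
    intro M _ _ _ h i hi
    obtain ⟨P, _, _, _, _, f, hf⟩ := exists_cover A M
    obtain ⟨j, rfl⟩ := Nat.exists_eq_add_of_le' (show 2 ≤ i by omega)
    have hp : Projective (f.shortComplexKer).X₂ := inferInstanceAs (Projective (ModuleCat.of A P))
    exact (shift_iff ((MonoidalCategory.tensoringLeft (ModuleCat.{u} A)).obj X)
      (LinearMap.shortExact_shortComplexKer hf) j).2
      (ih (LinearMap.ker f) ((pd_ker f hf d).1 h) (j + 1) (by omega))

theorem pd_of_tor {A : Type u} [CommRing A] [IsNoetherianRing A] [IsLocalRing A] (i : ℕ) :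
    ∀ (M : Type u) [AddCommGroup M] [Module A M] [Module.Finite A M],
      IsZero (((Tor (ModuleCat.{u} A) (i + 1)).obj (ModuleCat.of A (ResidueField A))).obj
        (ModuleCat.of A M)) →
      HasProjectiveDimensionLT (ModuleCat.of A M) (i + 1) := by
  induction i with
  | zero =>
    intro M _ _ _ h
    obtain ⟨P, _, _, _, _, f, hf⟩ := exists_cover A M
    have hp : Projective (f.shortComplexKer).X₂ := inferInstanceAs (Projective (ModuleCat.of A P))
    have hpe : ((MonoidalCategory.tensoringLeft (ModuleCat.{u} A)).obj
        (ModuleCat.of A (ResidueField A))).PreservesEpimorphisms :=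
      inferInstanceAs (MonoidalCategory.tensorLeft
        (ModuleCat.of A (ResidueField A))).PreservesEpimorphisms
    have hm := mono_of_tor_one ((MonoidalCategory.tensoringLeft (ModuleCat.{u} A)).obj
      (ModuleCat.of A (ResidueField A))) (LinearMap.shortExact_shortComplexKer hf) h
    have hinj := (ModuleCat.mono_iff_injective _).1 hm
    have : Module.Free A M :=
      Module.free_of_lTensor_residueField_injective (LinearMap.ker f).subtype f hf
        (LinearMap.exact_subtype_ker_map f) hinj
    exact pd_of_free 0
  | succ i ih =>
    intro M _ _ _ h
    obtain ⟨P, _, _, _, _, f, hf⟩ := exists_cover A M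
    have hp : Projective (f.shortComplexKer).X₂ := inferInstanceAs (Projective (ModuleCat.of A P))
    exact (pd_ker f hf i).2 (ih _
      ((shift_iff ((MonoidalCategory.tensoringLeft (ModuleCat.{u} A)).obj
        (ModuleCat.of A (ResidueField A))) (LinearMap.shortExact_shortComplexKer hf) i).1 h))

end RegTor

theorem regular_iff_tor_eventually_zero
    (A : Type u) [CommRing A] [IsNoetherianRing A] [IsLocalRing A]
    (n : ℕ) (hdim : ringKrullDim A = n) :
    Module.finrank (ResidueField A) (CotangentSpace A) = n ↔
      ∃ N : ℕ, ∀ i : ℕ, N ≤ i →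
        IsZero (((Tor (ModuleCat.{u} A) i).obj
          (ModuleCat.of A (ResidueField A))).obj (ModuleCat.of A (ResidueField A))) := by
  have e := spanFinrank_maximalIdeal_eq_finrank_cotangentSpace (R := A)
  constructor
  · intro h
    obtain ⟨d, hd⟩ := RegTor.pd_of_regular A n hdim (by rw [e, h])
    exact ⟨d + 1, RegTor.tor_of_pd _ d (ResidueField A) hd⟩
  · rintro ⟨N, hN⟩
    have hd := RegTor.pd_of_tor N (ResidueField A) (hN (N + 1) (by omega))
    have h1 := RegTor.edim_le_of_pd n A hdim N hd
    have h2 := ringKrullDim_le_spanFinrank_maximalIdeal A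
    rw [hdim] at h2
    have h3 : n ≤ (maximalIdeal A).spanFinrank := by exact_mod_cast h2
    rw [← e]
    omega
end

section
/- Let (A, m) be a noetherian local ring with residue field k = A/m, and let n ≥ 0 be an integer. Then the global dimension of A is at most n if and only if Tor_{n+1}^A(k, k) = 0. -/
/-!
STATEMENT 2: Let (A, m) be a noetherian local ring with residue field k = A/m, and let
n ≥ 0 be an integer. Then the global dimension of A is at most n if and only if
Tor_{n+1}^A(k, k) = 0.

The global dimension `gldh A` is the supremum over all pairs of `A`-modules `M, N`
of the integers `p` with `Ext_A^p(M, N) ≠ 0`.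
-/

open CategoryTheory Limits IsLocalRing

universe u

/-- The global dimension of a commutative ring: the supremum (in `ℕ∞`) over all pairs of
modules `M, N` of the integers `p` with `Ext_A^p(M, N) ≠ 0`. -/
noncomputable def gldh (A : Type u) [CommRing A] : ℕ∞ :=
  sSup {n : ℕ∞ | ∃ (p : ℕ) (M N : ModuleCat.{u} A),
    n = (p : ℕ∞) ∧ ¬ IsZero (((Ext A (ModuleCat.{u} A) p).obj (Opposite.op M)).obj N)}


namespace GldhAux

section Derived

variable {C : Type*} [Category* C] [Abelian C] {D : Type*} [Category* D] [Abelian D]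

lemma isZero_leftDerived_iff [HasProjectiveResolutions C] (F : C ⥤ D) [F.Additive] {X : C}
    (P : ProjectiveResolution X) (n : ℕ) :
    IsZero ((F.leftDerived (n + 1)).obj X) ↔
      ((ShortComplex.mk _ _ (P.complex.d_comp_d (n + 2) (n + 1) n)).map F).Exact := by
  rw [(P.isoLeftDerivedObj F (n + 1)).isZero_iff]
  erw [← HomologicalComplex.exactAt_iff_isZero_homology]
  rw [HomologicalComplex.exactAt_iff' _ (n + 2) (n + 1) n (by simp only [ChainComplex.prev]; rfl)
    (by simp)]
  rfl

noncomputable def aug {Z : C} (Q : ProjectiveResolution Z) : Q.complex.X 0 ⟶ Z := Q.π.f 0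

lemma d_aug {Z : C} (Q : ProjectiveResolution Z) : Q.complex.d 1 0 ≫ aug Q = 0 :=
  Q.complex_d_comp_π_f_zero

instance {Z : C} (Q : ProjectiveResolution Z) : Epi (aug Q) :=
  (inferInstance : Epi (Q.π.f 0))

lemma exact_aug {Z : C} (Q : ProjectiveResolution Z) : (ShortComplex.mk _ _ (d_aug Q)).Exact :=
  Q.exact₀

lemma d_aug_comp {S : ShortComplex C} (Q : ProjectiveResolution S.X₁) :
    Q.complex.d 1 0 ≫ aug Q ≫ S.f = 0 := by
  rw [← Category.assoc, d_aug, zero_comp]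

lemma aug_comp_zero {S : ShortComplex C} (Q : ProjectiveResolution S.X₁) :
    (aug Q ≫ S.f) ≫ S.g = 0 := by
  rw [Category.assoc, S.zero, comp_zero]

noncomputable def splice {S : ShortComplex C} (hS : S.ShortExact) [Projective S.X₂]
    (Q : ProjectiveResolution S.X₁) : ProjectiveResolution S.X₃ where
  complex := Q.complex.augment (aug Q ≫ S.f) (d_aug_comp Q)
  projective n := by
    cases n with
    | zero => exact (inferInstance : Projective S.X₂)
    | succ n => exact (inferInstance : Projective (Q.complex.X n))
  π := (ChainComplex.toSingle₀Equiv _ _).symm ⟨S.g, aug_comp_zero Q⟩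
  quasiIso := ⟨fun n => by
    have hm : Mono S.f := hS.mono_f
    cases n with
    | zero =>
      rw [ChainComplex.quasiIsoAt₀_iff, ShortComplex.quasiIso_iff_of_zeros']
      · have h1 : (ShortComplex.mk (aug Q ≫ S.f) S.g
            (aug_comp_zero Q)).Exact := by
          let φ : ShortComplex.mk (aug Q ≫ S.f) S.g
            (aug_comp_zero Q) ⟶ S :=
            { τ₁ := aug Q, τ₂ := 𝟙 _, τ₃ := 𝟙 _ }
          have : Epi φ.τ₁ := (inferInstance : Epi (aug Q))
          have : IsIso φ.τ₂ := (inferInstance : IsIso (𝟙 S.X₂))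
          have : Mono φ.τ₃ := (inferInstance : Mono (𝟙 S.X₃))
          exact (ShortComplex.exact_iff_of_epi_of_isIso_of_mono φ).2 hS.exact
        refine (ShortComplex.exact_and_epi_g_iff_of_iso ?_).2 ⟨h1, hS.epi_g⟩
        exact ShortComplex.isoMk (Iso.refl _) (Iso.refl _) (Iso.refl _)
          (by erw [Category.id_comp, Category.comp_id]; rfl)
          (by
            erw [Category.id_comp, Category.comp_id]
            exact (ChainComplex.toSingle₀Equiv_symm_apply_f_zero
              (C := Q.complex.augment (aug Q ≫ S.f) (d_aug_comp Q)) (X := S.X₃)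
              S.g (aug_comp_zero Q)).symm)
      all_goals rfl
    | succ n =>
      rw [quasiIsoAt_iff_exactAt' (hL := ChainComplex.exactAt_succ_single_obj _ _)]
      rw [HomologicalComplex.exactAt_iff' _ (n + 2) (n + 1) n
        (by simp only [ChainComplex.prev]; rfl) (by simp)]
      cases n with
      | zero =>
        let φ : ShortComplex.mk _ _ (d_aug Q) ⟶ 
          ShortComplex.mk (Q.complex.d 1 0) (aug Q ≫ S.f) 
            (d_aug_comp Q) :=
            { τ₁ := 𝟙 _, τ₂ := 𝟙 _, τ₃ := S.f }
        have : Epi φ.τ₁ := (inferInstance : Epi (𝟙 (Q.complex.X 1)))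
        have : IsIso φ.τ₂ := (inferInstance : IsIso (𝟙 (Q.complex.X 0)))
        have : Mono φ.τ₃ := hm
        exact (ShortComplex.exact_iff_of_epi_of_isIso_of_mono φ).1 (exact_aug Q)
      | succ n => exact Q.exact_succ n⟩

lemma isZero_leftDerived_shift [HasProjectiveResolutions C] (F : C ⥤ D) [F.Additive]
    {S : ShortComplex C} (hS : S.ShortExact) [Projective S.X₂] (n : ℕ) :
    IsZero ((F.leftDerived (n + 2)).obj S.X₃) ↔ IsZero ((F.leftDerived (n + 1)).obj S.X₁) := by
  let Q : ProjectiveResolution S.X₁ := (HasProjectiveResolution.out (Z := S.X₁)).some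
  rw [isZero_leftDerived_iff F Q, isZero_leftDerived_iff F (splice hS Q)]
  rfl

lemma isZero_leftDerived_one [HasProjectiveResolutions C] (F : C ⥤ D) [F.Additive]
    {S : ShortComplex C} (hS : S.ShortExact) [Projective S.X₂] (Q : ProjectiveResolution S.X₁) :
    IsZero ((F.leftDerived 1).obj S.X₃) ↔ 
      ((ShortComplex.mk (Q.complex.d 1 0) (aug Q ≫ S.f) 
            (d_aug_comp Q)).map F).Exact := by
  rw [isZero_leftDerived_iff F (splice hS Q)]
  rfl

lemma isZero_leftDerived_of_pd [EnoughProjectives C] (F : C ⥤ D) [F.Additive]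
    (n p : ℕ) (hp : n ≤ p) (X : C) [hX : HasProjectiveDimensionLT X (n + 1)] :
    IsZero ((F.leftDerived (p + 1)).obj X) := by
  induction n generalizing X p with
  | zero =>
    have : Projective X := projective_iff_hasProjectiveDimensionLT_one.2 hX
    exact F.isZero_leftDerived_obj_projective_succ p X
  | succ n ih =>
    obtain ⟨p, rfl⟩ : ∃ q, p = q + 1 := ⟨p - 1, by omega⟩
    let S : ShortComplex C := ShortComplex.mk (kernel.ι (Projective.π X)) (Projective.π X) (by simp)
    have hS : S.ShortExact :=
      { exact := ShortComplex.exact_kernel _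
        mono_f := (inferInstance : Mono (kernel.ι _))
        epi_g := (inferInstance : Epi (Projective.π X)) }
    have : Projective S.X₂ := (inferInstance : Projective (Projective.over X))
    have := (hS.hasProjectiveDimensionLT_X₃_iff n inferInstance).1 hX
    exact (isZero_leftDerived_shift F hS p).2 (ih p (by omega) S.X₁)

end Derived

section Mod

variable {A : Type u} [CommRing A]

lemma mono_of_exact (F : ModuleCat.{u} A ⥤ ModuleCat.{u} A) [F.Additive]
    [F.PreservesEpimorphisms] {S : ShortComplex (ModuleCat.{u} A)} (Q : ProjectiveResolution S.X₁)
    (h : ((ShortComplex.mk (Q.complex.d 1 0) (aug Q ≫ S.f) (d_aug_comp Q)).map F).Exact) :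
    Function.Injective (F.map S.f).hom := by
  rw [ShortComplex.moduleCat_exact_iff] at h
  rw [injective_iff_map_eq_zero]
  intro x hx
  have hs : Function.Surjective (F.map (aug Q)) :=
    (ModuleCat.epi_iff_surjective _).1 inferInstance
  obtain ⟨y, rfl⟩ := hs x
  obtain ⟨z, rfl⟩ := h y (by
    change F.map (aug Q ≫ S.f) y = 0
    rw [F.map_comp]
    exact hx)
  have h0 : F.map (Q.complex.d 1 0) ≫ F.map (aug Q) = 0 := by
    rw [← F.map_comp, d_aug, F.map_zero]
  exact congrArg (fun f => f.hom z) h0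

lemma isZero_ext_iff (p : ℕ) (M N : ModuleCat.{u} A) :
    IsZero (((Ext A (ModuleCat.{u} A) p).obj (Opposite.op M)).obj N) ↔
    IsZero (((((linearYoneda A (ModuleCat.{u} A)).obj N).rightOp).leftDerived p).obj M) := by
  constructor
  · intro h
    exact h.op
  · intro h
    exact h.unop

lemma pd_of_ext (n : ℕ) (M : ModuleCat.{u} A)
    (h : ∀ N : ModuleCat.{u} A,
      IsZero (((((linearYoneda A (ModuleCat.{u} A)).obj N).rightOp).leftDerived (n + 1)).obj M)) :
    HasProjectiveDimensionLT M (n + 1) := by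
  induction n generalizing M with
  | zero =>
    have hS := M.shortExact_projectiveShortComplex
    have hP : Projective M.projectiveShortComplex.X₂ := inferInstance
    obtain ⟨Q⟩ := HasProjectiveResolution.out (Z := M.projectiveShortComplex.X₁)
    have h1 := (isZero_leftDerived_one _ hS Q).1 (h M.projectiveShortComplex.X₁)
    have h2 := h1.unop
    rw [ShortComplex.moduleCat_exact_iff] at h2
    obtain ⟨φ, hφ⟩ := h2 (aug Q) (d_aug Q)
    change M.projectiveShortComplex.X₂ ⟶ M.projectiveShortComplex.X₁ at φ
    change (aug Q ≫ M.projectiveShortComplex.f) ≫ φ = aug Q at hφ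
    have h3 : M.projectiveShortComplex.f ≫ φ = 𝟙 _ := by
      rw [← cancel_epi (aug Q), ← Category.assoc, hφ, Category.comp_id]
    have := hS.epi_g
    let s := ShortComplex.Splitting.ofExactOfRetraction _ hS.exact φ h3 inferInstance
    have : Projective M.projectiveShortComplex.X₃ :=
      (Retract.mk s.s M.projectiveShortComplex.g s.s_g).projective
    exact projective_iff_hasProjectiveDimensionLT_one.1 this
  | succ n ih =>
    have hS := M.shortExact_projectiveShortComplex
    have hP : Projective M.projectiveShortComplex.X₂ := inferInstance
    refine (hS.hasProjectiveDimensionLT_X₃_iff n inferInstance).2 (ih _ fun N => ?_)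
    exact (isZero_leftDerived_shift _ hS n).1 (h N)

variable [IsNoetherianRing A] [IsLocalRing A]

lemma pd_of_tor (n : ℕ) (M : ModuleCat.{u} A) [Module.Finite A M]
    (h : IsZero (((Tor (ModuleCat.{u} A) (n + 1)).obj
        (ModuleCat.of A (ResidueField A))).obj M)) :
    HasProjectiveDimensionLT M (n + 1) := by
  induction n generalizing M with
  | zero =>
    rcases Module.exists_finite_presentation A M with ⟨L, _, _, _, _, f, surjf⟩
    let S : ShortComplex (ModuleCat.{u} A) := f.shortComplexKer
    have hS : S.ShortExact := LinearMap.shortExact_shortComplexKer surjf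
    have hP : Projective S.X₂ := (inferInstance : Projective (ModuleCat.of A L))
    obtain ⟨Q⟩ := HasProjectiveResolution.out (Z := S.X₁)
    have h1 := (isZero_leftDerived_one _ hS Q).1 h
    have : ((MonoidalCategory.tensoringLeft (ModuleCat.{u} A)).obj
        (ModuleCat.of A (ResidueField A))).PreservesEpimorphisms :=
      (inferInstance : (MonoidalCategory.tensorLeft
        (ModuleCat.of A (ResidueField A))).PreservesEpimorphisms)
    have h2 := mono_of_exact _ Q h1
    have h3 : Function.Injective ((LinearMap.ker f).subtype.lTensor (ResidueField A)) := h2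
    have : Module.Free A M := Module.free_of_lTensor_residueField_injective
      (LinearMap.ker f).subtype f surjf (LinearMap.exact_subtype_ker_map f) h3
    have : Projective M := inferInstance
    exact projective_iff_hasProjectiveDimensionLT_one.1 this
  | succ n ih =>
    rcases Module.exists_finite_presentation A M with ⟨L, _, _, _, _, f, surjf⟩
    let S : ShortComplex (ModuleCat.{u} A) := f.shortComplexKer
    have hS : S.ShortExact := LinearMap.shortExact_shortComplexKer surjf
    have hP : Projective S.X₂ := (inferInstance : Projective (ModuleCat.of A L))
    have : Module.Finite A S.X₁ := (inferInstance : Module.Finite A (LinearMap.ker f))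
    refine (hS.hasProjectiveDimensionLT_X₃_iff n inferInstance).2 (ih S.X₁ ?_)
    exact (isZero_leftDerived_shift _ hS n).1 h

omit [IsNoetherianRing A] [IsLocalRing A] in
lemma id_of_ext (n : ℕ) (N : ModuleCat.{u} A)
    (h : ∀ I : Ideal A, Subsingleton (Abelian.Ext (ModuleCat.of A (A ⧸ I)) N (n + 1))) :
    HasInjectiveDimensionLT N (n + 1) := by
  induction n generalizing N with
  | zero =>
    rw [zero_add, ← injective_iff_hasInjectiveDimensionLT_one,
      ← Module.injective_iff_injective_object A N]
    refine Module.Baer.injective fun I g => ?_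
    let S : ShortComplex (ModuleCat.{u} A) :=
      ShortComplex.mk (ModuleCat.ofHom I.subtype) (ModuleCat.ofHom I.mkQ) (by
        refine ModuleCat.hom_ext (LinearMap.ext fun x => ?_)
        exact (Submodule.Quotient.mk_eq_zero I).2 x.2)
    have hS : S.ShortExact :=
      { exact := by
          rw [ShortComplex.moduleCat_exact_iff]
          intro y hy
          exact ⟨⟨y, (Submodule.Quotient.mk_eq_zero I).1 hy⟩, rfl⟩
        mono_f := (ModuleCat.mono_iff_injective _).2 (Submodule.injective_subtype I)
        epi_g := (ModuleCat.epi_iff_surjective _).2 (Submodule.mkQ_surjective I) }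
    have : Subsingleton (Abelian.Ext S.X₃ N (0 + 1)) := h I
    obtain ⟨φ, hφ⟩ := Abelian.Ext.contravariant_sequence_exact₁ hS N
      (Abelian.Ext.mk₀ (ModuleCat.ofHom g : S.X₁ ⟶ N)) (n₁ := 0 + 1) rfl (Subsingleton.elim _ _)
    obtain ⟨ψ, rfl⟩ := (Abelian.Ext.mk₀_bijective _ _).2 φ
    rw [Abelian.Ext.mk₀_comp_mk₀, (Abelian.Ext.mk₀_bijective _ _).1.eq_iff] at hφ
    refine ⟨ψ.hom, fun x hx => ?_⟩
    exact congrArg (fun f => f.hom (⟨x, hx⟩ : I)) hφ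
  | succ n ih =>
    let S : ShortComplex (ModuleCat.{u} A) :=
      ShortComplex.mk (Injective.ι N) (cokernel.π (Injective.ι N)) (by simp)
    have hS : S.ShortExact :=
      { exact := ShortComplex.exact_cokernel _
        mono_f := (inferInstance : Mono (Injective.ι N))
        epi_g := (inferInstance : Epi (cokernel.π _)) }
    have : Injective S.X₂ := (inferInstance : Injective (Injective.under N))
    refine (hS.hasInjectiveDimensionLT_X₃_iff n inferInstance).1 (ih S.X₃ fun I => ?_)
    refine subsingleton_of_forall_eq 0 fun e => ?_
    have : Subsingleton (Abelian.Ext (ModuleCat.of A (A ⧸ I)) S.X₁ (n + 1 + 1)) := h I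
    obtain ⟨e', rfl⟩ := Abelian.Ext.covariant_sequence_exact₃ _ hS e rfl (Subsingleton.elim _ _)
    rw [Abelian.Ext.eq_zero_of_injective e', Abelian.Ext.zero_comp]

/-- The complex `A/J → A/I → A/K` with `J = (I : x)` and `K = I + (x)`. -/
noncomputable def colonComplex (I J K : Ideal A) (x : A) (hJ : ∀ a, a ∈ J ↔ x * a ∈ I)
    (hK : K = I ⊔ Ideal.span {x}) : ShortComplex (ModuleCat.{u} A) :=
  ShortComplex.mk
    (X₁ := ModuleCat.of A (A ⧸ J)) (X₂ := ModuleCat.of A (A ⧸ I)) (X₃ := ModuleCat.of A (A ⧸ K))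
    (ModuleCat.ofHom (Submodule.mapQ J I (LinearMap.lsmul A A x) (fun a ha => (hJ a).1 ha)))
    (ModuleCat.ofHom (Submodule.mapQ I K LinearMap.id (fun a ha => by
      rw [hK]; exact Ideal.mem_sup_left ha)))
    (by
      refine ModuleCat.hom_ext (LinearMap.ext fun y => ?_)
      obtain ⟨y, rfl⟩ := Submodule.mkQ_surjective J y
      refine (Submodule.Quotient.mk_eq_zero K).2 ?_
      change x * y ∈ K
      rw [hK]
      exact Ideal.mem_sup_right (Ideal.mul_mem_right _ _ (Ideal.mem_span_singleton_self x)))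

omit [IsNoetherianRing A] [IsLocalRing A] in
lemma colonComplex_shortExact (I J K : Ideal A) (x : A) (hJ : ∀ a, a ∈ J ↔ x * a ∈ I)
    (hK : K = I ⊔ Ideal.span {x}) : (colonComplex I J K x hJ hK).ShortExact where
  exact := by
    rw [ShortComplex.moduleCat_exact_iff]
    intro y hy
    obtain ⟨y, rfl⟩ := Submodule.mkQ_surjective I y
    have hy' : y ∈ K := (Submodule.Quotient.mk_eq_zero K).1 hy
    rw [hK] at hy'
    obtain ⟨i, hi, b, hb, rfl⟩ := Submodule.mem_sup.1 hy'
    obtain ⟨a, rfl⟩ := Ideal.mem_span_singleton'.1 hb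
    refine ⟨J.mkQ a, ?_⟩
    refine (Submodule.Quotient.eq I).2 ?_
    change x * a - (i + a * x) ∈ I
    have : x * a - (i + a * x) = -i := by ring
    rw [this]
    exact I.neg_mem hi
  mono_f := by
    refine (ModuleCat.mono_iff_injective _).2 ((injective_iff_map_eq_zero _).2 fun y hy => ?_)
    obtain ⟨y, rfl⟩ := Submodule.mkQ_surjective J y
    exact (Submodule.Quotient.mk_eq_zero J).2 ((hJ y).2 ((Submodule.Quotient.mk_eq_zero I).1 hy))
  epi_g := by
    refine (ModuleCat.epi_iff_surjective _).2 fun y => ?_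
    obtain ⟨y, rfl⟩ := Submodule.mkQ_surjective K y
    exact ⟨I.mkQ y, rfl⟩

lemma subsingleton_ext_of_smul {M K : ModuleCat.{u} A} [Module.Finite A M] (f : M ⟶ M)
    (g : M ⟶ K) (x : A) (hxm : x ∈ maximalIdeal A) (hf : f = x • 𝟙 M) (w : f ≫ g = 0)
    (hS : (ShortComplex.mk f g w).ShortExact) (N : ModuleCat.{u} A) [Module.Finite A N] (i : ℕ)
    (h : Subsingleton (Abelian.Ext K N (1 + i))) : Subsingleton (Abelian.Ext M N i) := by
  have key : (⊤ : Submodule A (Abelian.Ext M N i)) ≤ maximalIdeal A • ⊤ := by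
    intro e _
    obtain ⟨e', he'⟩ := Abelian.Ext.contravariant_sequence_exact₁ hS N (n₁ := 1 + i)
      e rfl (h.elim _ _)
    subst hf
    have he2 : x • e' = e := by
      rw [← he']
      simp only [Abelian.Ext.mk₀_smul, Abelian.Ext.smul_comp, Abelian.Ext.mk₀_id_comp]
    rw [← he2]
    exact Submodule.smul_mem_smul hxm trivial
  have hbot := Submodule.eq_bot_of_le_smul_of_le_jacobson_bot (maximalIdeal A) ⊤
    (Module.Finite.fg_top) key (IsLocalRing.maximalIdeal_le_jacobson _)
  exact (Submodule.subsingleton_iff A).1 (subsingleton_of_bot_eq_top hbot.symm)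

lemma ext_quotient (n : ℕ)
    (hk : HasProjectiveDimensionLT (ModuleCat.of A (ResidueField A)) (n + 1))
    (N : ModuleCat.{u} A) [Module.Finite A N] (I : Ideal A) :
    ∀ i, n + 1 ≤ i → Subsingleton (Abelian.Ext (ModuleCat.of A (A ⧸ I)) N i) := by
  induction I using WellFoundedGT.induction with
  | ind I ih =>
  intro i hi
  by_cases hT : I = ⊤
  · subst hT
    have hz : IsZero (ModuleCat.of A (A ⧸ (⊤ : Ideal A))) :=
      ModuleCat.isZero_of_subsingleton _
    have := hz.hasProjectiveDimensionLT_zero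
    exact HasProjectiveDimensionLT.subsingleton _ 0 i (Nat.zero_le _) N
  by_cases hM : I = maximalIdeal A
  · subst hM
    exact HasProjectiveDimensionLT.subsingleton (ModuleCat.of A (ResidueField A)) (n + 1) i hi N
  obtain ⟨x, hxm, hxI⟩ := SetLike.exists_of_lt (lt_of_le_of_ne (le_maximalIdeal hT) hM)
  have hlt : I < I ⊔ Ideal.span {x} := by
    refine lt_of_le_of_ne le_sup_left fun h => hxI ?_
    rw [h]
    exact Ideal.mem_sup_right (Ideal.mem_span_singleton_self x)
  by_cases hJ : ∀ a, a ∈ I ↔ x * a ∈ I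
  · have hS := colonComplex_shortExact I I _ x hJ rfl
    refine subsingleton_ext_of_smul _ _ x hxm ?_ _ hS N i (ih _ hlt (1 + i) (by omega))
    refine ModuleCat.hom_ext (LinearMap.ext fun y => ?_)
    obtain ⟨y, rfl⟩ := Submodule.mkQ_surjective I y
    rfl
  · let J : Ideal A := Submodule.comap (LinearMap.lsmul A A x) I
    have hJ' : ∀ a, a ∈ J ↔ x * a ∈ I := fun a => Iff.rfl
    have hIJ : I < J := by
      refine lt_of_le_of_ne (fun a ha => I.mul_mem_left x ha) fun h => hJ ?_
      intro a
      rw [← hJ', ← h]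
    have hS := colonComplex_shortExact I J _ x hJ' rfl
    have h1 := ih J hIJ i hi
    have h3 := ih _ hlt i hi
    refine subsingleton_of_forall_eq 0 fun e => ?_
    obtain ⟨e', rfl⟩ := Abelian.Ext.contravariant_sequence_exact₂ hS N e (h1.elim _ _)
    have : e' = 0 := h3.elim _ _
    subst this
    simp
    rfl

lemma pd_all (n : ℕ)
    (hk : HasProjectiveDimensionLT (ModuleCat.of A (ResidueField A)) (n + 1))
    (M : ModuleCat.{u} A) : HasProjectiveDimensionLT M (n + 1) := by
  have hN (N : ModuleCat.{u} A) : HasInjectiveDimensionLT N (n + 1) := by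
    refine id_of_ext n N fun I => ?_
    have : HasProjectiveDimensionLT (ModuleCat.of A (A ⧸ I)) (n + 1) :=
      ModuleCat.hasProjectiveDimensionLT_of_forall_finite _ _ fun L _ =>
        ext_quotient n hk L I _ le_rfl
    exact HasProjectiveDimensionLT.subsingleton _ (n + 1) (n + 1) le_rfl N
  rw [hasProjectiveDimensionLT_iff]
  intro i hi Y e
  exact e.eq_zero_of_hasInjectiveDimensionLT (n + 1) hi

end Mod

end GldhAux

theorem gldh_le_iff_tor_succ_eq_zero
    (A : Type u) [CommRing A] [IsNoetherianRing A] [IsLocalRing A] (n : ℕ) :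
    gldh A ≤ (n : ℕ∞) ↔
      IsZero (((Tor (ModuleCat.{u} A) (n + 1)).obj
        (ModuleCat.of A (ResidueField A))).obj (ModuleCat.of A (ResidueField A))) := by
  have hiff : gldh A ≤ (n : ℕ∞) ↔ ∀ (p : ℕ) (M N : ModuleCat.{u} A), n < p →
      IsZero (((Ext A (ModuleCat.{u} A) p).obj (Opposite.op M)).obj N) := by
    unfold gldh
    rw [sSup_le_iff]
    constructor
    · intro h p M N hp
      by_contra hz
      have := h p ⟨p, M, N, rfl, hz⟩
      exact absurd (Nat.cast_le.1 this) (by omega)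
    · rintro h _ ⟨p, M, N, rfl, hz⟩
      by_contra hlt
      exact hz (h p M N (by simpa using hlt))
  rw [hiff]
  constructor
  · intro h
    have := GldhAux.pd_of_ext n (ModuleCat.of A (ResidueField A)) fun N =>
      (GldhAux.isZero_ext_iff _ _ _).1 (h (n + 1) _ N (by omega))
    exact GldhAux.isZero_leftDerived_of_pd _ n n le_rfl _
  · intro h p M N hp
    have : Module.Finite A (ModuleCat.of A (ResidueField A)) :=
      (inferInstance : Module.Finite A (ResidueField A))
    have hk := GldhAux.pd_of_tor n _ h
    have := GldhAux.pd_all n hk M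
    obtain ⟨p, rfl⟩ : ∃ q, p = q + 1 := ⟨p - 1, by omega⟩
    exact (GldhAux.isZero_ext_iff _ _ _).2
      (GldhAux.isZero_leftDerived_of_pd _ n p (by omega) M)
end

section
/- Let (A, m) be a noetherian local ring of finite global dimension n = gldh A, and let M be a nonzero finitely generated A-module. Then pd M + depth M = n, where pd M is the projective dimension of M and depth M is the m-depth of M (Auslander–Buchsbaum formula). -/
/-!
STATEMENT 3: Let (A, m) be a noetherian local ring of finite global dimension n = gldh A,
and let M be a nonzero finitely generated A-module. Then pd M + depth M = n
(Auslander–Buchsbaum formula).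
-/

open CategoryTheory Limits IsLocalRing

universe u

/-- The projective dimension of a module `M`: the supremum (in `ℕ∞`) over all modules `N`
of the integers `p` with `Ext_A^p(M, N) ≠ 0`. -/
noncomputable def pdim (A : Type u) [CommRing A] (M : ModuleCat.{u} A) : ℕ∞ :=
  sSup {n : ℕ∞ | ∃ (p : ℕ) (N : ModuleCat.{u} A),
    n = (p : ℕ∞) ∧ ¬ IsZero (((Ext A (ModuleCat.{u} A) p).obj (Opposite.op M)).obj N)}

/-- The `m`-depth of a module `M` over a local ring `(A, m)`: the supremum (in `ℕ∞`) of the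
lengths of `M`-regular sequences consisting of elements of `m`. -/
noncomputable def mdepth (A : Type u) [CommRing A] [IsLocalRing A]
    (M : Type u) [AddCommGroup M] [Module A M] : ℕ∞ :=
  sSup {n : ℕ∞ | ∃ rs : List A, (∀ x ∈ rs, x ∈ maximalIdeal A) ∧
    RingTheory.Sequence.IsRegular M rs ∧ n = (rs.length : ℕ∞)}

lemma bridge (A : Type u) [CommRing A] (p : ℕ) (X Y : ModuleCat.{u} A) :
   IsZero (((Ext A (ModuleCat.{u} A) (p+1)).obj (Opposite.op X)).obj Y) ↔ Subsingleton (Abelian.Ext X Y (p+1)) := by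
  let P := projectiveResolution X
  rw [(P.isoExt (R := A) (p+1) Y).isZero_iff, ← HomologicalComplex.exactAt_iff_isZero_homology,
    HomologicalComplex.exactAt_iff' _ p (p+1) (p+2) (by simp) (by simp), ShortComplex.moduleCat_exact_iff]
  constructor
  · intro h
    refine subsingleton_of_forall_eq 0 fun α ↦ ?_
    obtain ⟨f, hf, rfl⟩ := P.extMk_surjective α (p+2) rfl
    rw [P.extMk_eq_zero_iff f (p+2) rfl hf p rfl]
    exact h f hf
  · intro h f hf
    have := (P.extMk_eq_zero_iff f (p+2) rfl hf p rfl).1 (Subsingleton.elim _ _)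
    exact this

lemma ses {A : Type u} [CommRing A] {X Y Z : Type u} [AddCommGroup X] [Module A X]
   [AddCommGroup Y] [Module A Y] [AddCommGroup Z] [Module A Z] (f : X →ₗ[A] Y) (g : Y →ₗ[A] Z)
   (hf : Function.Injective f) (hg : Function.Surjective g) (h : Function.Exact f g) :
   ∃ w, (ShortComplex.mk (ModuleCat.ofHom f) (ModuleCat.ofHom g) w).ShortExact := by
  have w : ModuleCat.ofHom f ≫ ModuleCat.ofHom g = 0 := by
    ext x; exact h.apply_apply_eq_zero x
  refine ⟨w, ?_⟩
  have : Mono (ModuleCat.ofHom f) := (ModuleCat.mono_iff_injective _).2 hf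
  have : Epi (ModuleCat.ofHom g) := (ModuleCat.epi_iff_surjective _).2 hg
  exact { exact := (ShortComplex.ShortExact.moduleCat_exact_iff_function_exact _).2 h }

section
open Abelian

lemma ext_baer (A : Type u) [CommRing A] (n : ℕ) (Y : ModuleCat.{u} A)
    (h : ∀ I : Ideal A, Subsingleton (Ext (ModuleCat.of A (A ⧸ I)) Y (n+1))) (X : ModuleCat.{u} A) :
    Subsingleton (Ext X Y (n+1)) := by
  induction n generalizing Y with
  | zero =>
    have hb : Module.Baer A Y := by
      intro I g
      obtain ⟨w, hS⟩ := ses (I.subtype : I →ₗ[A] A) I.mkQ I.subtype_injective I.mkQ_surjective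
        (LinearMap.exact_subtype_mkQ I)
      have := h I
      obtain ⟨φ, hφ⟩ := Ext.contravariant_sequence_exact₁ hS Y
        (Ext.mk₀ (ModuleCat.ofHom g)) (n₁ := 1) (by simp) (@Subsingleton.elim _ (h I) _ _)
      obtain ⟨φ, rfl⟩ := Ext.homEquiv₀.symm.surjective φ
      rw [Ext.homEquiv₀_symm_apply, Ext.mk₀_comp_mk₀] at hφ
      have hφ' := (Ext.mk₀_bijective _ _).1 hφ
      refine ⟨φ.hom, fun x hx ↦ ?_⟩
      have := congr(ModuleCat.Hom.hom $hφ' ⟨x, hx⟩)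
      exact this
    have := hb.injective
    have : Injective Y := Module.injective_object_of_injective_module A Y
    exact injective_iff_subsingleton_ext_one.1 this (Y := X)
  | succ n ih =>
    obtain ⟨⟨J, _, ι, _⟩⟩ := EnoughInjectives.presentation Y
    let S := ShortComplex.mk ι (cokernel.π ι) (by simp)
    have hS : S.ShortExact := { exact := ShortComplex.exact_cokernel ι }
    have : Injective S.X₂ := by assumption
    have key := ih S.X₃ (fun I ↦ by
      refine subsingleton_of_forall_eq 0 fun x ↦ ?_
      have := h I
      obtain ⟨y, rfl⟩ := Ext.covariant_sequence_exact₃ _ hS x (n₁ := n+1+1) rfl (@Subsingleton.elim _ (h I) _ _)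
      rw [Ext.eq_zero_of_injective y]; simp)
    refine subsingleton_of_forall_eq 0 fun x ↦ ?_
    obtain ⟨y, rfl⟩ := Ext.covariant_sequence_exact₁ _ hS x (Ext.eq_zero_of_injective _) rfl
    rw [Subsingleton.elim y 0]; simp

lemma nak {A : Type u} [CommRing A] [IsNoetherianRing A] [IsLocalRing A] (n : ℕ)
    (hn : ∀ X Y : ModuleCat.{u} A, Subsingleton (Ext X Y (n+1)))
    (M L : ModuleCat.{u} A) [Module.Finite A M] [Module.Finite A L] (x : A)
    (hx : x ∈ maximalIdeal A) (reg : IsSMulRegular M x) : Subsingleton (Ext M L n) := by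
  have hS := reg.smulShortComplex_shortExact
  by_contra! ntr
  have : x ∈ (Module.annihilator A (Ext M L n)).jacobson :=
    (IsLocalRing.maximalIdeal_le_jacobson _) hx
  refine Submodule.top_ne_pointwise_smul_of_mem_jacobson_annihilator this ?_
  rw [eq_comm, eq_top_iff]
  intro y hy
  obtain ⟨z, hz⟩ := Ext.contravariant_sequence_exact₁ hS L y (n₁ := n+1) (by omega) (@Subsingleton.elim _ (hn _ _) _ _)
  have e : (M.smulShortComplex x).f = x • 𝟙 M := rfl
  have hz' : ∀ z : Ext M L n, (Ext.mk₀ (x • 𝟙 M)).comp z (zero_add n) = x • z := fun z ↦ by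
    rw [Ext.mk₀_smul, Ext.smul_comp, Ext.mk₀_id_comp]
  rw [← hz]
  change (Ext.mk₀ (x • 𝟙 M)).comp (show Ext M L n from z) (zero_add n) ∈ _
  rw [hz']
  exact Submodule.smul_mem_pointwise_smul _ _ ⊤ trivial

lemma ext_residue {A : Type u} [CommRing A] [IsNoetherianRing A] [IsLocalRing A] (n : ℕ)
    (hn : ∀ X Y : ModuleCat.{u} A, Subsingleton (Ext X Y (n+1))) (L : ModuleCat.{u} A) [Module.Finite A L]
    (hk : Subsingleton (Ext (ModuleCat.of A (A ⧸ maximalIdeal A)) L n))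
    (X : Type u) [AddCommGroup X] [Module A X] [hX : Module.Finite A X] :
    Subsingleton (Ext (ModuleCat.of A X) L n) := by
  induction hX using IsNoetherianRing.induction_on_isQuotientEquivQuotientPrime A with
  | subsingleton N =>
    have : IsZero (ModuleCat.of A N) := ModuleCat.isZero_of_subsingleton _
    have := this.hasProjectiveDimensionLT_zero
    exact HasProjectiveDimensionLT.subsingleton _ 0 n (by omega) L
  | quotient N p e =>
    by_cases hp : p.asIdeal = maximalIdeal A
    · rw [hp] at e
      refine subsingleton_of_forall_eq 0 fun y ↦ ?_
      have : y = (Ext.mk₀ (e.toModuleIso.hom)).comp ((Ext.mk₀ (e.toModuleIso.inv)).comp y (zero_add n)) (zero_add n) := by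
        rw [Ext.mk₀_comp_mk₀_assoc, Iso.hom_inv_id, Ext.mk₀_id_comp]
      rw [this, @Subsingleton.elim _ hk ((Ext.mk₀ (e.toModuleIso.inv)).comp y (zero_add n)) 0]
      simp
    · obtain ⟨x, hx, hxp⟩ := SetLike.exists_of_lt (lt_of_le_of_ne (IsLocalRing.le_maximalIdeal p.2.ne_top) hp)
      refine nak n hn _ L x hx ?_
      have hr : IsSMulRegular (A ⧸ p.asIdeal) x := by
        have := p.2
        rw [isSMulRegular_iff_right_eq_zero_of_smul]
        intro y hy
        rw [Algebra.smul_def] at hy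
        exact (mul_eq_zero.1 hy).resolve_left (by
          simpa [Ideal.Quotient.eq_zero_iff_mem] using hxp)
      exact (e.isSMulRegular_congr x).2 hr
  | exact N₁ N₂ N₃ f g hf hg h h1 h3 =>
    obtain ⟨w, hS⟩ := ses f g hf hg h
    refine subsingleton_of_forall_eq 0 fun y ↦ ?_
    obtain ⟨z, rfl⟩ := Ext.contravariant_sequence_exact₂ hS L y (@Subsingleton.elim _ h1 _ _)
    rw [@Subsingleton.elim _ h3 z 0]; simp

lemma ext_k {A : Type u} [CommRing A] [IsNoetherianRing A] [IsLocalRing A] (n : ℕ)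
    (hn : ∀ X Y : ModuleCat.{u} A, Subsingleton (Ext X Y (n+1)))
    (hn' : n ≠ 0 → ∃ X Y : ModuleCat.{u} A, ¬ Subsingleton (Ext X Y n)) :
    ∃ L : ModuleCat.{u} A, ¬ Subsingleton (Ext (ModuleCat.of A (A ⧸ maximalIdeal A)) L n) := by
  by_contra! hc
  have h1 : ∀ I : Ideal A, HasProjectiveDimensionLT (ModuleCat.of A (A ⧸ I)) n := fun I ↦
    ModuleCat.hasProjectiveDimensionLT_of_forall_finite _ n fun L _ ↦
      ext_residue n hn L (hc L) (A ⧸ I)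
  obtain _ | n := n
  · have := h1 (maximalIdeal A)
    have := isZero_of_hasProjectiveDimensionLT_zero (ModuleCat.of A (A ⧸ maximalIdeal A))
    rw [ModuleCat.isZero_iff_subsingleton] at this
    have h2 : Nontrivial (A ⧸ maximalIdeal A) :=
      Ideal.Quotient.nontrivial_iff.2 (Ideal.IsPrime.ne_top inferInstance)
    exact not_subsingleton_iff_nontrivial.2 h2 this
  · obtain ⟨X, Y, h⟩ := hn' (by omega)
    refine h (ext_baer A n Y (fun I ↦ ?_) X)
    have := h1 I
    exact HasProjectiveDimensionLT.subsingleton _ (n+1) (n+1) le_rfl Y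

lemma exists_reg {A : Type u} [CommRing A] [IsNoetherianRing A] [IsLocalRing A] (n : ℕ)
    (hn : ∀ X Y : ModuleCat.{u} A, Subsingleton (Ext X Y (n+1)))
    (hn' : n ≠ 0 → ∃ X Y : ModuleCat.{u} A, ¬ Subsingleton (Ext X Y n))
    (M : Type u) [AddCommGroup M] [Module A M] [Module.Finite A M]
    (hM : HasProjectiveDimensionLT (ModuleCat.of A M) n) :
    ∃ x ∈ maximalIdeal A, IsSMulRegular M x := by
  obtain ⟨L, hL⟩ := ext_k n hn hn'
  have := IsSMulRegular.subsingleton_linearMap_iff (R := A) (M := M) (N := A ⧸ maximalIdeal A)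
  rw [Ideal.annihilator_quotient] at this
  rw [← this]
  refine subsingleton_of_forall_eq 0 fun f ↦ ?_
  by_contra hf
  apply hL
  have hinj : Function.Injective f := by
    rw [← LinearMap.ker_eq_bot]
    have : IsSimpleModule A (A ⧸ maximalIdeal A) :=
      isSimpleModule_iff_isCoatom.2 (maximalIdeal.isMaximal A).out
    exact (eq_bot_or_eq_top (LinearMap.ker f)).resolve_right (fun h ↦ hf (LinearMap.ker_eq_top.1 h))
  obtain ⟨w, hS⟩ := ses f (LinearMap.range f).mkQ hinj (Submodule.mkQ_surjective _)
    (LinearMap.exact_map_mkQ_range f)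
  refine subsingleton_of_forall_eq 0 fun y ↦ ?_
  obtain ⟨z, rfl⟩ := Ext.contravariant_sequence_exact₁ hS L y (n₁ := n+1) (by omega)
    (@Subsingleton.elim _ (hn _ _) _ _)
  have := HasProjectiveDimensionLT.subsingleton _ (hX := hM) n n le_rfl L
  rw [@Subsingleton.elim _ this z 0]; simp

lemma exists_seq {A : Type u} [CommRing A] [IsNoetherianRing A] [IsLocalRing A] (n : ℕ)
    (hn : ∀ X Y : ModuleCat.{u} A, Subsingleton (Ext X Y (n+1)))
    (hn' : n ≠ 0 → ∃ X Y : ModuleCat.{u} A, ¬ Subsingleton (Ext X Y n)) (k : ℕ)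
    (M : Type u) [AddCommGroup M] [Module A M] [Module.Finite A M] [Nontrivial M] (p : ℕ)
    (hp : projectiveDimension (ModuleCat.of A M) = (p : WithBot ℕ∞)) (hk : p + k = n) :
    ∃ rs : List A, rs.length = k ∧ (∀ x ∈ rs, x ∈ maximalIdeal A) ∧
      RingTheory.Sequence.IsRegular M rs := by
  induction k generalizing M p with
  | zero => exact ⟨[], by simp [RingTheory.Sequence.isRegular_iff]⟩
  | succ k ih =>
    obtain ⟨x, hx, reg⟩ := exists_reg n hn hn' M (by
      rw [← projectiveDimension_lt_iff, hp]
      exact_mod_cast (by omega : p < n))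
    have := ModuleCat.projectiveDimension_quotSMulTop_eq_succ_of_isSMulRegular (ModuleCat.of A M) x reg hx
    have := nontrivial_quotSMulTop_of_mem_maximalIdeal M hx
    obtain ⟨rs, hl, hm, hr⟩ := ih (QuotSMulTop x M) (p+1) (by
      rw [hp] at *; push_cast; assumption) (by omega)
    refine ⟨x :: rs, by simp [hl], List.forall_mem_cons.2 ⟨hx, hm⟩, ?_⟩
    rw [RingTheory.Sequence.isRegular_cons_iff]
    exact ⟨reg, hr⟩

end

lemma pdim_eq {A : Type u} [CommRing A] [IsNoetherianRing A]
    (M : Type u) [AddCommGroup M] [Module A M] [Module.Finite A M] (p : ℕ)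
    (hp : projectiveDimension (ModuleCat.of A M) = (p : WithBot ℕ∞)) :
    pdim A (ModuleCat.of A M) = p := by
  apply le_antisymm
  · refine sSup_le ?_
    rintro _ ⟨q, N, rfl, hq⟩
    by_contra! hlt
    have hlt : p < q := by exact_mod_cast hlt
    obtain _ | q := q
    · omega
    rw [bridge] at hq
    have := (projectiveDimension_le_iff _ _).1 hp.le
    exact hq (HasProjectiveDimensionLT.subsingleton _ (p+1) (q+1) (by omega) N)
  · obtain _ | p := p
    · simp
    have h1 := (projectiveDimension_ge_iff _ _).1 hp.ge
    have h2 : ∃ L : ModuleCat.{u} A, ¬ Subsingleton (Abelian.Ext (ModuleCat.of A M) L (p+1)) := by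
      by_contra! hc
      exact h1 (ModuleCat.hasProjectiveDimensionLT_of_forall_finite _ _ fun L _ ↦ hc L)
    obtain ⟨L, hL⟩ := h2
    exact le_sSup ⟨p+1, L, rfl, by rwa [bridge]⟩

lemma gl1 {A : Type u} [CommRing A] (n : ℕ) (hgl : gldh A = (n : ℕ∞)) (q : ℕ) (hq : n < q)
    (X Y : ModuleCat.{u} A) : Subsingleton (Abelian.Ext X Y q) := by
  obtain _ | q := q
  · omega
  by_contra h
  rw [← bridge] at h
  have : ((q+1 : ℕ) : ℕ∞) ≤ gldh A := le_sSup ⟨q+1, X, Y, rfl, h⟩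
  rw [hgl] at this
  have : q + 1 ≤ n := by exact_mod_cast this
  omega

lemma gl2 {A : Type u} [CommRing A] (n : ℕ) (hgl : gldh A = (n : ℕ∞)) (h0 : n ≠ 0) :
    ∃ X Y : ModuleCat.{u} A, ¬ Subsingleton (Abelian.Ext X Y n) := by
  obtain _ | n := n
  · omega
  by_contra! hc
  have : gldh A ≤ (n : ℕ∞) := by
    refine sSup_le ?_
    rintro _ ⟨q, X, Y, rfl, hq⟩
    by_contra! hlt
    have hlt : n < q := by exact_mod_cast hlt
    obtain _ | q := q
    · omega
    rw [bridge] at hq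
    by_cases h : n = q
    · subst h; exact hq (hc X Y)
    · exact hq (gl1 _ hgl (q+1) (by omega) X Y)
  rw [hgl] at this
  have : n + 1 ≤ n := by exact_mod_cast this
  omega

theorem auslander_buchsbaum
    (A : Type u) [CommRing A] [IsNoetherianRing A] [IsLocalRing A]
    (n : ℕ) (hgl : gldh A = (n : ℕ∞))
    (M : Type u) [AddCommGroup M] [Module A M] [Module.Finite A M] [Nontrivial M] :
    pdim A (ModuleCat.of A M) + mdepth A M = (n : ℕ∞) := by
  have h1 := gl1 n hgl
  have h2 := gl2 n hgl
  have hle : ∀ X : ModuleCat.{u} A, projectiveDimension X ≤ (n : WithBot ℕ∞) := fun X ↦ by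
    rw [projectiveDimension_le_iff, HasProjectiveDimensionLE, hasProjectiveDimensionLT_iff]
    intro i hi Y e
    have := h1 i (by omega) X Y
    exact Subsingleton.elim _ _
  obtain ⟨p, hp⟩ : ∃ p : ℕ, projectiveDimension (ModuleCat.of A M) = (p : WithBot ℕ∞) := by
    have hb : projectiveDimension (ModuleCat.of A M) ≠ ⊥ := by
      rw [Ne, projectiveDimension_eq_bot_iff, ModuleCat.isZero_iff_subsingleton]
      exact not_subsingleton_iff_nontrivial.2 ‹_›
    have hl := hle (ModuleCat.of A M)
    generalize projectiveDimension (ModuleCat.of A M) = d at hb hl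
    induction d with
    | bot => exact absurd rfl hb
    | coe d =>
      induction d with
      | top => exact absurd (WithBot.coe_le_coe.1 hl) (by simp)
      | coe d => exact ⟨d, rfl⟩
  have hpn : p ≤ n := by
    have := hle (ModuleCat.of A M)
    rw [hp] at this
    exact_mod_cast this
  obtain ⟨k, hk⟩ := Nat.exists_eq_add_of_le hpn
  have hd : mdepth A M = (k : ℕ∞) := by
    apply le_antisymm
    · refine sSup_le ?_
      rintro _ ⟨rs, hm, hr, rfl⟩
      have h3 := ModuleCat.projectiveDimension_quotient_eq_add_length_of_isWeaklyRegular
        (ModuleCat.of A M) rs hr.toIsWeaklyRegular hm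
      have h4 := hle (ModuleCat.of A (M ⧸ Ideal.ofList rs • (⊤ : Submodule A M)))
      rw [hp] at h3
      have h5 := h3.symm.le.trans h4
      have h6 : p + rs.length ≤ n := by exact_mod_cast h5
      have : rs.length ≤ k := by omega
      exact_mod_cast this
    · obtain ⟨rs, hl, hm, hr⟩ := exists_seq n (h1 (n+1) (by omega)) h2 k M p hp hk.symm
      exact le_sSup ⟨rs, hm, hr, by rw [hl]⟩
  rw [pdim_eq M p hp, hd, hk]
  push_cast
  rfl
end

section
/- Let (A, m) be a noetherian local ring of Krull dimension n with residue field k = A/m. If m can be generated by n elements, then the associated graded ring gr_m A = ⊕_{i≥0} m^i/m^{i+1} is isomorphic as a graded k-algebra to the polynomial ring k[X_1, ..., X_n]. -/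
/-!
STATEMENT 5: Let (A, m) be a noetherian local ring of Krull dimension n with residue field
k = A/m. If m can be generated by n elements, then the associated graded ring
gr_m A = ⊕_{i≥0} mⁱ/mⁱ⁺¹ is isomorphic as a graded k-algebra to the polynomial ring
k[X_1, ..., X_n].
-/

open CategoryTheory Limits IsLocalRing Polynomial

universe u

set_option maxHeartbeats 1000000
set_option synthInstance.maxHeartbeats 400000

/-- The associated graded ring (tangential cone) `gr_m A = ⊕_{i≥0} mⁱ/mⁱ⁺¹`, realized as
the quotient of the Rees algebra `A[mt] ⊆ A[t]` by the ideal generated by `m`. -/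
noncomputable def AssocGraded (A : Type u) [CommRing A] [IsLocalRing A] : Type u :=
  ↥(reesAlgebra (maximalIdeal A)) ⧸
    (Ideal.map (algebraMap A ↥(reesAlgebra (maximalIdeal A))) (maximalIdeal A))

noncomputable instance (A : Type u) [CommRing A] [IsLocalRing A] :
    CommRing (AssocGraded A) :=
  inferInstanceAs (CommRing (↥(reesAlgebra (maximalIdeal A)) ⧸
    (Ideal.map (algebraMap A ↥(reesAlgebra (maximalIdeal A))) (maximalIdeal A))))

/-- The associated graded ring is an algebra over the residue field `k = A/m`. -/
noncomputable instance (A : Type u) [CommRing A] [IsLocalRing A] :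
    Algebra (ResidueField A) (AssocGraded A) :=
  (Ideal.Quotient.lift (maximalIdeal A)
    ((Ideal.Quotient.mk _).comp (algebraMap A ↥(reesAlgebra (maximalIdeal A))) :
        A →+* AssocGraded A)
    (fun a ha => by
      show (Ideal.Quotient.mk _) _ = 0
      rw [Ideal.Quotient.eq_zero_iff_mem]
      exact Ideal.mem_map_of_mem _ ha)).toAlgebra

/-- The degree-`i` homogeneous component of the associated graded ring, as a `k`-submodule:
the classes of the elements of the Rees algebra concentrated in degree `i`. -/
noncomputable def AssocGraded.piece (A : Type u) [CommRing A] [IsLocalRing A] (i : ℕ) :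
    Submodule (ResidueField A) (AssocGraded A) :=
  Submodule.span (ResidueField A)
    (((Ideal.Quotient.mk _ :
        ↥(reesAlgebra (maximalIdeal A)) →+* AssocGraded A)) ''
      {x : ↥(reesAlgebra (maximalIdeal A)) | ∃ a : A, (x : A[X]) = Polynomial.monomial i a})


lemma weight_inj (B : ℕ) : ∀ (n : ℕ) (a b : Fin n → ℕ), (∀ i, a i < B) → (∀ i, b i < B) →
    ∑ i, a i * B ^ (i : ℕ) = ∑ i, b i * B ^ (i : ℕ) → a = b := by
  intro n
  induction n with
  | zero => intro a b _ _ _; exact Subsingleton.elim _ _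
  | succ n ih =>
    intro a b ha hb h
    have hx : ∀ c : Fin (n+1) → ℕ, ∑ i, c i * B ^ (i : ℕ)
        = c 0 + B * ∑ i : Fin n, c i.succ * B ^ (i : ℕ) := by
      intro c
      rw [Fin.sum_univ_succ, Finset.mul_sum]
      simp only [Fin.val_zero, pow_zero, mul_one, Fin.val_succ]
      congr 1
      refine Finset.sum_congr rfl fun i _ => ?_
      ring
    rw [hx, hx] at h
    have h0 : a 0 = b 0 := by
      have := congrArg (· % B) h
      simpa [Nat.add_mul_mod_self_left, Nat.mod_eq_of_lt (ha 0), Nat.mod_eq_of_lt (hb 0)] using this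
    have hB : 0 < B := lt_of_le_of_lt (Nat.zero_le _) (ha 0)
    rw [h0] at h
    have h1 := Nat.eq_of_mul_eq_mul_left hB (Nat.add_left_cancel h)
    have h2 := ih (fun i => a i.succ) (fun i => b i.succ) (fun i => ha _) (fun i => hb _) h1
    funext i
    refine Fin.cases h0 (fun j => congrFun h2 j) i

lemma exists_homog {A : Type u} [CommRing A] {n : ℕ} (f : Fin n → A) (d : ℕ) :
    ∀ a ∈ Ideal.span (Set.range f) ^ d, ∃ P : MvPolynomial (Fin n) A,
      P.IsHomogeneous d ∧ MvPolynomial.eval f P = a := by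
  induction d with
  | zero =>
    intro a _
    exact ⟨MvPolynomial.C a, MvPolynomial.isHomogeneous_C _ _, by simp⟩
  | succ d ih =>
    intro a ha
    rw [pow_succ] at ha
    induction ha using Submodule.mul_induction_on' with
    | mem_mul_mem x hx y hy =>
      obtain ⟨P, hP, rfl⟩ := ih x hx
      obtain ⟨c, rfl⟩ := Ideal.mem_span_range_iff_exists_fun.mp hy
      refine ⟨P * ∑ i, MvPolynomial.C (c i) * MvPolynomial.X i, hP.mul ?_, by simp⟩
      refine MvPolynomial.IsHomogeneous.sum _ _ _ fun i _ => ?_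
      exact (MvPolynomial.isHomogeneous_X _ i).C_mul _
    | add x _ y _ hx hy =>
      obtain ⟨P, hP, rfl⟩ := hx
      obtain ⟨Q, hQ, rfl⟩ := hy
      exact ⟨P + Q, hP.add hQ, by simp⟩

lemma height_contra (A : Type u) [CommRing A] [IsNoetherianRing A] [IsLocalRing A]
    (n : ℕ) (hdim : ringKrullDim A = n) (f : Fin n → A)
    (hf : Ideal.span (Set.range f) = maximalIdeal A) (e : Fin n → ℕ) (he : ∀ i, e i ≠ 0)
    (K : ℕ) (c : A) (hc : c ∉ maximalIdeal A) (b : A[X])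
    (hJ : X ^ K * (C c - X * b) ∈ Ideal.span (Set.range fun i => (C (f i) - X ^ e i : A[X]))) :
    False := by
  set J := Ideal.span (Set.range fun i => (C (f i) - X ^ e i : A[X])) with hJdef
  let g : A[X] →+* ResidueField A := (residue A).comp (Polynomial.evalRingHom 0)
  have hg : Function.Surjective g := by
    intro y
    obtain ⟨a, rfl⟩ := IsLocalRing.residue_surjective y
    exact ⟨C a, by simp [g]⟩
  let M : Ideal A[X] := RingHom.ker g
  have hMmax : M.IsMaximal := RingHom.ker_isMaximal_of_surjective g hg
  have hMem : ∀ p : A[X], p ∈ M ↔ p.coeff 0 ∈ maximalIdeal A := by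
    intro p
    rw [RingHom.mem_ker, ← IsLocalRing.residue_eq_zero_iff]
    simp [g, Polynomial.coeff_zero_eq_eval_zero]
  have hlies : M.LiesOver (maximalIdeal A) := by
    refine ⟨?_⟩
    ext a
    rw [Ideal.mem_comap, hMem]
    simp
  have hh : M.height = (maximalIdeal A).height + 1 := Polynomial.height_eq_height_add_one _ _
  have hfm : ∀ i, f i ∈ maximalIdeal A := fun i => hf ▸ Ideal.subset_span ⟨i, rfl⟩
  have hJM : J ≤ M := by
    rw [hJdef, Ideal.span_le]
    rintro _ ⟨i, rfl⟩
    simp only [SetLike.mem_coe]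
    rw [hMem]
    simpa [Polynomial.coeff_X_pow, (he i).symm] using hfm i
  have hmin : M ∈ J.minimalPrimes := by
    refine ⟨⟨hMmax.isPrime, hJM⟩, ?_⟩
    rintro P ⟨hP, hJP⟩ hPM
    have hX : (X : A[X]) ∈ P := by
      rcases hP.mem_or_mem (hJP hJ) with h | h
      · exact hP.mem_of_pow_mem _ h
      · exfalso
        have := (hMem _).1 (hPM h)
        simp at this
        exact hc (by simpa using this)
    have hCf : (maximalIdeal A).map (C : A →+* A[X]) ≤ P := by
      rw [← hf, Ideal.map_span, Ideal.span_le]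
      rintro _ ⟨_, ⟨i, rfl⟩, rfl⟩
      have h1 : (C (f i) - X ^ e i : A[X]) ∈ P := hJP (Ideal.subset_span ⟨i, rfl⟩)
      have h2 : (X ^ e i : A[X]) ∈ P := P.pow_mem_of_mem hX _ (Nat.pos_of_ne_zero (he i))
      simpa using P.add_mem h1 h2
    intro p hp
    rw [← Polynomial.X_mul_divX_add p]
    exact P.add_mem (P.mul_mem_right _ hX) (hCf (Ideal.mem_map_of_mem _ ((hMem _).1 hp)))
  have h1 := Ideal.height_le_card_of_mem_minimalPrimes_span (Set.finite_range _) hmin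
  have h2 : (Set.range fun i => (C (f i) - X ^ e i : A[X])).ncard ≤ n := by
    rw [← Set.image_univ]
    refine (Set.ncard_image_le Set.finite_univ).trans ?_
    simp [Set.ncard_univ]
  have h3 : (maximalIdeal A).height = n := by
    have := IsLocalRing.maximalIdeal_height_eq_ringKrullDim (R := A)
    rw [hdim] at this
    exact_mod_cast this
  rw [hh, h3] at h1
  have h4 : (n + 1 : ℕ∞) ≤ n := h1.trans (by exact_mod_cast h2)
  have h5 : n + 1 ≤ n := by exact_mod_cast h4
  omega

lemma key (A : Type u) [CommRing A] [IsNoetherianRing A] [IsLocalRing A]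
    (n : ℕ) (hdim : ringKrullDim A = n) (f : Fin n → A)
    (hf : Ideal.span (Set.range f) = maximalIdeal A) (d : ℕ) (F : MvPolynomial (Fin n) A)
    (hF : F.IsHomogeneous d) (hFm : MvPolynomial.eval f F ∈ maximalIdeal A ^ (d + 1))
    (α : Fin n →₀ ℕ) : F.coeff α ∈ maximalIdeal A := by
  classical
  by_contra hα
  let s : (Fin n →₀ ℕ) → ℕ := fun β => ∑ i, β i * (d + 1) ^ (i : ℕ)
  let S := F.support.filter fun β => F.coeff β ∉ maximalIdeal A
  have hS : S.Nonempty := ⟨α, by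
    simp only [S, Finset.mem_filter, MvPolynomial.mem_support_iff]
    exact ⟨fun h => hα (h ▸ zero_mem _), hα⟩⟩
  obtain ⟨α₀, hα₀, hmin⟩ := Finset.exists_min_image S s hS
  have hα₀' := (Finset.mem_filter.1 hα₀)
  have hdeg : ∀ β ∈ F.support, ∑ i, β i = d := by
    intro β hβ
    have := hF (MvPolynomial.mem_support_iff.1 hβ)
    rw [← this]
    simp [Finsupp.weight_apply, Finsupp.sum_fintype]
  have hs : ∀ β ∈ F.support, ∀ γ ∈ F.support, s β = s γ → β = γ := by
    intro β hβ γ hγ h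
    have hlt : ∀ δ ∈ F.support, ∀ i, δ i < d + 1 := by
      intro δ hδ i
      rw [Nat.lt_succ_iff, ← hdeg δ hδ]
      exact Finset.single_le_sum (f := fun i => δ i) (fun _ _ => Nat.zero_le _) (Finset.mem_univ i)
    exact DFunLike.coe_injective (weight_inj (d + 1) n β γ (hlt β hβ) (hlt γ hγ) h)
  let N := s α₀ + 1
  let e : Fin n → ℕ := fun i => N + (d + 1) ^ (i : ℕ)
  have he : ∀ i, e i ≠ 0 := fun i => by simp [e, N]
  have hes : ∀ β ∈ F.support, ∑ i, e i * β i = N * d + s β := by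
    intro β hβ
    simp only [e, s, add_mul, Finset.sum_add_distrib]
    rw [← Finset.mul_sum, hdeg β hβ]
    congr 1
    exact Finset.sum_congr rfl fun i _ => mul_comm _ _
  let K := N * d + s α₀
  let J := Ideal.span (Set.range fun i => (C (f i) - X ^ e i : A[X]))
  let q : A[X] →+* A[X] ⧸ J := Ideal.Quotient.mk J
  let t := q X
  have hqf : ∀ i, q (C (f i)) = t ^ e i := by
    intro i
    rw [← map_pow]
    exact (Ideal.Quotient.mk_eq_mk_iff_sub_mem _ _).2 (Ideal.subset_span ⟨i, rfl⟩)
  have hqm : (maximalIdeal A).map (q.comp C) ≤ Ideal.span {t ^ N} := by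
    rw [← hf, Ideal.map_span, Ideal.span_le]
    rintro _ ⟨_, ⟨i, rfl⟩, rfl⟩
    simp only [SetLike.mem_coe, RingHom.comp_apply]
    rw [hqf, Ideal.mem_span_singleton]
    exact pow_dvd_pow _ (Nat.le_add_right _ _)
  have hqm1 : ∀ a ∈ maximalIdeal A, t ^ N ∣ q (C a) := fun a ha =>
    Ideal.mem_span_singleton.1 (hqm (Ideal.mem_map_of_mem (q.comp C) ha))
  have hqF : t ^ (K + 1) ∣ q (C (MvPolynomial.eval f F)) := by
    have h1 := Ideal.mem_map_of_mem (q.comp C) hFm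
    rw [Ideal.map_pow] at h1
    have h2 := Ideal.pow_right_mono hqm _ h1
    rw [Ideal.span_singleton_pow, Ideal.mem_span_singleton, ← pow_mul] at h2
    refine (pow_dvd_pow _ ?_).trans h2
    simp only [K, N]
    rw [Nat.mul_succ]
    omega
  have hexp : q (C (MvPolynomial.eval f F)) =
      ∑ β ∈ F.support, q (C (F.coeff β)) * t ^ (N * d + s β) := by
    rw [MvPolynomial.eval_eq', map_sum, map_sum]
    refine Finset.sum_congr rfl fun β hβ => ?_
    rw [map_mul, map_mul, map_prod, map_prod, ← hes β hβ, ← Finset.prod_pow_eq_pow_sum]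
    congr 1
    refine Finset.prod_congr rfl fun i _ => ?_
    rw [map_pow, map_pow, hqf, pow_mul]
  rw [hexp, ← Finset.add_sum_erase _ _ hα₀'.1] at hqF
  have hrest : t ^ (K + 1) ∣ ∑ β ∈ F.support.erase α₀, q (C (F.coeff β)) * t ^ (N * d + s β) := by
    refine Finset.dvd_sum fun β hβ => ?_
    obtain ⟨hne, hβ⟩ := Finset.mem_erase.1 hβ
    by_cases hc : F.coeff β ∈ maximalIdeal A
    · refine dvd_trans ?_ (mul_dvd_mul (hqm1 _ hc) dvd_rfl)
      rw [← pow_add]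
      refine pow_dvd_pow _ ?_
      simp only [K, N]
      omega
    · refine dvd_trans (pow_dvd_pow _ ?_) (dvd_mul_left _ _)
      have h1 := hmin β (Finset.mem_filter.2 ⟨hβ, hc⟩)
      have h2 : s α₀ ≠ s β := fun h => hne (hs _ hβ _ hα₀'.1 h.symm)
      simp only [K]
      omega
  obtain ⟨b, hb⟩ := (dvd_add_left hrest).1 hqF
  obtain ⟨b, rfl⟩ := Ideal.Quotient.mk_surjective b
  refine height_contra A n hdim f hf e he K (F.coeff α₀) hα₀'.2 b ?_
  rw [← Ideal.Quotient.eq_zero_iff_mem]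
  change q _ = 0
  have hb' : q (C (F.coeff α₀)) * t ^ K = t ^ (K + 1) * q b := hb
  simp only [map_mul, map_sub, map_pow]
  change t ^ K * (q (C (F.coeff α₀)) - t * q b) = 0
  linear_combination hb'

lemma coeff_mem_of_mem_map (A : Type u) [CommRing A] [IsLocalRing A]
    (x : ↥(reesAlgebra (maximalIdeal A)))
    (hx : x ∈ Ideal.map (algebraMap A ↥(reesAlgebra (maximalIdeal A))) (maximalIdeal A)) :
    ∀ d, (x : A[X]).coeff d ∈ maximalIdeal A ^ (d + 1) := by
  refine Submodule.span_induction (p := fun (x : ↥(reesAlgebra (maximalIdeal A))) _ => ∀ d, (x : A[X]).coeff d ∈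
    maximalIdeal A ^ (d + 1)) ?_ ?_ ?_ ?_ hx
  · rintro _ ⟨a, ha, rfl⟩ d
    change (C a : A[X]).coeff d ∈ _
    rw [Polynomial.coeff_C]
    split_ifs with h
    · subst h; simpa using ha
    · exact zero_mem _
  · intro d; simp
  · intro x y _ _ hx hy d
    simpa using add_mem (hx d) (hy d)
  · intro r x _ hx d
    change ((r : A[X]) * (x : A[X])).coeff d ∈ _
    rw [Polynomial.coeff_mul]
    refine sum_mem fun ij hij => ?_
    rw [← Finset.HasAntidiagonal.mem_antidiagonal.1 hij, add_assoc, pow_add]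
    exact Ideal.mul_mem_mul (r.2 ij.1) (hx ij.2)

noncomputable def reesPsi {A : Type u} [CommRing A] [IsLocalRing A] {n : ℕ} (f : Fin n → A)
    (hf : ∀ i, f i ∈ maximalIdeal A) :
    MvPolynomial (Fin n) A →ₐ[A] ↥(reesAlgebra (maximalIdeal A)) :=
  MvPolynomial.aeval fun i => ⟨Polynomial.monomial 1 (f i),
    reesAlgebra.monomial_mem.2 (by simpa using hf i)⟩

lemma reesPsi_coe {A : Type u} [CommRing A] [IsLocalRing A] {n : ℕ} (f : Fin n → A)
    (hf : ∀ i, f i ∈ maximalIdeal A) (P : MvPolynomial (Fin n) A) (d : ℕ)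
    (hP : P.IsHomogeneous d) :
    (reesPsi f hf P : A[X]) = Polynomial.monomial d (MvPolynomial.eval f P) := by
  have h1 : (reesPsi f hf P : A[X]) =
      MvPolynomial.aeval (fun i => (Polynomial.monomial 1 (f i) : A[X])) P := by
    change ((reesAlgebra (maximalIdeal A)).val.comp (reesPsi f hf)) P = _
    congr 1
    ext i
    simp [reesPsi]
  rw [h1, MvPolynomial.aeval_def, MvPolynomial.eval₂_eq', MvPolynomial.eval_eq', map_sum]
  refine Finset.sum_congr rfl fun β hβ => ?_
  have hd : ∑ i, β i = d := by
    rw [← hP (MvPolynomial.mem_support_iff.1 hβ)]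
    simp [Finsupp.weight_apply, Finsupp.sum_fintype]
  have h2 : ∀ i, (Polynomial.monomial 1 (f i) : A[X]) = C (f i) * X := fun i => by
    rw [Polynomial.C_mul_X_eq_monomial]
  simp only [h2, mul_pow, Finset.prod_mul_distrib, Finset.prod_pow_eq_pow_sum, hd]
  rw [← Polynomial.C_mul_X_pow_eq_monomial, map_mul, map_prod]
  simp only [map_pow, Polynomial.algebraMap_eq]
  ring

lemma reesPsi_coeff {A : Type u} [CommRing A] [IsLocalRing A] {n : ℕ} (f : Fin n → A)
    (hf : ∀ i, f i ∈ maximalIdeal A) (P : MvPolynomial (Fin n) A) (d : ℕ) :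
    (reesPsi f hf P : A[X]).coeff d =
      MvPolynomial.eval f (MvPolynomial.homogeneousComponent d P) := by
  conv_lhs => rw [← MvPolynomial.sum_homogeneousComponent P]
  rw [map_sum, AddSubmonoidClass.coe_finsetSum, Polynomial.finsetSum_coeff]
  simp only [fun i => reesPsi_coe f hf _ i (MvPolynomial.homogeneousComponent_isHomogeneous i P),
    Polynomial.coeff_monomial]
  rw [Finset.sum_ite_eq']
  split_ifs with h
  · rfl
  · rw [MvPolynomial.homogeneousComponent_eq_zero, map_zero]
    simpa using h

/-- The quotient map from the Rees algebra. -/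
noncomputable def grMk (A : Type u) [CommRing A] [IsLocalRing A] :
    ↥(reesAlgebra (maximalIdeal A)) →+* AssocGraded A :=
  Ideal.Quotient.mk _

lemma grMk_surjective (A : Type u) [CommRing A] [IsLocalRing A] :
    Function.Surjective (grMk A) := Ideal.Quotient.mk_surjective

noncomputable def grPhi {A : Type u} [CommRing A] [IsLocalRing A] {n : ℕ} (f : Fin n → A)
    (hf : ∀ i, f i ∈ maximalIdeal A) :
    MvPolynomial (Fin n) (ResidueField A) →ₐ[ResidueField A] AssocGraded A :=
  MvPolynomial.aeval fun i => grMk A (reesPsi f hf (MvPolynomial.X i))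

lemma grPhi_map {A : Type u} [CommRing A] [IsLocalRing A] {n : ℕ} (f : Fin n → A)
    (hf : ∀ i, f i ∈ maximalIdeal A) (P : MvPolynomial (Fin n) A) :
    grPhi f hf (MvPolynomial.map (residue A) P) = grMk A (reesPsi f hf P) := by
  change ((grPhi f hf).toRingHom.comp (MvPolynomial.map (residue A))) P =
    ((grMk A).comp (reesPsi f hf).toRingHom) P
  congr 1
  refine MvPolynomial.ringHom_ext ?_ ?_
  · intro a
    have h1 : reesPsi f hf (MvPolynomial.C a) = algebraMap A _ a := (reesPsi f hf).commutes a
    have h2 : grPhi f hf (MvPolynomial.C (residue A a)) = algebraMap (ResidueField A) _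
      (residue A a) := (grPhi f hf).commutes _
    simp only [RingHom.comp_apply, MvPolynomial.map_C]
    refine h2.trans ?_
    refine Eq.trans ?_ (congrArg (grMk A) h1).symm
    rfl
  · intro i
    simp only [RingHom.comp_apply, MvPolynomial.map_X]
    exact MvPolynomial.aeval_X _ i

lemma reesPsi_surjective {A : Type u} [CommRing A] [IsLocalRing A] {n : ℕ} (f : Fin n → A)
    (hf : ∀ i, f i ∈ maximalIdeal A) (hs : Ideal.span (Set.range f) = maximalIdeal A) :
    Function.Surjective (reesPsi f hf) := by
  intro x
  have hx : ∀ d, ∃ P : MvPolynomial (Fin n) A, P.IsHomogeneous d ∧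
      MvPolynomial.eval f P = (x : A[X]).coeff d := fun d =>
    exists_homog f d _ (by rw [hs]; exact x.2 d)
  choose P hP hPe using hx
  refine ⟨∑ d ∈ (x : A[X]).support, P d, ?_⟩
  apply Subtype.ext
  rw [map_sum, AddSubmonoidClass.coe_finsetSum, Polynomial.as_sum_support (x : A[X])]
  refine Finset.sum_congr (by rw [← Polynomial.as_sum_support]) fun d _ => ?_
  rw [reesPsi_coe f hf _ d (hP d), hPe]

theorem assocGraded_polynomial_of_span
    (A : Type u) [CommRing A] [IsNoetherianRing A] [IsLocalRing A]
    (n : ℕ) (hdim : ringKrullDim A = n)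
    (hgen : ∃ f : Fin n → A, Ideal.span (Set.range f) = maximalIdeal A) :
    ∃ e : MvPolynomial (Fin n) (ResidueField A) ≃ₐ[ResidueField A] AssocGraded A,
      ∀ i : ℕ, Submodule.map e.toLinearMap
        (MvPolynomial.homogeneousSubmodule (Fin n) (ResidueField A) i) =
          AssocGraded.piece A i := by
  obtain ⟨f, hs⟩ := hgen
  have hf : ∀ i, f i ∈ maximalIdeal A := fun i => hs ▸ Ideal.subset_span ⟨i, rfl⟩
  have hmapsurj : Function.Surjective (MvPolynomial.map (σ := Fin n) (residue A)) :=
    MvPolynomial.map_surjective _ IsLocalRing.residue_surjective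
  have hsurj : Function.Surjective (grPhi f hf) := by
    intro y
    obtain ⟨x, rfl⟩ := grMk_surjective A y
    obtain ⟨P, rfl⟩ := reesPsi_surjective f hf hs x
    exact ⟨_, grPhi_map f hf P⟩
  have hinj : Function.Injective (grPhi f hf) := by
    rw [injective_iff_map_eq_zero]
    intro p hp
    obtain ⟨P, rfl⟩ := hmapsurj p
    rw [grPhi_map] at hp
    have h1 := coeff_mem_of_mem_map A _ (Ideal.Quotient.eq_zero_iff_mem.1 hp)
    ext α
    rw [MvPolynomial.coeff_map, MvPolynomial.coeff_zero, IsLocalRing.residue_eq_zero_iff]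
    have h2 := h1 α.degree
    rw [reesPsi_coeff] at h2
    have h3 := key A n hdim f hs _ _ (MvPolynomial.homogeneousComponent_isHomogeneous _ P) h2 α
    rwa [MvPolynomial.coeff_homogeneousComponent, if_pos rfl] at h3
  refine ⟨AlgEquiv.ofBijective (grPhi f hf) ⟨hinj, hsurj⟩, fun i => ?_⟩
  apply le_antisymm
  · rintro _ ⟨p, hp, rfl⟩
    obtain ⟨P, rfl⟩ := hmapsurj p
    refine Submodule.subset_span ⟨reesPsi f hf (MvPolynomial.homogeneousComponent i P),
      ⟨_, reesPsi_coe f hf _ i (MvPolynomial.homogeneousComponent_isHomogeneous i P)⟩, ?_⟩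
    refine (grPhi_map f hf _).symm.trans ?_
    change grPhi f hf _ = grPhi f hf _
    congr 1
    have hp' : (MvPolynomial.map (residue A) P).IsHomogeneous i := hp
    ext α
    rw [MvPolynomial.coeff_map, MvPolynomial.coeff_homogeneousComponent]
    split_ifs with h
    · rw [MvPolynomial.coeff_map]
    · rw [map_zero, hp'.coeff_eq_zero h]
  · refine Submodule.span_le.2 ?_
    rintro _ ⟨x, ⟨a, hx⟩, rfl⟩
    have ha : a ∈ Ideal.span (Set.range f) ^ i := by
      rw [hs]
      have := x.2 i
      rw [hx] at this
      simpa using this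
    obtain ⟨P, hP, rfl⟩ := exists_homog f i a ha
    refine ⟨MvPolynomial.map (residue A) P, hP.map _, ?_⟩
    refine (grPhi_map f hf P).trans ?_
    refine congrArg (grMk A) (Subtype.ext ?_)
    rw [reesPsi_coe f hf P i hP, hx]
end

section
/- Let (A, m) be a noetherian local ring with residue field k = A/m, and suppose m is generated by a regular sequence x_1, ..., x_n of length n. Then Tor_j^A(k, M) = 0 for every A-module M and every j > n, and Tor_n^A(k, k) ≅ k. In particular the global dimension of A equals n. -/
/-!
STATEMENT 7: Let (A, m) be a noetherian local ring with residue field k = A/m, and suppose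
m is generated by a regular sequence x_1, ..., x_n of length n. Then Tor_j^A(k, M) = 0 for
every A-module M and every j > n, and Tor_n^A(k, k) ≅ k. In particular the global
dimension of A equals n.
-/

open CategoryTheory Limits IsLocalRing

universe u

section AuxPart
open RingTheory.Sequence


section
variable {A : Type u} [CommRing A]

noncomputable def TC (P : ChainComplex (ModuleCat.{u} A) ℕ) (N : ModuleCat.{u} A) :
    ChainComplex (ModuleCat.{u} A) ℕ :=
  (((MonoidalCategory.tensoringLeft (ModuleCat.{u} A)).obj N).mapHomologicalComplex _).obj P

noncomputable def TCmap (P : ChainComplex (ModuleCat.{u} A) ℕ) {N N' : ModuleCat.{u} A} (f : N ⟶ N') :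
    TC P N ⟶ TC P N' :=
  (NatTrans.mapHomologicalComplex ((MonoidalCategory.tensoringLeft (ModuleCat.{u} A)).map f) _).app P

lemma TCmap_f (P : ChainComplex (ModuleCat.{u} A) ℕ) {N N' : ModuleCat.{u} A} (f : N ⟶ N') (i : ℕ) :
    (TCmap P f).f i = MonoidalCategory.whiskerRight f (P.X i) := rfl

noncomputable def TCS (P : ChainComplex (ModuleCat.{u} A) ℕ) (S : ShortComplex (ModuleCat.{u} A)) :
    ShortComplex (ChainComplex (ModuleCat.{u} A) ℕ) :=
  ShortComplex.mk (TCmap P S.f) (TCmap P S.g) (by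
    ext i : 1
    have h : MonoidalCategory.whiskerRight S.f (P.X i) ≫ MonoidalCategory.whiskerRight S.g (P.X i) = 0 := by
      rw [← MonoidalCategory.comp_whiskerRight, S.zero]
      simp
    exact h)

lemma TCS_exact (P : ChainComplex (ModuleCat.{u} A) ℕ) (hP : ∀ i, Projective (P.X i))
    (S : ShortComplex (ModuleCat.{u} A)) (hS : S.ShortExact) : (TCS P S).ShortExact := by
  refine HomologicalComplex.shortExact_of_degreewise_shortExact _ fun i => ?_
  have h1 : Module.Projective A (P.X i) := (IsProjective.iff_projective _).mpr (hP i)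
  have h2 : Module.Flat A (P.X i) := inferInstance
  have h3 := hS.map_of_exact (MonoidalCategory.tensorRight (P.X i))
  exact h3

lemma TC_step (P : ChainComplex (ModuleCat.{u} A) ℕ) (hP : ∀ i, Projective (P.X i))
    (N : ModuleCat.{u} A) (x : A) (hx : IsSMulRegular N x) (j : ℕ)
    (h1 : IsZero ((TC P N).homology (j+1))) (h0 : IsZero ((TC P N).homology j)) :
    IsZero ((TC P (ModuleCat.of A (QuotSMulTop x N))).homology (j+1)) := by
  have hS := TCS_exact P hP _ hx.smulShortComplex_shortExact
  exact (hS.homology_exact₃ (j+1) j (by simp)).isZero_of_both_zeros (h1.eq_of_src _ _) (h0.eq_of_tgt _ _)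

lemma TC_iso (P : ChainComplex (ModuleCat.{u} A) ℕ) (hP : ∀ i, Projective (P.X i))
    (N : ModuleCat.{u} A) (x : A) (hx : IsSMulRegular N x) (j : ℕ)
    (h1 : IsZero ((TC P N).homology (j+1)))
    (h0 : HomologicalComplex.homologyMap (TCmap P (x • 𝟙 N)) j = 0) :
    Nonempty ((TC P (ModuleCat.of A (QuotSMulTop x N))).homology (j+1) ≅ (TC P N).homology j) := by
  have hS := TCS_exact P hP _ hx.smulShortComplex_shortExact
  have hr : (ComplexShape.down ℕ).Rel (j+1) j := by simp
  have m : Mono (hS.δ (j+1) j hr) :=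
    (hS.homology_exact₃ (j+1) j hr).mono_g (h1.eq_of_src _ _)
  have e : Epi (hS.δ (j+1) j hr) :=
    (hS.homology_exact₁ (j+1) j hr).epi_f h0
  have : IsIso (hS.δ (j+1) j hr) := isIso_of_mono_of_epi _
  have i := @asIso _ _ _ _ _ this
  exact ⟨i⟩

lemma TC_zero {M : ModuleCat.{u} A} (P : ProjectiveResolution M)
    (N : ModuleCat.{u} A) (x : A) (hx : x • 𝟙 M = 0) (j : ℕ) :
    HomologicalComplex.homologyMap (TCmap P.complex (x • 𝟙 N)) j = 0 := by
  have e : TCmap P.complex (x • 𝟙 N) =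
    (((MonoidalCategory.tensoringLeft (ModuleCat.{u} A)).obj N).mapHomologicalComplex _).map
      (x • 𝟙 P.complex) := by
    ext i : 1
    have h : MonoidalCategory.whiskerRight (x • 𝟙 N) (P.complex.X i) =
        MonoidalCategory.whiskerLeft N (x • 𝟙 (P.complex.X i)) := by
      rw [MonoidalLinear.smul_whiskerRight, MonoidalLinear.whiskerLeft_smul,
        MonoidalCategory.id_whiskerRight, MonoidalCategory.whiskerLeft_id]
    exact h
  have h := Functor.leftDerived_map_eq ((MonoidalCategory.tensoringLeft (ModuleCat.{u} A)).obj N) j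
    (0 : M ⟶ M) (P := P) (Q := P) (x • 𝟙 P.complex) (by
      rw [← hx, Linear.smul_comp, Category.id_comp]
      ext i
      have h : ∀ f : P.complex.X 0 ⟶ M, x • f = f ≫ (x • 𝟙 M) := fun f => by
        rw [Linear.comp_smul, Category.comp_id]
      exact congrArg (fun f => f.hom i) (h (P.π.f 0)))
  have h' := Functor.leftDerived_map_eq ((MonoidalCategory.tensoringLeft (ModuleCat.{u} A)).obj N) j
    (0 : M ⟶ M) (P := P) (Q := P) 0 (by simp)
  rw [h] at h'
  rw [Iso.cancel_iso_hom_left, Iso.cancel_iso_inv_right] at h'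
  rw [e]
  refine Eq.trans h' ?_
  simp
  rfl

lemma TC_flat {M : ModuleCat.{u} A} (P : ProjectiveResolution M) (j : ℕ) :
    IsZero ((TC P.complex (ModuleCat.of A A)).homology (j+1)) := by
  rw [← HomologicalComplex.exactAt_iff_isZero_homology]
  have h := P.complex_exactAt_succ j
  rw [HomologicalComplex.exactAt_iff] at h ⊢
  have h2 := h.map (MonoidalCategory.tensorLeft (ModuleCat.of A A))
  exact h2

lemma TC_list {M : ModuleCat.{u} A} (P : ProjectiveResolution M) (rs : List A) :
    ∀ (N : ModuleCat.{u} A) (_ : IsWeaklyRegular N rs) (d : ℕ)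
    (_ : ∀ j, d < j → IsZero ((TC P.complex N).homology j)),
    (∀ j, d + rs.length < j → IsZero ((TC P.complex (ModuleCat.of A (N ⧸ (Ideal.ofList rs • ⊤ : Submodule A N)))).homology j)) ∧
    ((∀ x ∈ rs, x • 𝟙 M = 0) →
      Nonempty ((TC P.complex (ModuleCat.of A (N ⧸ (Ideal.ofList rs • ⊤ : Submodule A N)))).homology (d + rs.length) ≅
        (TC P.complex N).homology d)) := by
  have tr : ∀ {N N' : ModuleCat.{u} A} (_ : N ≅ N') (j : ℕ),
      Nonempty ((TC P.complex N).homology j ≅ (TC P.complex N').homology j) := fun i j =>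
    ⟨(HomologicalComplex.homologyFunctor _ _ j).mapIso
      ((NatIso.mapHomologicalComplex ((MonoidalCategory.tensoringLeft (ModuleCat.{u} A)).mapIso i) _).app P.complex)⟩
  induction rs with
  | nil =>
    intro N hN d hd
    have e : ModuleCat.of A (N ⧸ (Ideal.ofList ([] : List A) • ⊤ : Submodule A N)) ≅ N :=
      (Submodule.quotEquivOfEqBot _ (by simp)).toModuleIso
    exact ⟨fun j hj => (hd j hj).of_iso (tr e j).some, fun _ => tr e d⟩
  | cons x rs ih =>
    intro N hN d hd
    rw [isWeaklyRegular_cons_iff] at hN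
    have e := (Submodule.quotOfListConsSMulTopEquivQuotSMulTopInner N x rs).toModuleIso
    have hd' : ∀ j, d + 1 < j → IsZero ((TC P.complex (ModuleCat.of A (QuotSMulTop x N))).homology j) := by
      rintro (_ | j) hj
      · omega
      · exact TC_step P.complex P.projective N x hN.1 j (hd _ (by omega)) (hd _ (by omega))
    obtain ⟨i1, i2⟩ := ih (ModuleCat.of A (QuotSMulTop x N)) hN.2 (d+1) hd'
    have el : d + (x :: rs).length = d + 1 + rs.length := by simp; omega
    rw [el]
    refine ⟨fun j hj => (i1 j hj).of_iso (tr e j).some, fun h => ?_⟩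
    obtain ⟨a⟩ := i2 fun y hy => h y (List.mem_cons_of_mem _ hy)
    obtain ⟨b⟩ := TC_iso P.complex P.projective N x hN.1 d (hd _ (by omega))
      (TC_zero P N x (h x List.mem_cons_self) d)
    exact ⟨(tr e _).some ≪≫ a ≪≫ b⟩
end



lemma aux_syz {A : Type u} [CommRing A] (rs : List A) :
    ∀ (s : A) {K F Z : Type u} [AddCommGroup K] [AddCommGroup F] [AddCommGroup Z]
    [Module A K] [Module A F] [Module A Z] (f : K →ₗ[A] F) (g : F →ₗ[A] Z)
    (_ : Function.Injective f) (_ : Function.Exact f g) (_ : Function.Surjective g)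
    (_ : IsWeaklyRegular F (rs ++ [s])) (_ : IsWeaklyRegular Z rs),
    IsWeaklyRegular K (rs ++ [s]) := by
  induction rs with
  | nil =>
    intro s K F Z _ _ _ _ _ _ f g hf hfg hg hF hZ
    simp only [List.nil_append, isWeaklyRegular_singleton_iff] at hF ⊢
    exact IsSMulRegular.of_injective f hf hF
  | cons t rs ih =>
    intro s K F Z _ _ _ _ _ _ f g hf hfg hg hF hZ
    simp only [List.cons_append, isWeaklyRegular_cons_iff] at hF hZ ⊢
    refine ⟨IsSMulRegular.of_injective f hf hF.1, ?_⟩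
    refine ih s (QuotSMulTop.map t f) (QuotSMulTop.map t g) ?_ ?_ ?_ hF.2 hZ.2
    · have h0 : Function.Exact (0 : PUnit.{u+1} →ₗ[A] K) f := by
        rw [LinearMap.exact_zero_iff_injective]; exact hf
      have := QuotSMulTop.map_first_exact_on_four_term_exact_of_isSMulRegular_last h0 hfg hZ.1
      rw [map_zero] at this
      rwa [LinearMap.exact_zero_iff_injective] at this
    · exact QuotSMulTop.map_exact t hfg hg
    · exact QuotSMulTop.map_surjective t hg

lemma aux_free {A : Type u} [CommRing A] (rs : List A) (F : Type u) [AddCommGroup F] [Module A F]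
    [Module.Free A F] (h : IsWeaklyRegular A rs) : IsWeaklyRegular F rs :=
  ((TensorProduct.rid A F).isWeaklyRegular_congr rs).mp (IsWeaklyRegular.isWeaklyRegular_lTensor (M₂ := F) h)

lemma aux_pi {A : Type u} [CommRing A] (k : Type u) [AddCommGroup k] [Module A k] (n : ℕ)
    (h : HasProjectiveDimensionLT (ModuleCat.of A k) n) (d : ℕ) :
    HasProjectiveDimensionLT (ModuleCat.of A (Fin d → k)) n := by
  induction d with
  | zero =>
    have : HasProjectiveDimensionLT (ModuleCat.of A (Fin 0 → k)) 0 :=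
      (ModuleCat.isZero_of_subsingleton (ModuleCat.of A (Fin 0 → k))).hasProjectiveDimensionLT_zero
    exact hasProjectiveDimensionLT_of_ge _ 0 n (Nat.zero_le _)
  | succ d ih =>
    have e : (ModuleCat.of A k) ⊞ (ModuleCat.of A (Fin d → k)) ≅ ModuleCat.of A (Fin (d+1) → k) :=
      ModuleCat.biprodIsoProd _ _ ≪≫ (Fin.consLinearEquiv A (fun _ : Fin (d+1) => k)).toModuleIso
    exact hasProjectiveDimensionLT_of_iso e n

section
variable {A : Type u} [CommRing A] [IsNoetherianRing A] [IsLocalRing A]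

lemma aux_pdk (rs : List A) (hreg : IsRegular A rs) (hspan : Ideal.ofList rs = maximalIdeal A) :
    projectiveDimension (ModuleCat.of A (ResidueField A)) = rs.length := by
  have h := ModuleCat.projectiveDimension_quotient_eq_length.{u} rs hreg
  rw [← h]
  refine projectiveDimension_eq_of_iso (LinearEquiv.toModuleIso ?_)
  refine (Submodule.quotEquivOfEq _ _ hspan.symm) ≪≫ₗ (Shrink.linearEquiv.{u} A _).symm

lemma aux_vs (Z : Type u) [AddCommGroup Z] [Module A Z] [Module.Finite A Z] :
    ∃ d : ℕ, Nonempty ((Z ⧸ (maximalIdeal A • ⊤ : Submodule A Z)) ≃ₗ[A] (Fin d → ResidueField A)) := by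
  let _ := Ideal.Quotient.field (maximalIdeal A)
  have : Module.Finite (A ⧸ maximalIdeal A) (Z ⧸ (maximalIdeal A • ⊤ : Submodule A Z)) :=
    Module.Finite.of_restrictScalars_finite A _ _
  let b := Module.finBasis (A ⧸ maximalIdeal A) (Z ⧸ (maximalIdeal A • ⊤ : Submodule A Z))
  exact ⟨_, ⟨b.equivFun.restrictScalars A⟩⟩

lemma aux_base (rs : List A) (hreg : IsRegular A rs) (hspan : Ideal.ofList rs = maximalIdeal A)
    (Z : Type u) [AddCommGroup Z] [Module A Z] [Module.Finite A Z] (hZ : IsWeaklyRegular Z rs) :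
    HasProjectiveDimensionLE (ModuleCat.of A Z) 0 := by
  rcases subsingleton_or_nontrivial Z with hs | hn
  · have := (ModuleCat.isZero_of_subsingleton (ModuleCat.of A Z)).hasProjectiveDimensionLT_zero
    exact hasProjectiveDimensionLT_of_ge _ 0 _ (Nat.zero_le _)
  have mem : ∀ r ∈ rs, r ∈ maximalIdeal A := fun r hr => hspan ▸ Ideal.subset_span hr
  have h := ModuleCat.projectiveDimension_quotient_eq_add_length_of_isWeaklyRegular
    (ModuleCat.of A Z) rs hZ mem
  have hk := (projectiveDimension_le_iff _ _).mp (aux_pdk rs hreg hspan).le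
  obtain ⟨d, ⟨e⟩⟩ := aux_vs (A := A) Z
  have hQ := aux_pi (A := A) (ResidueField A) _ hk d
  have hQ' : HasProjectiveDimensionLE (ModuleCat.of A (Z ⧸ (Ideal.ofList rs • ⊤ : Submodule A Z))) rs.length := by
    rw [hspan]
    exact hasProjectiveDimensionLT_of_iso e.symm.toModuleIso _
  have hle := (projectiveDimension_le_iff _ _).mpr hQ'
  rw [← projectiveDimension_le_iff]
  change projectiveDimension (ModuleCat.of A (Z ⧸ (Ideal.ofList rs • ⊤ : Submodule A Z))) = _ at h
  rw [h] at hle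
  have := ENat.WithBot.add_le_add_natCast_right_iff (a := projectiveDimension (ModuleCat.of A Z)) (b := 0) (c := rs.length)
  simpa using this.mp (by simpa using hle)

lemma aux_fg (rs : List A) (hreg : IsRegular A rs) (hspan : Ideal.ofList rs = maximalIdeal A)
    (i : ℕ) (hi : i ≤ rs.length) :
    ∀ (Z : Type u) [AddCommGroup Z] [Module A Z] [Module.Finite A Z]
    (_ : IsWeaklyRegular Z (rs.take (rs.length - i))),
    HasProjectiveDimensionLE (ModuleCat.of A Z) i := by
  induction i with
  | zero =>
    intro Z _ _ _ hZ
    exact aux_base rs hreg hspan Z (by simpa using hZ)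
  | succ i ih =>
    intro Z _ _ _ hZ
    obtain ⟨F, _, _, _, _, f, hf⟩ := Module.exists_finite_presentation A Z
    have hS : f.shortComplexKer.ShortExact := LinearMap.shortExact_shortComplexKer hf
    have hpF : Projective (f.shortComplexKer.X₂) :=
      inferInstanceAs (Projective (ModuleCat.of A F))
    refine (hS.hasProjectiveDimensionLT_X₃_iff i hpF).mpr ?_
    refine ih (by omega) (LinearMap.ker f) ?_
    have hlt : rs.length - (i+1) < rs.length := by omega
    have e : rs.length - i = (rs.length - (i+1)) + 1 := by omega
    rw [e, List.take_add_one, List.getElem?_eq_getElem hlt]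
    refine aux_syz _ _ (LinearMap.ker f).subtype f (Submodule.subtype_injective _)
      ?_ hf ?_ hZ
    · intro x; simp
    · refine aux_free _ F ?_
      have h2 : IsWeaklyRegular A (rs.take (rs.length - i) ++ rs.drop (rs.length - i)) := by
        rw [List.take_append_drop]; exact hreg.1
      have := ((isWeaklyRegular_append_iff A _ _).mp h2).1
      rwa [e, List.take_add_one, List.getElem?_eq_getElem hlt] at this

lemma aux_inj (m : ℕ) : ∀ (N : ModuleCat.{u} A)
    (_ : ∀ I : Ideal A, Subsingleton (Abelian.Ext (ModuleCat.of A (A ⧸ I)) N (m+1))),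
    HasInjectiveDimensionLT N (m+1) := by
  induction m with
  | zero =>
    intro N h
    rw [zero_add, ← injective_iff_hasInjectiveDimensionLT_one]
    have hb : Module.Baer A N := by
      intro I g
      have hS : (I.mkQ).shortComplexKer.ShortExact := LinearMap.shortExact_shortComplexKer (Submodule.mkQ_surjective I)
      have hI := h I
      let g' : (I.mkQ).shortComplexKer.X₁ ⟶ N :=
        ModuleCat.ofHom (g ∘ₗ (LinearEquiv.ofEq _ _ (Submodule.ker_mkQ I)).toLinearMap)
      obtain ⟨x, hx⟩ := Abelian.Ext.contravariant_sequence_exact₁ hS N (Abelian.Ext.mk₀ g') (add_zero 1)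
        (@Subsingleton.elim _ hI _ _)
      obtain ⟨y, rfl⟩ := (Abelian.Ext.mk₀_bijective _ _).2 x
      rw [Abelian.Ext.mk₀_comp_mk₀, (Abelian.Ext.mk₀_bijective _ _).1.eq_iff] at hx
      refine ⟨y.hom, fun a ha => ?_⟩
      have := congr($hx ⟨a, by simpa using ha⟩)
      exact this
    have := hb.injective
    exact Module.injective_object_of_injective_module A N
  | succ m ih =>
    intro N h
    obtain ⟨p⟩ := EnoughInjectives.presentation N
    have hS : (ShortComplex.mk _ _ (cokernel.condition p.f)).ShortExact :=
      { exact := ShortComplex.exact_cokernel p.f }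
    refine (hS.hasInjectiveDimensionLT_X₃_iff m p.injective).mp ?_
    refine ih _ fun I => ?_
    have hI := h I
    refine ⟨fun x y => ?_⟩
    have key : ∀ x : Abelian.Ext (ModuleCat.of A (A ⧸ I)) (cokernel p.f) (m+1), x = 0 := by
      intro x
      have := p.injective
      obtain ⟨z, rfl⟩ := Abelian.Ext.covariant_sequence_exact₃ _ hS x rfl (@Subsingleton.elim _ hI _ _)
      rw [Abelian.Ext.eq_zero_of_injective z, Abelian.Ext.zero_comp]
    exact (key x).trans (key y).symm

lemma aux_all (rs : List A) (hreg : IsRegular A rs) (hspan : Ideal.ofList rs = maximalIdeal A)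
    (M N : ModuleCat.{u} A) (p : ℕ) (hp : rs.length < p) : Subsingleton (Abelian.Ext M N p) := by
  have : HasInjectiveDimensionLT N (rs.length + 1) := by
    refine aux_inj _ N fun I => ?_
    have := aux_fg rs hreg hspan rs.length le_rfl (A ⧸ I) (by simp)
    exact HasProjectiveDimensionLT.subsingleton _ (rs.length+1) _ le_rfl _
  exact HasInjectiveDimensionLT.subsingleton _ (rs.length+1) _ hp _

lemma aux_link (M N : ModuleCat.{u} A) (p : ℕ) :
    IsZero (((Ext A (ModuleCat.{u} A) (p+1)).obj (Opposite.op M)).obj N) ↔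
    Subsingleton (Abelian.Ext M N (p+1)) := by
  let P := projectiveResolution M
  have h1 : IsZero (((Ext A (ModuleCat.{u} A) (p+1)).obj (Opposite.op M)).obj N) ↔
      ∀ f : P.complex.X (p+1) ⟶ N, P.complex.d (p+2) (p+1) ≫ f = 0 →
        ∃ g, P.complex.d (p+1) p ≫ g = f := by
    rw [(P.isoExt (R := A) (p+1) N).isZero_iff, ← HomologicalComplex.exactAt_iff_isZero_homology,
      HomologicalComplex.exactAt_iff' _ p (p+1) (p+2) (by simp) (by simp),
      ShortComplex.moduleCat_exact_iff]
    rfl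
  rw [h1]
  constructor
  · intro h
    have key : ∀ x : Abelian.Ext M N (p+1), x = 0 := by
      intro x
      obtain ⟨f, hf, rfl⟩ := P.extMk_surjective x (p+2) rfl
      exact (P.extMk_eq_zero_iff f _ rfl hf p rfl).mpr (h f hf)
    exact ⟨fun x y => (key x).trans (key y).symm⟩
  · intro h f hf
    exact (P.extMk_eq_zero_iff f _ rfl hf p rfl).mp (@Subsingleton.elim _ h _ _)

end

end AuxPart

theorem tor_of_maximalIdeal_generated_by_regular_sequence
    (A : Type u) [CommRing A] [IsNoetherianRing A] [IsLocalRing A]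
    (n : ℕ) (rs : List A) (hlen : rs.length = n)
    (hreg : RingTheory.Sequence.IsRegular A rs)
    (hspan : Ideal.span {a : A | a ∈ rs} = maximalIdeal A) :
    (∀ (M : ModuleCat.{u} A) (j : ℕ), n < j →
      IsZero (((Tor (ModuleCat.{u} A) j).obj (ModuleCat.of A (ResidueField A))).obj M)) ∧
    Nonempty ((((Tor (ModuleCat.{u} A) n).obj (ModuleCat.of A (ResidueField A))).obj
      (ModuleCat.of A (ResidueField A))) ≅ ModuleCat.of A (ResidueField A)) ∧
    gldh A = (n : ℕ∞) := by
  have hs : Ideal.ofList rs = maximalIdeal A := hspan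
  let ek : ModuleCat.of A (ResidueField A) ≅
      ModuleCat.of A ((ModuleCat.of A A) ⧸ (Ideal.ofList rs • ⊤ : Submodule A (ModuleCat.of A A))) :=
    (Submodule.quotEquivOfEq (maximalIdeal A) (Ideal.ofList rs • ⊤ : Submodule A A)
      (by rw [hs, smul_eq_mul, Ideal.mul_top])).toModuleIso
  have key : ∀ (M : ModuleCat.{u} A) (j : ℕ),
      Nonempty (((Tor (ModuleCat.{u} A) j).obj (ModuleCat.of A (ResidueField A))).obj M ≅
        (TC (projectiveResolution M).complex (ModuleCat.of A
          ((ModuleCat.of A A) ⧸ (Ideal.ofList rs • ⊤ : Submodule A (ModuleCat.of A A))))).homology j) := by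
    intro M j
    exact ⟨((Tor (ModuleCat.{u} A) j).mapIso ek).app M ≪≫
      (projectiveResolution M).isoLeftDerivedObj
        ((MonoidalCategory.tensoringLeft (ModuleCat.{u} A)).obj _) j⟩
  have main := fun M : ModuleCat.{u} A => TC_list (projectiveResolution M) rs (ModuleCat.of A A)
    hreg.toIsWeaklyRegular 0 (by
      rintro (_ | j) hj
      · omega
      · exact TC_flat _ j)
  refine ⟨fun M j hj => ?_, ?_, ?_⟩
  · exact ((main M).1 j (by omega)).of_iso (key M j).some
  · obtain ⟨a⟩ := key (ModuleCat.of A (ResidueField A)) n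
    obtain ⟨b⟩ := (main (ModuleCat.of A (ResidueField A))).2 (by
      intro x hx
      have hx' : x ∈ maximalIdeal A := hspan ▸ Ideal.subset_span hx
      ext y
      obtain ⟨y, rfl⟩ := Ideal.Quotient.mk_surjective y
      exact Ideal.Quotient.eq_zero_iff_mem.mpr (Ideal.mul_mem_right _ _ hx'))
    rw [zero_add, hlen] at b
    have c := (projectiveResolution (ModuleCat.of A (ResidueField A))).isoLeftDerivedObj
        (MonoidalCategory.tensorLeft (ModuleCat.of A A)) 0
    have d := (MonoidalCategory.tensorLeft (ModuleCat.of A A)).leftDerivedZeroIsoSelf.app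
      (ModuleCat.of A (ResidueField A))
    have l := MonoidalCategory.leftUnitor (ModuleCat.of A (ResidueField A))
    exact ⟨a ≪≫ b ≪≫ c.symm ≪≫ d ≪≫ l⟩
  · apply le_antisymm
    · refine sSup_le ?_
      rintro _ ⟨p, M, N, rfl, h⟩
      rw [Nat.cast_le]
      by_contra hp
      obtain _ | p := p
      · omega
      · exact h ((aux_link M N p).mpr (aux_all rs hreg hs M N (p+1) (by omega)))
    · obtain _ | m := n
      · simp
      · have h1 : ¬ HasProjectiveDimensionLT (ModuleCat.of A (ResidueField A)) (m+1) := by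
          intro h
          have h2 := (projectiveDimension_lt_iff (n := m+1)).mpr h
          rw [aux_pdk rs hreg hs, hlen] at h2
          exact lt_irrefl _ h2
        have h3 : ∃ Y, ¬ Subsingleton (Abelian.Ext (ModuleCat.of A (ResidueField A)) Y (m+1)) := by
          by_contra hc
          push Not at hc
          exact h1 (hasProjectiveDimensionLT_of_enoughInjectives _ _ hc)
        obtain ⟨Y, hY⟩ := h3
        exact le_sSup ⟨m+1, _, Y, rfl, fun h => hY ((aux_link _ _ _).mp h)⟩
end

section
/- Let (A, m) be a noetherian local ring of Krull dimension 0 (i.e. an artinian local ring) with finite global dimension. Then A is a field, i.e. m = 0. -/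
/-!
STATEMENT 8: Let (A, m) be a noetherian local ring of Krull dimension 0 (i.e. an artinian
local ring) with finite global dimension. Then A is a field, i.e. m = 0.
-/

open CategoryTheory Limits IsLocalRing

universe u

open scoped TensorProduct

theorem gldhaux_pd (A : Type u) [CommRing A] (hgl : gldh A ≠ ⊤) :
    ∃ n : ℕ, ∀ M : ModuleCat.{u} A, HasProjectiveDimensionLT M (n + 1) := by
  obtain ⟨n, hn⟩ := ENat.ne_top_iff_exists.mp hgl
  refine ⟨n, fun M => ?_⟩
  have hz : ∀ p : ℕ, n < p → ∀ N : ModuleCat.{u} A,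
      IsZero (((Ext A (ModuleCat.{u} A) p).obj (Opposite.op M)).obj N) := by
    intro p hp N
    by_contra h
    have : (p : ℕ∞) ≤ gldh A := le_sSup ⟨p, M, N, rfl, h⟩
    rw [← hn] at this
    have := Nat.cast_le.mp this
    omega
  refine HasProjectiveDimensionLT.mk ?_
  intro i hi Y e
  obtain ⟨p, rfl⟩ : ∃ p, i = p + 1 := ⟨i - 1, by omega⟩
  let P := projectiveResolution M
  obtain ⟨f, hf, rfl⟩ := P.extMk_surjective e (p + 1 + 1) rfl
  rw [P.extMk_eq_zero_iff f _ rfl hf p rfl]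
  have h1 := (hz (p + 1) (by omega) Y).of_iso (P.isoExt (R := A) (p + 1) Y).symm
  rw [← HomologicalComplex.exactAt_iff_isZero_homology,
    HomologicalComplex.exactAt_iff' _ p (p + 1) (p + 1 + 1) (by simp) (by simp),
    ShortComplex.moduleCat_exact_iff] at h1
  obtain ⟨g, hg⟩ := h1 f hf
  exact ⟨g, hg⟩

theorem gldhaux_mem {A : Type u} [CommRing A] [IsLocalRing A]
    {M : Type u} [AddCommGroup M] [Module A M] (x : M) :
    (1 : ResidueField A) ⊗ₜ[A] x = 0 ↔ x ∈ maximalIdeal A • (⊤ : Submodule A M) := by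
  rw [← Submodule.Quotient.mk_eq_zero]
  have h := (TensorProduct.quotTensorEquivQuotSMul M (maximalIdeal A)).map_eq_zero_iff
    (x := (Ideal.Quotient.mk (maximalIdeal A) 1) ⊗ₜ[A] x)
  rw [TensorProduct.quotTensorEquivQuotSMul_mk_tmul, one_smul] at h
  exact h.symm

theorem gldhaux_socle (A : Type u) [CommRing A] [IsNoetherianRing A] [IsLocalRing A]
    (hdim : ringKrullDim A = 0) : ∃ s : A, s ≠ 0 ∧ ∀ a ∈ maximalIdeal A, s * a = 0 := by
  have h0 : Ring.KrullDimLE 0 A := ringKrullDimZero_iff_ringKrullDim_eq_zero.mpr hdim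
  have : IsArtinianRing A := IsNoetherianRing.isArtinianRing_of_krullDimLE_zero
  have hnil : ∃ n, maximalIdeal A ^ n = ⊥ :=
    (isArtinianRing_iff_isNilpotent_maximalIdeal A).mp this
  classical
  have hn := Nat.find_spec hnil
  have hm := fun m => Nat.find_min hnil (m := m)
  generalize Nat.find hnil = n at hn hm
  cases n with
  | zero => simp at hn
  | succ n =>
    obtain ⟨s, hs, hs0⟩ := Submodule.exists_mem_ne_zero_of_ne_bot (hm n (by omega))
    refine ⟨s, hs0, fun a ha => ?_⟩
    have := Ideal.mul_mem_mul hs ha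
    rwa [← pow_succ, hn] at this

theorem gldhaux_free {A : Type u} [CommRing A] [IsNoetherianRing A] [IsLocalRing A]
    (s : A) (hs : s ≠ 0) (hsm : ∀ a ∈ maximalIdeal A, s * a = 0) (n : ℕ)
    (M : ModuleCat.{u} A) [Module.Finite A M] (h : HasProjectiveDimensionLT M (n + 1)) :
    Module.Free A M := by
  induction n generalizing M with
  | zero =>
    have h' : Projective M := projective_iff_hasProjectiveDimensionLT_one.mpr h
    have : Module.Projective A M := (IsProjective.iff_projective M).mpr h'
    exact Module.free_of_flat_of_isLocalRing
  | succ n ih =>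
    obtain ⟨F, _, _, _, _, f, hf⟩ := Module.exists_finite_presentation A M
    have hS := LinearMap.shortExact_shortComplexKer hf
    have proj := ModuleCat.projective_of_categoryTheory_projective f.shortComplexKer.X₂
    have hK : HasProjectiveDimensionLT (ModuleCat.of A (LinearMap.ker f)) (n + 1) :=
      (hS.hasProjectiveDimensionLT_X₃_iff n proj).mp h
    have hfree : Module.Free A (LinearMap.ker f) := ih (ModuleCat.of A (LinearMap.ker f)) hK
    refine Module.free_of_lTensor_residueField_injective (LinearMap.ker f).subtype f hf
      (LinearMap.exact_subtype_ker_map f) ?_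
    rw [injective_iff_map_eq_zero]
    intro t ht
    obtain ⟨x, rfl⟩ : ∃ x, (1 : ResidueField A) ⊗ₜ[A] x = t :=
      TensorProduct.mk_surjective A _ _ (residue_surjective) t
    rw [LinearMap.lTensor_tmul, gldhaux_mem] at ht
    rw [gldhaux_mem]
    have hsx : s • x = 0 := by
      apply Subtype.ext
      have key : ∀ y ∈ maximalIdeal A • (⊤ : Submodule A F), s • y = 0 := by
        intro y hy
        refine Submodule.smul_induction_on hy ?_ ?_
        · intro r hr z _
          rw [smul_smul, hsm r hr, zero_smul]
        · intro a b ha hb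
          rw [smul_add, ha, hb, add_zero]
      exact key _ ht
    let b := Module.Free.chooseBasis A (LinearMap.ker f)
    rw [← b.sum_repr x]
    refine Submodule.sum_mem _ fun i _ => Submodule.smul_mem_smul ?_ trivial
    rw [mem_maximalIdeal, mem_nonunits_iff]
    intro hu
    have h2 : s * b.repr x i = 0 := by
      have := congrArg (fun z => b.repr z i) hsx
      simpa using this
    exact hs (hu.mul_left_eq_zero.mp h2)

theorem isField_of_dim_zero_of_finite_gldh
    (A : Type u) [CommRing A] [IsNoetherianRing A] [IsLocalRing A]
    (hdim : ringKrullDim A = 0) (hgl : gldh A ≠ ⊤) :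
    maximalIdeal A = ⊥ := by
  obtain ⟨n, hn⟩ := gldhaux_pd A hgl
  obtain ⟨s, hs, hsm⟩ := gldhaux_socle A hdim
  have hfin : Module.Finite A (ModuleCat.of A (ResidueField A)) :=
    inferInstanceAs (Module.Finite A (ResidueField A))
  have hfree : Module.Free A (ResidueField A) :=
    gldhaux_free s hs hsm n (ModuleCat.of A (ResidueField A)) (hn _)
  rw [eq_bot_iff]
  intro a ha
  have h1 : ∀ x : ResidueField A, a • x = (0 : A) • x := by
    intro x
    rw [zero_smul, Algebra.smul_def, ResidueField.algebraMap_eq, (residue_eq_zero_iff a).mpr ha,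
      zero_mul]
  exact FaithfulSMul.eq_of_smul_eq_smul h1
end

section
/- Let (A, m) be a noetherian local ring with finite global dimension. Then gldh A = dim A = depth A; in particular A is a Cohen–Macaulay ring. -/
/-!
STATEMENT 10: Let (A, m) be a noetherian local ring with finite global dimension. Then
gldh A = dim A = depth A; in particular A is a Cohen–Macaulay ring (depth A = dim A).
-/

open CategoryTheory Limits IsLocalRing

universe u

theorem aux_isZero_ext_iff (A : Type u) [CommRing A] (M N : ModuleCat.{u} A) (p : ℕ) :
    IsZero (((Ext A (ModuleCat.{u} A) (p+1)).obj (Opposite.op M)).obj N) ↔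
      Subsingleton (Abelian.Ext M N (p+1)) := by
  let P := ProjectiveResolution.of M
  rw [(P.isoExt (R := A) (p+1) N).isZero_iff, ← HomologicalComplex.exactAt_iff_isZero_homology,
    HomologicalComplex.exactAt_iff' _ p (p+1) (p+2) (by simp) (by simp),
    ShortComplex.moduleCat_exact_iff]
  constructor
  · intro h
    refine subsingleton_of_forall_eq 0 fun α => ?_
    obtain ⟨f, hf, rfl⟩ := P.extMk_surjective α (p+2) rfl
    rw [P.extMk_eq_zero_iff f (p+2) rfl hf p rfl]
    exact h f hf
  · intro h f hf
    have := Subsingleton.elim (P.extMk (Y := N) f (p+2) rfl hf) 0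
    rw [P.extMk_eq_zero_iff f (p+2) rfl hf p rfl] at this
    exact this

open Abelian in
/-- Baer -/
theorem aux_baer (A : Type u) [CommRing A] (n : ℕ) (N : ModuleCat.{u} A)
    (h : ∀ I : Ideal A, Subsingleton (Ext (ModuleCat.of A (A ⧸ I)) N (n+1))) :
    HasInjectiveDimensionLT N (n+1) := by
  induction n generalizing N with
  | zero =>
    simp only [zero_add] at h ⊢
    rw [← injective_iff_hasInjectiveDimensionLT_one]
    rw [← Module.injective_iff_injective_object, ← Module.Baer.iff_injective]
    intro I g
    let S : ShortComplex (ModuleCat.{u} A) := ShortComplex.mk (ModuleCat.ofHom I.subtype)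
      (ModuleCat.ofHom I.mkQ) (by ext x; exact (Submodule.Quotient.mk_eq_zero I).2 x.2)
    have hS : S.ShortExact := by
      refine ShortComplex.ShortExact.mk' ?_ ?_ ?_
      · rw [ShortComplex.moduleCat_exact_iff]
        intro x hx
        exact ⟨⟨x, (Submodule.Quotient.mk_eq_zero I).1 hx⟩, rfl⟩
      · rw [ModuleCat.mono_iff_injective]; exact Subtype.val_injective
      · rw [ModuleCat.epi_iff_surjective]; exact Submodule.mkQ_surjective _
    have := h I
    obtain ⟨y, hy⟩ := Ext.contravariant_sequence_exact₁ hS N (Ext.mk₀ (ModuleCat.ofHom g))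
      (show 1 + 0 = 1 from rfl) (Subsingleton.elim (α := Ext (ModuleCat.of A (A ⧸ I)) N 1) _ _)
    obtain ⟨f, rfl⟩ := (Ext.mk₀_bijective _ _).2 y
    rw [Ext.mk₀_comp_mk₀, (Ext.mk₀_bijective _ _).1.eq_iff] at hy
    refine ⟨f.hom, fun x hx => ?_⟩
    have := congrArg (fun t => t.hom ⟨x, hx⟩) hy
    exact this
  | succ n ih =>
    let S := ShortComplex.mk (Injective.ι N) (cokernel.π (Injective.ι N)) (by simp)
    have hS : S.ShortExact := { exact := ShortComplex.exact_cokernel _ }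
    refine (hS.hasInjectiveDimensionLT_X₃_iff n (inferInstanceAs (Injective (Injective.under N)))).1
      (ih _ fun I => ?_)
    refine subsingleton_of_forall_eq 0 fun α => ?_
    have := h I
    obtain ⟨y, hy⟩ := Ext.covariant_sequence_exact₃ _ hS α (show n + 1 + 1 = n + 2 from rfl)
      (Subsingleton.elim (α := Ext (ModuleCat.of A (A ⧸ I)) N (n+2)) _ _)
    have h2 : HasInjectiveDimensionLT S.X₂ 1 :=
      injective_iff_hasInjectiveDimensionLT_one.1 (inferInstanceAs (Injective (Injective.under N)))
    rw [← hy, y.eq_zero_of_hasInjectiveDimensionLT 1 (by omega)]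
    simp

open Abelian in
theorem aux_global_of_fg (A : Type u) [CommRing A] (n : ℕ) (hn : n ≠ 0)
    (h : ∀ M : ModuleCat.{u} A, Module.Finite A M → HasProjectiveDimensionLT M n) :
    ∀ M : ModuleCat.{u} A, HasProjectiveDimensionLT M n := by
  obtain ⟨n, rfl⟩ := Nat.exists_eq_succ_of_ne_zero hn
  intro M
  have key (N : ModuleCat.{u} A) : HasInjectiveDimensionLT N (n+1) := aux_baer A n N fun I => by
    have := h (ModuleCat.of A (A ⧸ I)) inferInstance
    exact HasProjectiveDimensionLT.subsingleton _ (n+1) _ le_rfl _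
  refine HasProjectiveDimensionLT.mk fun i hi N e => ?_
  have := key N
  exact e.eq_zero_of_hasInjectiveDimensionLT (n+1) hi

open Abelian in
/-- nonmaximal primes have smaller projective dimension -/
theorem aux_prime (A : Type u) [CommRing A] [IsNoetherianRing A] [IsLocalRing A] (n : ℕ)
    (h : ∀ M : ModuleCat.{u} A, HasProjectiveDimensionLT M (n+1)) (p : Ideal A) [hp : p.IsPrime]
    (hpm : p ≠ maximalIdeal A) : HasProjectiveDimensionLT (ModuleCat.of A (A ⧸ p)) n := by
  apply ModuleCat.hasProjectiveDimensionLT_of_forall_finite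
  intro L _
  obtain ⟨x, hxm, hxp⟩ : ∃ x ∈ maximalIdeal A, x ∉ p := by
    by_contra! hc
    exact hpm (le_antisymm (IsLocalRing.le_maximalIdeal hp.ne_top) hc)
  let M := ModuleCat.of A (A ⧸ p)
  have reg : IsSMulRegular M x := by
    rw [isSMulRegular_iff_right_eq_zero_of_smul]
    intro y hy
    obtain ⟨y, rfl⟩ := Ideal.Quotient.mk_surjective y
    change Ideal.Quotient.mk p (x * y) = 0 at hy
    rw [Ideal.Quotient.eq_zero_iff_mem] at hy ⊢
    exact (hp.mem_or_mem hy).resolve_left hxp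
  let S := M.smulShortComplex x
  have hS : S.ShortExact := reg.smulShortComplex_shortExact
  have := h S.X₃
  have zero := HasProjectiveDimensionLT.subsingleton S.X₃ (n + 1) _ (le_refl _) L
  by_contra ntr
  rw [not_subsingleton_iff_nontrivial] at ntr
  have : x ∈ (Module.annihilator A (Ext M L n)).jacobson :=
    (IsLocalRing.maximalIdeal_le_jacobson _) hxm
  refine absurd ?_ (Submodule.top_ne_pointwise_smul_of_mem_jacobson_annihilator this)
  rw [eq_comm, eq_top_iff]
  intro y _
  obtain ⟨z, hz⟩ := Ext.contravariant_sequence_exact₁ hS L y (add_comm 1 n)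
    (Subsingleton.elim (α := Ext S.X₃ L (n+1)) _ _)
  have e : S.f = x • 𝟙 M := rfl
  have aux (z : Ext M L n) : (Ext.mk₀ (x • 𝟙 M)).comp z (zero_add n) = x • z := by
    rw [Ext.mk₀_smul, Ext.smul_comp, Ext.mk₀_id_comp]
  have hz' : x • (z : Ext M L n) = y := (aux z).symm.trans hz
  rw [← hz']
  exact Submodule.smul_mem_pointwise_smul _ _ ⊤ trivial

open Abelian in
theorem aux_reduce (A : Type u) [CommRing A] [IsNoetherianRing A] [IsLocalRing A] (n : ℕ)
    (hn : n ≠ 0)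
    (h : ∀ M : ModuleCat.{u} A, HasProjectiveDimensionLT M (n+1))
    (hk : HasProjectiveDimensionLT (ModuleCat.of A (A ⧸ maximalIdeal A)) n) :
    ∀ M : ModuleCat.{u} A, HasProjectiveDimensionLT M n := by
  apply aux_global_of_fg A n hn
  intro M hM
  suffices H : ∀ (M : Type u) [AddCommGroup M] [Module A M] (hM : Module.Finite A M),
    HasProjectiveDimensionLT (ModuleCat.of A M) n from H M hM
  clear! M
  intro M _ _ hM
  induction hM using IsNoetherianRing.induction_on_isQuotientEquivQuotientPrime A with
  | subsingleton N =>
    have := (ModuleCat.isZero_of_subsingleton (ModuleCat.of A N)).hasProjectiveDimensionLT_zero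
    exact hasProjectiveDimensionLT_of_ge _ 0 n (by omega)
  | quotient N p f =>
    have : HasProjectiveDimensionLT (ModuleCat.of A (A ⧸ p.1)) n := by
      have := p.2
      by_cases hp : p.1 = maximalIdeal A
      · rwa [hp]
      · exact aux_prime A n h p.1 hp
    exact hasProjectiveDimensionLT_of_iso (X := ModuleCat.of A (A ⧸ p.1)) f.toModuleIso.symm n
  | exact N₁ N₂ N₃ f g hf hg hfg h₁ h₃ =>
    let S : ShortComplex (ModuleCat.{u} A) := ShortComplex.mk (ModuleCat.ofHom f)
      (ModuleCat.ofHom g) (by ext x; exact hfg.apply_apply_eq_zero x)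
    have hS : S.ShortExact := by
      refine ShortComplex.ShortExact.mk' ?_ ?_ ?_
      · rw [ShortComplex.moduleCat_exact_iff]
        intro x hx
        exact (hfg x).1 hx
      · rw [ModuleCat.mono_iff_injective]; exact hf
      · rw [ModuleCat.epi_iff_surjective]; exact hg
    exact hS.hasProjectiveDimensionLT_X₂ n h₁ h₃

lemma aux_loc (A : Type u) [CommRing A] (S : Submonoid A) (M : ModuleCat.{u} A)
    (N : Type u) [AddCommGroup N] [Module A N] [Module (Localization S) N]
    [IsScalarTower A (Localization S) N] (f : M →ₗ[A] N) [IsLocalizedModule S f] (k : ℕ)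
    (h : HasProjectiveDimensionLT M (k+1)) :
    HasProjectiveDimensionLT (ModuleCat.of (Localization S) N) (k+1) := by
  have : HasProjectiveDimensionLE M k := h
  have h1 := ModuleCat.localizedModule_hasProjectiveDimensionLE k S M
  have e := IsLocalizedModule.linearEquiv S (M.localizedModuleMkLinearMap S) f
  have e2 : M.localizedModule S ≃ₗ[Localization S] N :=
    LinearEquiv.extendScalarsOfIsLocalization S (Localization S) e
  exact hasProjectiveDimensionLT_of_iso e2.toModuleIso (k+1)

lemma aux_loc_all (A : Type u) [CommRing A] (S : Submonoid A) (k : ℕ)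
    (h : ∀ M : ModuleCat.{u} A, HasProjectiveDimensionLT M (k+1)) :
    ∀ M : ModuleCat.{u} (Localization S), HasProjectiveDimensionLT M (k+1) := by
  intro N
  let : Module A N := Module.compHom N (algebraMap A (Localization S))
  have : IsScalarTower A (Localization S) N := IsScalarTower.of_algebraMap_smul fun _ _ => rfl
  have := isLocalizedModule_id S N (Localization S)
  exact aux_loc A S (ModuleCat.of A N) N LinearMap.id k (h _)

lemma aux_loc_quot (A : Type u) [CommRing A] (p : Ideal A) [p.IsPrime] (k : ℕ)
    (h : HasProjectiveDimensionLT (ModuleCat.of A (A ⧸ p)) (k+1)) :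
    HasProjectiveDimensionLT (ModuleCat.of (Localization.AtPrime p)
      (Localization.AtPrime p ⧸ maximalIdeal (Localization.AtPrime p))) (k+1) := by
  have h1 := aux_loc A p.primeCompl (ModuleCat.of A (A ⧸ p)) _ (Submodule.toLocalizedQuotient'
    (Localization p.primeCompl) p.primeCompl (Algebra.linearMap A (Localization p.primeCompl)) p) k h
  have h2 : Submodule.localized' (Localization p.primeCompl) p.primeCompl
      (Algebra.linearMap A (Localization p.primeCompl)) p
      = maximalIdeal (Localization.AtPrime p) := by
    rw [← Localization.AtPrime.map_eq_maximalIdeal]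
    exact Ideal.localized'_eq_map _ _ _
  rw [h2] at h1
  exact h1

lemma aux_dim (n : ℕ) : ∀ (A : Type u) [CommRing A] [IsNoetherianRing A] [IsLocalRing A],
    (∀ M : ModuleCat.{u} A, HasProjectiveDimensionLT M (n+1)) → ringKrullDim A ≤ n := by
  induction n with
  | zero =>
    intro A _ _ _ h
    rw [← IsLocalRing.maximalIdeal_height_eq_ringKrullDim]
    have : (maximalIdeal A).height ≤ ((0:ℕ) : ℕ∞) := by
      rw [Ideal.height_le_iff]
      intro q hq hlt
      exfalso
      have h1 := aux_prime A 0 h q hlt.ne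
      have h2 := isZero_of_hasProjectiveDimensionLT_zero (ModuleCat.of A (A ⧸ q))
      have h3 : Subsingleton (A ⧸ q) := ModuleCat.subsingleton_of_isZero h2
      exact hq.ne_top (Ideal.Quotient.subsingleton_iff.mp h3)
    exact_mod_cast this
  | succ n ih =>
    intro A _ _ _ h
    rw [← IsLocalRing.maximalIdeal_height_eq_ringKrullDim]
    have : (maximalIdeal A).height ≤ ((n+1:ℕ) : ℕ∞) := by
      rw [Ideal.height_le_iff]
      intro q hq hlt
      have h1 := aux_prime A (n+1) h q hlt.ne
      have h2 := aux_reduce (Localization.AtPrime q) (n+1) (by simp)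
        (aux_loc_all A q.primeCompl (n+1) h) (aux_loc_quot A q n h1)
      have h3 := ih (Localization.AtPrime q) h2
      rw [IsLocalization.AtPrime.ringKrullDim_eq_height q] at h3
      have h4 : q.height ≤ (n : ℕ∞) := by exact_mod_cast h3
      exact lt_of_le_of_lt h4 (by exact_mod_cast Nat.lt_succ_self n)
    exact_mod_cast this

lemma aux_depth (A : Type u) [CommRing A] [IsNoetherianRing A] [IsLocalRing A] (d : ℕ)
    (h : ∀ M : ModuleCat.{u} A, HasProjectiveDimensionLT M (d+1))
    (hk : ¬ HasProjectiveDimensionLT (ModuleCat.of A (A ⧸ maximalIdeal A)) d) (e : ℕ)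
    (he : e ≤ d) : ∃ rs : List A, (∀ x ∈ rs, x ∈ maximalIdeal A) ∧
      RingTheory.Sequence.IsWeaklyRegular A rs ∧ rs.length = e := by
  induction e with
  | zero => exact ⟨[], by simp, RingTheory.Sequence.IsWeaklyRegular.nil A A, rfl⟩
  | succ e ih =>
    obtain ⟨rs, hm, hr, hl⟩ := ih (by omega)
    let Q := A ⧸ (Ideal.ofList rs • (⊤ : Submodule A A))
    have hQ : HasProjectiveDimensionLT (ModuleCat.of A Q) d := by
      have h1 := ModuleCat.projectiveDimension_quotient_eq_add_length_of_isWeaklyRegular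
        (ModuleCat.of A A) rs hr hm
      have : Projective (ModuleCat.of A A) :=
        (IsProjective.iff_projective (R := A) A).1 inferInstance
      rw [ModuleCat.projectiveDimension_eq_zero_of_projective (ModuleCat.of A A), zero_add, hl] at h1
      rw [← projectiveDimension_lt_iff]
      refine lt_of_eq_of_lt h1 ?_
      exact_mod_cast he
    have hex : ∃ r ∈ Module.annihilator A (A ⧸ maximalIdeal A), IsSMulRegular Q r := by
      rw [← IsSMulRegular.subsingleton_linearMap_iff]
      refine subsingleton_of_forall_eq 0 fun f => ?_
      by_contra hf
      apply hk
      have : IsSimpleModule A (A ⧸ maximalIdeal A) := by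
        rw [isSimpleModule_iff_isCoatom]
        exact Ideal.isMaximal_def.1 inferInstance
      have hinj : Function.Injective f := (LinearMap.injective_or_eq_zero f).resolve_right hf
      let S : ShortComplex (ModuleCat.{u} A) := ShortComplex.mk (ModuleCat.ofHom f)
        (ModuleCat.ofHom (LinearMap.range f).mkQ)
        (by ext x; exact (Submodule.Quotient.mk_eq_zero _).2 ⟨_, rfl⟩)
      have hS : S.ShortExact := by
        refine ShortComplex.ShortExact.mk' ?_ ?_ ?_
        · rw [ShortComplex.moduleCat_exact_iff]
          intro x hx
          exact (Submodule.Quotient.mk_eq_zero (LinearMap.range f)).1 hx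
        · rw [ModuleCat.mono_iff_injective]; exact hinj
        · rw [ModuleCat.epi_iff_surjective]; exact Submodule.mkQ_surjective _
      exact hS.hasProjectiveDimensionLT_X₁ d hQ (h _)
    obtain ⟨x, hx, hxr⟩ := hex
    rw [Ideal.annihilator_quotient] at hx
    refine ⟨rs ++ [x], ?_, ?_, by simp [hl]⟩
    · intro y hy
      rcases List.mem_append.1 hy with hy | hy
      · exact hm y hy
      · rw [List.mem_singleton.1 hy]; exact hx
    · rw [RingTheory.Sequence.isWeaklyRegular_append_iff,
        RingTheory.Sequence.isWeaklyRegular_singleton_iff]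
      exact ⟨hr, hxr⟩

theorem gldh_eq_dim_eq_depth_of_finite_gldh
    (A : Type u) [CommRing A] [IsNoetherianRing A] [IsLocalRing A]
    (hgl : gldh A ≠ ⊤) :
    ringKrullDim A = (gldh A : WithBot ℕ∞) ∧
    gldh A = mdepth A A ∧
    ringKrullDim A = (mdepth A A : WithBot ℕ∞) := by
  obtain ⟨d, hd⟩ := ENat.ne_top_iff_exists.1 hgl
  have hG : ∀ M : ModuleCat.{u} A, HasProjectiveDimensionLT M (d+1) := by
    intro M
    refine HasProjectiveDimensionLT.mk fun i hi N e => ?_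
    obtain ⟨p, rfl⟩ : ∃ p, i = p + 1 := ⟨i - 1, by omega⟩
    have : Subsingleton (Abelian.Ext M N (p+1)) := by
      rw [← aux_isZero_ext_iff]
      by_contra hc
      have h1 : ((p + 1 : ℕ) : ℕ∞) ≤ gldh A := le_sSup ⟨p+1, M, N, rfl, hc⟩
      rw [← hd, Nat.cast_le] at h1
      omega
    exact Subsingleton.elim _ _
  have hk : ¬ HasProjectiveDimensionLT (ModuleCat.of A (A ⧸ maximalIdeal A)) d := by
    intro hk
    rcases d with _ | d
    · have h2 := isZero_of_hasProjectiveDimensionLT_zero (ModuleCat.of A (A ⧸ maximalIdeal A))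
      have h3 : Subsingleton (A ⧸ maximalIdeal A) := ModuleCat.subsingleton_of_isZero h2
      exact (maximalIdeal.isMaximal A).ne_top (Ideal.Quotient.subsingleton_iff.mp h3)
    · have h1 := aux_reduce A (d+1) (by simp) hG hk
      have h2 : gldh A ≤ (d : ℕ∞) := by
        refine sSup_le ?_
        rintro _ ⟨p, M, N, rfl, hp⟩
        by_contra hc
        rw [Nat.cast_le] at hc
        obtain ⟨q, rfl⟩ : ∃ q, p = q + 1 := ⟨p - 1, by omega⟩
        rw [aux_isZero_ext_iff] at hp
        have := h1 M
        exact hp (HasProjectiveDimensionLT.subsingleton M (d+1) _ (by omega) N)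
      rw [← hd, Nat.cast_le] at h2
      omega
  have hdim : ringKrullDim A ≤ d := aux_dim d A hG
  obtain ⟨rs, hm, hw, hl⟩ := aux_depth A d hG hk d le_rfl
  have hlen (ts : List A) (ht : RingTheory.Sequence.IsRegular A ts)
      (htm : ∀ x ∈ ts, x ∈ maximalIdeal A) :
      ((ts.length : ℕ) : WithBot ℕ∞) ≤ ringKrullDim A := by
    rw [← ringKrullDim_add_length_eq_ringKrullDim_of_isRegular ts ht]
    have : Nontrivial (A ⧸ Ideal.ofList ts) := by
      rw [Ideal.Quotient.nontrivial_iff]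
      intro htop
      have : Ideal.ofList ts ≤ maximalIdeal A := Ideal.span_le.2 htm
      exact (maximalIdeal.isMaximal A).ne_top (top_le_iff.1 (htop ▸ this))
    exact le_add_of_nonneg_left ringKrullDim_nonneg_of_nontrivial
  have hreg := (IsLocalRing.isRegular_iff_isWeaklyRegular_of_subset_maximalIdeal hm).2 hw
  have e1 : ringKrullDim A = (d : WithBot ℕ∞) := le_antisymm hdim (hl ▸ hlen rs hreg hm)
  have e2 : mdepth A A = (d : ℕ∞) := by
    refine le_antisymm (sSup_le ?_) (le_sSup ⟨rs, hm, hreg, by rw [hl]⟩)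
    rintro _ ⟨ts, htm, ht, rfl⟩
    have := (hlen ts ht htm).trans hdim
    exact_mod_cast this
  rw [e2, e1, ← hd]
  exact ⟨rfl, rfl, rfl⟩
end

section
/- Let (A, m) be a noetherian local ring of finite global dimension n with residue field k = A/m, and let g ∈ m \ m² be a nonzerodivisor of A. Set A' = A/gA with residue field k. Then Tor_q^{A'}(k, k) = 0 for all q ≥ n; in particular A' has finite global dimension. -/
/-!
STATEMENT 12: Let (A, m) be a noetherian local ring of finite global dimension n with
residue field k = A/m, and let g ∈ m \ m² be a nonzerodivisor of A. Set A' = A/gA with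
residue field k. Then Tor_q^{A'}(k, k) = 0 for all q ≥ n; in particular A' has finite
global dimension.
-/

open CategoryTheory Limits IsLocalRing

universe u

/-- The residue field of the quotient `A' = A/gA` of a local ring `(A, m)`,
namely `A'/(m/gA) = A/m`. -/
noncomputable def quotResidueField (A : Type u) [CommRing A] [IsLocalRing A] (g : A) :
    Type u :=
  (A ⧸ Ideal.span {g}) ⧸ (maximalIdeal A).map (Ideal.Quotient.mk (Ideal.span {g}))

noncomputable instance (A : Type u) [CommRing A] [IsLocalRing A] (g : A) :
    CommRing (quotResidueField A g) :=
  inferInstanceAs (CommRing ((A ⧸ Ideal.span {g}) ⧸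
    (maximalIdeal A).map (Ideal.Quotient.mk (Ideal.span {g}))))

noncomputable instance (A : Type u) [CommRing A] [IsLocalRing A] (g : A) :
    Algebra (A ⧸ Ideal.span {g}) (quotResidueField A g) :=
  inferInstanceAs (Algebra (A ⧸ Ideal.span {g}) ((A ⧸ Ideal.span {g}) ⧸
    (maximalIdeal A).map (Ideal.Quotient.mk (Ideal.span {g}))))


section P1

open Abelian in
lemma isZero_oldExt_iff {R : Type u} [CommRing R] (M N : ModuleCat.{u} R) (p : ℕ) :
    IsZero (((Ext R (ModuleCat.{u} R) (p+1)).obj (Opposite.op M)).obj N) ↔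
      Subsingleton (Abelian.Ext.{u} M N (p+1)) := by
  let P := projectiveResolution M
  have h1 : IsZero (((Ext R (ModuleCat.{u} R) (p+1)).obj (Opposite.op M)).obj N) ↔
      IsZero ((P.complex.linearYonedaObj R N).homology (p+1)) :=
    Iso.isZero_iff (P.isoExt (p+1) N)
  rw [h1, ← HomologicalComplex.exactAt_iff_isZero_homology,
    HomologicalComplex.exactAt_iff' _ p (p+1) (p+2) (by simp) (by simp),
    ShortComplex.moduleCat_exact_iff]
  constructor
  · intro h
    refine ⟨fun a b => ?_⟩
    suffices ∀ a : Abelian.Ext.{u} M N (p+1), a = 0 by rw [this a, this b]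
    intro a
    obtain ⟨f, hf, rfl⟩ := P.extMk_surjective a (p+2) rfl
    rw [P.extMk_eq_zero_iff _ _ _ _ p rfl]
    exact h f hf
  · intro h f hf
    exact (P.extMk_eq_zero_iff f (p+2) rfl hf p rfl).1 (Subsingleton.elim _ _)

lemma hasPD_of_gldh {R : Type u} [CommRing R] (n : ℕ) (h : gldh R = (n : ℕ∞))
    (M : ModuleCat.{u} R) : HasProjectiveDimensionLT M (n+1) := by
  refine HasProjectiveDimensionLT.mk (fun i hi Y e => ?_)
  obtain ⟨i, rfl⟩ : ∃ j, i = j + 1 := ⟨i - 1, by omega⟩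
  have : Subsingleton (Abelian.Ext.{u} M Y (i+1)) := by
    rw [← isZero_oldExt_iff]
    by_contra hc
    have : ((i + 1 : ℕ) : ℕ∞) ≤ gldh R := le_sSup ⟨i+1, M, Y, rfl, hc⟩
    rw [h, Nat.cast_le] at this
    omega
  exact Subsingleton.elim _ _

lemma gldh_ne_top {R : Type u} [CommRing R] (n : ℕ)
    (h : ∀ M : ModuleCat.{u} R, HasProjectiveDimensionLT M n) : gldh R ≠ ⊤ := by
  have : gldh R ≤ n := by
    refine sSup_le ?_
    rintro _ ⟨p, M, N, rfl, hc⟩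
    rw [Nat.cast_le]
    by_contra hp
    obtain ⟨p, rfl⟩ : ∃ j, p = j + 1 := ⟨p - 1, by omega⟩
    rw [isZero_oldExt_iff] at hc
    have := h M
    exact hc (HasProjectiveDimensionLT.subsingleton M n _ (by omega) N)
  exact ne_top_of_le_ne_top (ENat.natCast_ne_top n) this

lemma isZero_Tor_of_pd {R : Type u} [CommRing R] (X M : ModuleCat.{u} R) (n : ℕ) (hn : 1 ≤ n)
    [HasProjectiveDimensionLT M n] (q : ℕ) (hq : n ≤ q) :
    IsZero (((Tor (ModuleCat.{u} R) q).obj X).obj M) := by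
  obtain ⟨p, rfl⟩ : ∃ j, q = j + 1 := ⟨q - 1, by omega⟩
  let P := projectiveResolution M
  refine IsZero.of_iso ?_ (P.isoLeftDerivedObj ((MonoidalCategory.tensoringLeft _).obj X) (p+1))
  change IsZero (HomologicalComplex.homology _ _)
  rw [← HomologicalComplex.exactAt_iff_isZero_homology,
    HomologicalComplex.exactAt_iff' _ (p+2) (p+1) p (by simp) (by simp),
    ShortComplex.moduleCat_exact_iff]
  let d2 := (P.complex.d (p+2) (p+1)).hom
  let d1 := (P.complex.d (p+1) p).hom
  have key : ∃ s : (P.complex.X p) →ₗ[R] (P.complex.X (p+1) ⧸ LinearMap.range d2),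
      s ∘ₗ d1 = (LinearMap.range d2).mkQ := by
    let Z : ModuleCat.{u} R := ModuleCat.of R (P.complex.X (p+1) ⧸ LinearMap.range d2)
    let f : P.complex.X (p+1) ⟶ Z := ModuleCat.ofHom (LinearMap.range d2).mkQ
    have hf : P.complex.d (p+2) (p+1) ≫ f = 0 := by
      ext x
      exact (Submodule.Quotient.mk_eq_zero _).2 ⟨x, rfl⟩
    have := HasProjectiveDimensionLT.subsingleton M n _ hq Z
    obtain ⟨g, hg⟩ := (P.extMk_eq_zero_iff f (p+2) rfl hf p rfl).1 (Subsingleton.elim _ _)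
    exact ⟨g.hom, congrArg ModuleCat.Hom.hom hg⟩
  obtain ⟨s, hs⟩ := key
  have hex : Function.Exact d2 (LinearMap.range d2).mkQ := by
    rw [LinearMap.exact_iff]; simp
  have := lTensor_exact X hex (Submodule.mkQ_surjective _)
  have key2 : ∀ x : TensorProduct R X (P.complex.X (p+1)), d1.lTensor X x = 0 →
      ∃ y, d2.lTensor X y = x := by
    intro x hx
    refine (this x).1 ?_
    rw [← hs, LinearMap.lTensor_comp, LinearMap.comp_apply, hx, map_zero]
  exact key2

end P1

section P2

variable {R : Type u} [CommRing R]

/-- The short complex attached to two linear maps. -/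
noncomputable abbrev mkSC {X Y Z : Type u} [AddCommGroup X] [AddCommGroup Y] [AddCommGroup Z]
    [Module R X] [Module R Y] [Module R Z] (f : X →ₗ[R] Y) (g : Y →ₗ[R] Z)
    (h : g ∘ₗ f = 0) : ShortComplex (ModuleCat.{u} R) :=
  ShortComplex.mk (ModuleCat.ofHom f) (ModuleCat.ofHom g)
    (by rw [← ModuleCat.ofHom_comp, h]; rfl)

lemma mkSC_shortExact {X Y Z : Type u} [AddCommGroup X] [AddCommGroup Y] [AddCommGroup Z]
    [Module R X] [Module R Y] [Module R Z] (f : X →ₗ[R] Y) (g : Y →ₗ[R] Z)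
    (h : g ∘ₗ f = 0) (hf : Function.Injective f) (hg : Function.Surjective g)
    (he : ∀ y, g y = 0 → ∃ x, f x = y) : (mkSC f g h).ShortExact where
  exact := (ShortComplex.moduleCat_exact_iff _).2 he
  mono_f := (ModuleCat.mono_iff_injective _).2 hf
  epi_g := (ModuleCat.epi_iff_surjective _).2 hg

/-- Multiplication by `x`, as a map `R/J → R/I`. -/
noncomputable def quotF (I J : Ideal R) (x : R) (hJ : ∀ r, r ∈ J ↔ x * r ∈ I) :
    (R ⧸ J) →ₗ[R] (R ⧸ I) :=
  Submodule.mapQ J I (LinearMap.lsmul R R x) (fun r hr => (hJ r).1 hr)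

lemma quot_zero (I J : Ideal R) (x : R) (hJ : ∀ r, r ∈ J ↔ x * r ∈ I) :
    Submodule.factor (le_sup_left : I ≤ I ⊔ Ideal.span {x}) ∘ₗ quotF I J x hJ = 0 := by
  refine LinearMap.ext fun r => ?_
  obtain ⟨r, rfl⟩ := Submodule.Quotient.mk_surjective _ r
  refine (Submodule.Quotient.mk_eq_zero _).2 ?_
  exact Ideal.mem_sup_right (Ideal.mul_mem_right _ _ (Ideal.mem_span_singleton_self x))

/-- The complex `R/J → R/I → R/(I + x)`. -/
noncomputable abbrev quotSC (I J : Ideal R) (x : R) (hJ : ∀ r, r ∈ J ↔ x * r ∈ I) :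
    ShortComplex (ModuleCat.{u} R) :=
  mkSC (quotF I J x hJ) (Submodule.factor (le_sup_left : I ≤ I ⊔ Ideal.span {x}))
    (quot_zero I J x hJ)

lemma quotSC_shortExact (I J : Ideal R) (x : R) (hJ : ∀ r, r ∈ J ↔ x * r ∈ I) :
    (quotSC I J x hJ).ShortExact := by
  refine mkSC_shortExact _ _ _ ?_ (Submodule.factor_surjective _) ?_
  · refine (injective_iff_map_eq_zero (quotF I J x hJ)).2 ?_
    intro r hr
    obtain ⟨r, rfl⟩ := Submodule.Quotient.mk_surjective _ r
    exact (Submodule.Quotient.mk_eq_zero _).2 ((hJ r).2 ((Submodule.Quotient.mk_eq_zero _).1 hr))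
  · intro r hr
    obtain ⟨r, rfl⟩ := Submodule.Quotient.mk_surjective _ r
    have hr : r ∈ I ⊔ Ideal.span {x} := (Submodule.Quotient.mk_eq_zero _).1 hr
    obtain ⟨a, ha, b, hb, rfl⟩ := Submodule.mem_sup.1 hr
    obtain ⟨c, rfl⟩ := Ideal.mem_span_singleton'.1 hb
    refine ⟨Submodule.Quotient.mk c, ?_⟩
    change (Submodule.Quotient.mk (x * c) : R ⧸ I) = Submodule.Quotient.mk (a + c * x)
    rw [Submodule.Quotient.eq]
    have : x * c - (a + c * x) = - a := by ring
    rw [this]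
    exact I.neg_mem ha

lemma ext_quot_aux [IsNoetherianRing R] [IsLocalRing R] (n : ℕ)
    (hk : HasProjectiveDimensionLT (ModuleCat.of R (R ⧸ maximalIdeal R)) n)
    (N : ModuleCat.{u} R) [Module.Finite R N] (I : Ideal R) :
    ∀ i, n ≤ i → Subsingleton (Abelian.Ext.{u} (ModuleCat.of R (R ⧸ I)) N i) := by
  induction I using IsNoetherian.induction with
  | hgt I ih =>
  intro i hi
  by_cases htop : I = ⊤
  · subst htop
    have hz : IsZero (ModuleCat.of R (R ⧸ (⊤ : Ideal R))) := by
      rw [ModuleCat.isZero_iff_subsingleton]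
      exact Ideal.Quotient.subsingleton_iff.2 rfl
    have := hz.hasProjectiveDimensionLT_zero
    exact HasProjectiveDimensionLT.subsingleton _ 0 i (by omega) N
  by_cases hm : I = maximalIdeal R
  · subst hm
    exact HasProjectiveDimensionLT.subsingleton _ n i hi N
  have hle : I ≤ maximalIdeal R := IsLocalRing.le_maximalIdeal htop
  by_cases hp : Ideal.IsPrime I
  · obtain ⟨x, hxm, hxI⟩ := SetLike.exists_of_lt (lt_of_le_of_ne hle hm)
    have hJ : ∀ r, r ∈ I ↔ x * r ∈ I := fun r =>
      ⟨fun h => Ideal.mul_mem_left I _ h, fun h => (hp.mem_or_mem h).resolve_left hxI⟩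
    have hS := quotSC_shortExact I I x hJ
    have hf : (quotSC I I x hJ).f = x • 𝟙 (ModuleCat.of R (R ⧸ I)) := by
      refine ModuleCat.hom_ext (LinearMap.ext fun r => ?_)
      obtain ⟨r, rfl⟩ := Submodule.Quotient.mk_surjective _ r
      rfl
    have hgt : I < I ⊔ Ideal.span {x} := by
      refine lt_of_le_of_ne le_sup_left fun h => hxI ?_
      rw [h]
      exact Ideal.mem_sup_right (Ideal.mem_span_singleton_self x)
    have h3 : Subsingleton (Abelian.Ext.{u} (quotSC I I x hJ).X₃ N (i+1)) :=
      ih _ hgt (i+1) (by omega)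
    have hfin : Module.Finite R (Abelian.Ext.{u} (ModuleCat.of R (R ⧸ I)) N i) := inferInstance
    have hbot : (⊤ : Submodule R (Abelian.Ext.{u} (ModuleCat.of R (R ⧸ I)) N i)) = ⊥ := by
      refine Submodule.eq_bot_of_le_smul_of_le_jacobson_bot (Ideal.span {x}) _ hfin.1 ?_ ?_
      · intro e _
        obtain ⟨e', he'⟩ := Abelian.Ext.contravariant_sequence_exact₁ hS N (n₀ := i) e
          (add_comm 1 i) (Subsingleton.elim _ _)
        have : e = x • e' := by
          rw [← he', hf, Abelian.Ext.mk₀_smul, Abelian.Ext.smul_comp, Abelian.Ext.mk₀_id_comp]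
        rw [this]
        exact Submodule.smul_mem_smul (Ideal.mem_span_singleton_self x) trivial
      · rw [IsLocalRing.jacobson_eq_maximalIdeal _ bot_ne_top, Ideal.span_singleton_le_iff_mem]
        exact hxm
    exact (Submodule.subsingleton_iff R).1 (subsingleton_of_bot_eq_top hbot.symm)
  · obtain ⟨x, y, hxy, hx, hy⟩ : ∃ x y, x * y ∈ I ∧ x ∉ I ∧ y ∉ I := by
      by_contra! hc
      exact hp ⟨htop, fun {a b} hab => by
        by_contra! h2
        exact h2.2 (hc a b hab h2.1)⟩
    let J : Ideal R := Submodule.comap (LinearMap.lsmul R R x) I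
    have hJ : ∀ r, r ∈ J ↔ x * r ∈ I := fun r => Iff.rfl
    have hS := quotSC_shortExact I J x hJ
    have hgt : I < I ⊔ Ideal.span {x} := by
      refine lt_of_le_of_ne le_sup_left fun h => hx ?_
      rw [h]
      exact Ideal.mem_sup_right (Ideal.mem_span_singleton_self x)
    have hgt' : I < J := by
      refine lt_of_le_of_ne (fun r hr => Ideal.mul_mem_left I _ hr) fun h => hy ?_
      rw [h]
      exact hxy
    have h3 : Subsingleton (Abelian.Ext.{u} (quotSC I J x hJ).X₃ N i) := ih _ hgt i hi
    have h1 : Subsingleton (Abelian.Ext.{u} (quotSC I J x hJ).X₁ N i) := ih _ hgt' i hi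
    refine ⟨fun a b => ?_⟩
    suffices ∀ a : Abelian.Ext.{u} (quotSC I J x hJ).X₂ N i, a = 0 by
      exact (this a).trans (this b).symm
    intro a
    obtain ⟨c, rfl⟩ := Abelian.Ext.contravariant_sequence_exact₂ hS N a (Subsingleton.elim _ _)
    rw [Subsingleton.elim c 0, Abelian.Ext.comp_zero]

lemma injDim_of_quot (n : ℕ) (N : ModuleCat.{u} R)
    (h : ∀ I : Ideal R, Subsingleton (Abelian.Ext.{u} (ModuleCat.of R (R ⧸ I)) N (n+1))) :
    HasInjectiveDimensionLT N (n+1) := by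
  induction n generalizing N with
  | zero =>
    rw [zero_add, ← injective_iff_hasInjectiveDimensionLT_one]
    have : Module.Injective R N := by
      refine Module.Baer.injective fun I f => ?_
      have hz : Submodule.mkQ I ∘ₗ Submodule.subtype I = 0 := by
        refine LinearMap.ext fun r => ?_
        exact (Submodule.Quotient.mk_eq_zero _).2 r.2
      let S := mkSC _ _ hz
      have hS : S.ShortExact := mkSC_shortExact _ _ _ Subtype.val_injective
        (Submodule.mkQ_surjective _)
        fun r hr => ⟨⟨r, (Submodule.Quotient.mk_eq_zero _).1 hr⟩, rfl⟩
      have h3 : Subsingleton (Abelian.Ext.{u} S.X₃ N 1) := h I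
      obtain ⟨e, he⟩ := Abelian.Ext.contravariant_sequence_exact₁ hS N (n₀ := 0) (n₁ := 1)
          (Abelian.Ext.mk₀ (ModuleCat.ofHom f : S.X₁ ⟶ N)) rfl (Subsingleton.elim _ _)
      obtain ⟨e, rfl⟩ := Abelian.Ext.homEquiv₀.symm.surjective e
      have he : S.f ≫ e = ModuleCat.ofHom f := by
        apply Abelian.Ext.homEquiv₀.symm.injective
        simpa using he
      refine ⟨e.hom, fun r hr => ?_⟩
      exact congrArg (fun φ : S.X₁ ⟶ N => φ.hom (⟨r, hr⟩ : I)) he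
    exact Module.injective_object_of_injective_module R N
  | succ n ih =>
    obtain ⟨⟨E, _, ι, _⟩⟩ := EnoughInjectives.presentation N
    let S := ShortComplex.mk ι (cokernel.π ι) (cokernel.condition ι)
    have hS : S.ShortExact := { exact := ShortComplex.exact_cokernel ι }
    have hE : HasInjectiveDimensionLT S.X₂ (n+1+1) := by
      have : HasInjectiveDimensionLT E 1 := inferInstance
      exact hasInjectiveDimensionLT_of_ge E 1 _ (by omega)
    refine hS.hasInjectiveDimensionLT_X₁ _ (ih S.X₃ fun I => ?_) hE
    refine ⟨fun a b => ?_⟩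
    suffices ∀ a : Abelian.Ext.{u} (ModuleCat.of R (R ⧸ I)) S.X₃ (n+1), a = 0 by
      exact (this a).trans (this b).symm
    intro a
    have := h I
    obtain ⟨c, rfl⟩ := Abelian.Ext.covariant_sequence_exact₃ _ hS a (n₁ := n+1+1) rfl
      (Subsingleton.elim (α := Abelian.Ext.{u} (ModuleCat.of R (R ⧸ I)) N (n+1+1)) _ _)
    have hc : c = 0 := by
      have : HasInjectiveDimensionLT S.X₂ 1 := inferInstanceAs (HasInjectiveDimensionLT E 1)
      exact (HasInjectiveDimensionLT.subsingleton S.X₂ 1 (n+1) (by omega) _).elim _ _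
    rw [hc, Abelian.Ext.zero_comp]

lemma pd_of_pd_residue [IsNoetherianRing R] [IsLocalRing R] (n : ℕ) (hn : 1 ≤ n)
    (hk : HasProjectiveDimensionLT (ModuleCat.of R (R ⧸ maximalIdeal R)) n)
    (M : ModuleCat.{u} R) : HasProjectiveDimensionLT M n := by
  obtain ⟨n, rfl⟩ : ∃ j, n = j + 1 := ⟨n - 1, by omega⟩
  have h1 : ∀ I : Ideal R, HasProjectiveDimensionLT (ModuleCat.of R (R ⧸ I)) (n+1) := fun I =>
    ModuleCat.hasProjectiveDimensionLT_of_forall_finite _ _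
      fun L _ => ext_quot_aux (n+1) hk L I _ le_rfl
  have h2 : ∀ N : ModuleCat.{u} R, HasInjectiveDimensionLT N (n+1) := fun N =>
    injDim_of_quot n N fun I => by
      have := h1 I
      exact HasProjectiveDimensionLT.subsingleton _ (n+1) (n+1) le_rfl N
  refine HasProjectiveDimensionLT.mk fun i hi Y e => ?_
  have := h2 Y
  exact (HasInjectiveDimensionLT.subsingleton Y (n+1) i hi M).elim _ _

end P2

section P3

variable {A : Type u} [CommRing A] (I : Ideal A)

/-- `M/IM`. -/
abbrev QM (M : Type u) [AddCommGroup M] [Module A M] : Type u := M ⧸ (I • ⊤ : Submodule A M)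

/-- The map induced on `M/IM`. -/
noncomputable def QMmap {M N : Type u} [AddCommGroup M] [Module A M] [AddCommGroup N] [Module A N]
    (f : M →ₗ[A] N) : QM I M →ₗ[A ⧸ I] QM I N :=
  LinearMap.extendScalarsOfSurjective (Ideal.Quotient.mk_surjective (I := I))
    (Submodule.mapQ (I • ⊤ : Submodule A M) (I • ⊤ : Submodule A N) f (by
      rw [← Submodule.map_le_iff_le_comap, Submodule.map_smul'']
      exact Submodule.smul_mono le_rfl le_top))

lemma QMmap_mk {M N : Type u} [AddCommGroup M] [Module A M] [AddCommGroup N] [Module A N]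
    (f : M →ₗ[A] N) (m : M) :
    QMmap I f (Submodule.Quotient.mk m) = Submodule.Quotient.mk (f m) := rfl

lemma QM_projective (M : Type u) [AddCommGroup M] [Module A M] [Module.Projective A M] :
    Module.Projective (A ⧸ I) (QM I M) :=
  Module.Projective.of_equiv
    ((TensorProduct.quotTensorEquivQuotSMul M I).extendScalarsOfSurjective
      (Ideal.Quotient.mk_surjective (I := I)))

lemma QM_eq_zero_iff (g : A) {M : Type u} [AddCommGroup M] [Module A M] (m : M) :
    (Submodule.Quotient.mk m : QM (Ideal.span {g}) M) = 0 ↔ ∃ m', g • m' = m := by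
  rw [Submodule.Quotient.mk_eq_zero, Submodule.ideal_span_singleton_smul,
    Submodule.mem_smul_pointwise_iff_exists]
  simp

lemma pd_QM (g : A) (hg : g ∈ nonZeroDivisors A) (n : ℕ) (M : Type u) [AddCommGroup M] [Module A M]
    (hM : ∀ m : M, g • m = 0 → m = 0)
    (hpd : HasProjectiveDimensionLT (ModuleCat.of A M) (n+1)) :
    HasProjectiveDimensionLT (ModuleCat.of (A ⧸ Ideal.span {g}) (QM (Ideal.span {g}) M)) (n+1) := by
  induction n generalizing M with
  | zero =>
    rw [zero_add, ← projective_iff_hasProjectiveDimensionLT_one,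
      ← IsProjective.iff_projective] at hpd ⊢
    exact QM_projective _ M
  | succ n ih =>
    let f : (M →₀ A) →ₗ[A] M := Finsupp.linearCombination A id
    have hf : Function.Surjective f := Finsupp.linearCombination_id_surjective A M
    let K : Submodule A (M →₀ A) := LinearMap.ker f
    have hz : f ∘ₗ K.subtype = 0 := LinearMap.ext fun x => x.2
    have hS := mkSC_shortExact K.subtype f hz Subtype.val_injective hf
      (fun y hy => Exists.intro (⟨y, LinearMap.mem_ker.2 hy⟩ : K) rfl)
    have hP : Projective (ModuleCat.of A (M →₀ A)) :=
      (IsProjective.iff_projective (M →₀ A)).1 inferInstance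
    have hFreg : ∀ m : M →₀ A, g • m = 0 → m = 0 := by
      intro m hm
      ext i
      have : g * m i = 0 := DFunLike.congr_fun hm i
      exact (mul_right_mem_nonZeroDivisors_eq_zero_iff hg).1 (by rwa [mul_comm])
    have hK : HasProjectiveDimensionLT (ModuleCat.of A K) (n+1) :=
      (hS.hasProjectiveDimensionLT_X₃_iff n hP).1 hpd
    have hKreg : ∀ m : K, g • m = 0 → m = 0 := by
      intro m hm
      exact Subtype.ext (hFreg m (congrArg Subtype.val hm))
    have ihK := ih K hKreg hK
    have hz' : QMmap (Ideal.span {g}) f ∘ₗ QMmap (M := K) (Ideal.span {g}) K.subtype = 0 := by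
      refine LinearMap.ext fun x => ?_
      obtain ⟨x, rfl⟩ := Submodule.Quotient.mk_surjective _ x
      rw [LinearMap.comp_apply, QMmap_mk, QMmap_mk]
      have : f (K.subtype x) = 0 := x.2
      rw [this]; rfl
    have hS' : (mkSC _ _ hz').ShortExact := by
      refine mkSC_shortExact _ _ hz' ?_ ?_ ?_
      · refine (injective_iff_map_eq_zero _).2 fun x hx => ?_
        obtain ⟨x, rfl⟩ := Submodule.Quotient.mk_surjective _ x
        rw [QMmap_mk, QM_eq_zero_iff] at hx
        obtain ⟨y, hy⟩ := hx
        rw [QM_eq_zero_iff]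
        have hfy : f y = 0 := by
          apply hM
          rw [← map_smul, hy]
          exact x.2
        exact ⟨⟨y, hfy⟩, Subtype.ext hy⟩
      · intro x
        obtain ⟨x, rfl⟩ := Submodule.Quotient.mk_surjective _ x
        obtain ⟨y, rfl⟩ := hf x
        exact ⟨Submodule.Quotient.mk y, rfl⟩
      · intro x hx
        obtain ⟨x, rfl⟩ := Submodule.Quotient.mk_surjective _ x
        rw [QMmap_mk, QM_eq_zero_iff] at hx
        obtain ⟨y, hy⟩ := hx
        obtain ⟨y, rfl⟩ := hf y
        refine ⟨Submodule.Quotient.mk ⟨x - g • y, ?_⟩, ?_⟩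
        · rw [LinearMap.mem_ker, map_sub, map_smul, hy, sub_self]
        · rw [QMmap_mk, ← sub_eq_zero, ← Submodule.Quotient.mk_sub, QM_eq_zero_iff]
          exact ⟨-y, by simp⟩
    have hP' : Projective (mkSC _ _ hz').X₂ :=
      (IsProjective.iff_projective (QM (Ideal.span {g}) (M →₀ A))).1 (QM_projective _ _)
    exact (hS'.hasProjectiveDimensionLT_X₃_iff n hP').2 ihK

lemma n_pos [IsLocalRing A] (g : A) (hg : g ∈ maximalIdeal A) (hreg : g ∈ nonZeroDivisors A)
    (h : HasProjectiveDimensionLT (ModuleCat.of A (A ⧸ Ideal.span {g})) 1) : False := by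
  rw [← projective_iff_hasProjectiveDimensionLT_one, ← IsProjective.iff_projective] at h
  obtain ⟨s, hs⟩ := Module.projective_lifting_property (Submodule.mkQ (Ideal.span {g}))
    LinearMap.id (Submodule.mkQ_surjective _)
  have h1 : (Submodule.Quotient.mk (s (Submodule.Quotient.mk 1)) : A ⧸ Ideal.span {g}) =
      Submodule.Quotient.mk 1 := LinearMap.congr_fun hs _
  have h2 : g * s (Submodule.Quotient.mk 1) = 0 := by
    rw [← smul_eq_mul, ← map_smul, ← Submodule.Quotient.mk_smul]
    have : (Submodule.Quotient.mk (g • (1 : A)) : A ⧸ Ideal.span {g}) = 0 :=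
      (Submodule.Quotient.mk_eq_zero _).2
        (by simp)
    rw [this, map_zero]
  have h3 : s (Submodule.Quotient.mk 1) = 0 :=
    (mul_right_mem_nonZeroDivisors_eq_zero_iff hreg).1 (by rwa [mul_comm])
  rw [h3, eq_comm, Submodule.Quotient.mk_zero, Submodule.Quotient.mk_eq_zero] at h1
  have h4 : (1 : A) ∈ maximalIdeal A :=
    (Ideal.span_singleton_le_iff_mem _).2 hg h1
  exact (Ideal.ne_top_iff_one _).1 (IsLocalRing.maximalIdeal.isMaximal A).ne_top h4

lemma exists_functional [IsLocalRing A] (g : A) (hg : g ∈ maximalIdeal A)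
    (hg2 : g ∉ (maximalIdeal A) ^ 2) :
    ∃ φ : maximalIdeal A →ₗ[A] (A ⧸ maximalIdeal A), φ ⟨g, hg⟩ = 1 := by
  have hne : (maximalIdeal A).toCotangent ⟨g, hg⟩ ≠ 0 := by
    rw [Ne, Ideal.toCotangent_eq_zero]
    exact hg2
  have hne' : ((maximalIdeal A).toCotangent ⟨g, hg⟩ : CotangentSpace A) ∉
      (⊥ : Submodule (ResidueField A) (CotangentSpace A)) := by
    rw [Submodule.mem_bot]
    exact hne
  obtain ⟨φ, -, hφ⟩ := LinearMap.exists_extend_of_notMem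
    (0 : (⊥ : Submodule (ResidueField A) (CotangentSpace A)) →ₗ[ResidueField A] ResidueField A)
    hne' 1
  exact ⟨(φ.restrictScalars A) ∘ₗ (maximalIdeal A).toCotangent, hφ⟩

lemma pd_residue [IsNoetherianRing A] [IsLocalRing A] (n : ℕ)
    (h : ∀ M : ModuleCat.{u} A, HasProjectiveDimensionLT M (n+1))
    (g : A) (hg : g ∈ maximalIdeal A) (hg2 : g ∉ (maximalIdeal A) ^ 2)
    (hreg : g ∈ nonZeroDivisors A) : 1 ≤ n ∧
    HasProjectiveDimensionLT (ModuleCat.of (A ⧸ Ideal.span {g}) ((A ⧸ Ideal.span {g}) ⧸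
      (maximalIdeal A).map (Ideal.Quotient.mk (Ideal.span {g})))) n := by
  have hn : 1 ≤ n := by
    by_contra hc
    obtain rfl : n = 0 := by omega
    exact n_pos g hg hreg (h _)
  refine ⟨hn, ?_⟩
  let m := maximalIdeal A
  let A' := A ⧸ Ideal.span {g}
  let k' := A' ⧸ m.map (Ideal.Quotient.mk (Ideal.span {g}))
  have hm : HasProjectiveDimensionLT (ModuleCat.of A m) n := by
    have hz : Submodule.mkQ m ∘ₗ Submodule.subtype m = 0 := by
      refine LinearMap.ext fun r => ?_
      exact (Submodule.Quotient.mk_eq_zero _).2 r.2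
    have hS : (mkSC _ _ hz).ShortExact := mkSC_shortExact _ _ _ Subtype.val_injective
      (Submodule.mkQ_surjective _)
      fun r hr => ⟨⟨r, (Submodule.Quotient.mk_eq_zero _).1 hr⟩, rfl⟩
    have hP : Projective (ModuleCat.of A A) := (IsProjective.iff_projective A).1 inferInstance
    exact hS.hasProjectiveDimensionLT_X₁ n
      (hasProjectiveDimensionLT_of_ge (ModuleCat.of A A) 1 n hn) (h _)
  have hq : HasProjectiveDimensionLT (ModuleCat.of A' (QM (Ideal.span {g}) m)) n := by
    obtain ⟨j, rfl⟩ : ∃ j, n = j + 1 := ⟨n - 1, by omega⟩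
    refine pd_QM g hreg j m (fun x hx => ?_) hm
    have : g * (x : A) = 0 := congrArg Subtype.val hx
    exact Subtype.ext ((mul_right_mem_nonZeroDivisors_eq_zero_iff hreg).1 (by rwa [mul_comm]))
  obtain ⟨φ, hφ⟩ := exists_functional g hg hg2
  let c : (A ⧸ m) →ₗ[A] k' := Submodule.liftQ m (Algebra.linearMap A k') (by
    intro a ha
    rw [LinearMap.mem_ker]
    exact (Submodule.Quotient.mk_eq_zero _).2 (Ideal.mem_map_of_mem _ ha))
  let r0 : QM (Ideal.span {g}) m →ₗ[A] k' := Submodule.liftQ _ (c ∘ₗ φ) (by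
    rw [Submodule.ideal_span_singleton_smul]
    intro x hx
    obtain ⟨y, -, rfl⟩ := (Submodule.mem_smul_pointwise_iff_exists _ _ _).1 hx
    rw [LinearMap.mem_ker, LinearMap.comp_apply, map_smul]
    have : g • φ y = 0 := by
      obtain ⟨z, hz⟩ := Submodule.Quotient.mk_surjective _ (φ y)
      rw [← hz, ← Submodule.Quotient.mk_smul, Submodule.Quotient.mk_eq_zero]
      exact Ideal.mul_mem_right _ _ hg
    rw [this, map_zero])
  let r : QM (Ideal.span {g}) m →ₗ[A'] k' :=
    LinearMap.extendScalarsOfSurjective (Ideal.Quotient.mk_surjective (I := Ideal.span {g})) r0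
  let gb : QM (Ideal.span {g}) m := Submodule.Quotient.mk ⟨g, hg⟩
  let i : k' →ₗ[A'] QM (Ideal.span {g}) m := Submodule.liftQ _ (LinearMap.toSpanSingleton A' _ gb)
    (by
      change m.map (Ideal.Quotient.mk (Ideal.span {g})) ≤ _
      rw [Ideal.map_le_iff_le_comap]
      intro a ha
      change (LinearMap.toSpanSingleton A' (QM (Ideal.span {g}) m) gb)
        (Ideal.Quotient.mk (Ideal.span {g}) a) = 0
      change (Submodule.Quotient.mk (a • (⟨g, hg⟩ : m)) : QM (Ideal.span {g}) m) = 0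
      rw [QM_eq_zero_iff]
      exact ⟨⟨a, ha⟩, Subtype.ext (mul_comm _ _)⟩)
  have hri : r ∘ₗ i = LinearMap.id := by
    refine LinearMap.ext fun x => ?_
    obtain ⟨x, rfl⟩ := Submodule.Quotient.mk_surjective _ x
    change r (x • gb) = _
    have : r gb = Submodule.Quotient.mk 1 := by
      change c (φ ⟨g, hg⟩) = _
      rw [hφ]
      rfl
    rw [map_smul, this, ← Submodule.Quotient.mk_smul, smul_eq_mul, mul_one]
    rfl
  have ret : Retract (ModuleCat.of A' k') (ModuleCat.of A' (QM (Ideal.span {g}) m)) :=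
    { i := ModuleCat.ofHom i
      r := ModuleCat.ofHom r
      retract := by rw [← ModuleCat.ofHom_comp, hri]; rfl }
  exact ret.hasProjectiveDimensionLT n

end P3

theorem tor_quotient_residueField_eq_zero
    (A : Type u) [CommRing A] [IsNoetherianRing A] [IsLocalRing A]
    (n : ℕ) (hgl : gldh A = (n : ℕ∞))
    (g : A) (hg : g ∈ maximalIdeal A) (hg2 : g ∉ (maximalIdeal A) ^ 2)
    (hreg : g ∈ nonZeroDivisors A) :
    (∀ q : ℕ, n ≤ q →
      IsZero (((Tor (ModuleCat.{u} (A ⧸ Ideal.span {g})) q).obj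
        (ModuleCat.of (A ⧸ Ideal.span {g}) (quotResidueField A g))).obj
        (ModuleCat.of (A ⧸ Ideal.span {g}) (quotResidueField A g)))) ∧
    gldh (A ⧸ Ideal.span {g}) ≠ ⊤ := by
  obtain ⟨hn, hk⟩ := pd_residue n (hasPD_of_gldh n hgl) g hg hg2 hreg
  have hle : Ideal.span {g} ≤ maximalIdeal A := (Ideal.span_singleton_le_iff_mem _).2 hg
  have hnt : Nontrivial (A ⧸ Ideal.span {g}) := Ideal.Quotient.nontrivial_iff.2 fun h =>
    (IsLocalRing.maximalIdeal.isMaximal A).ne_top (top_le_iff.1 (h ▸ hle))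
  have hloc : IsLocalRing (A ⧸ Ideal.span {g}) :=
    IsLocalRing.of_surjective' (Ideal.Quotient.mk (Ideal.span {g})) Ideal.Quotient.mk_surjective
  refine ⟨fun q hq => ?_, ?_⟩
  · have hk' : HasProjectiveDimensionLT
        (ModuleCat.of (A ⧸ Ideal.span {g}) (quotResidueField A g)) n := hk
    exact isZero_Tor_of_pd _ _ n hn q hq
  · have hmax : (maximalIdeal A).map (Ideal.Quotient.mk (Ideal.span {g})) =
        maximalIdeal (A ⧸ Ideal.span {g}) := by
      have : ((maximalIdeal A).map (Ideal.Quotient.mk (Ideal.span {g}))).IsMaximal := by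
        refine (Ideal.map_eq_top_or_isMaximal_of_surjective _ Ideal.Quotient.mk_surjective
          (IsLocalRing.maximalIdeal.isMaximal A)).resolve_left fun h => ?_
        have h2 := Ideal.comap_map_of_surjective _
          (Ideal.Quotient.mk_surjective (I := Ideal.span {g})) (maximalIdeal A)
        rw [h, Ideal.comap_top, ← RingHom.ker_eq_comap_bot, Ideal.mk_ker, sup_eq_left.2 hle] at h2
        exact (IsLocalRing.maximalIdeal.isMaximal A).ne_top h2.symm
      exact IsLocalRing.eq_maximalIdeal this
    rw [hmax] at hk
    exact gldh_ne_top n (pd_of_pd_residue n hn hk)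
end
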